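/- (Hardy–Littlewood Lemma 18) Fix a and b with 1/2 < a ≤ b. There exists c₀ > 0 such that for every c with 0 < c ≤ c₀ there exist C > 0 and T₀ > 0 with the following property: for all T ≥ T₀, all U with T^a ≤ U ≤ T^b, and all H with 0 < H ≤ T^c, one has |∫_T^{T+U} ( ∫_t^{t+H} X(u) du )² dt − π·√(2π)·H·U| ≤ C·U/ln T. -/

import Mathlib

open Filter Topology

noncomputable def XiF (t : ℝ) : ℝ :=
  (((1/2 + Complex.I * t) * ((1/2 + Complex.I * t) - 1) / 2) *
    (Real.pi : ℂ) ^ (-(1/2 + Complex.I * t) / 2) *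
    Complex.Gamma ((1/2 + Complex.I * t) / 2) *
    riemannZeta (1/2 + Complex.I * t)).re

noncomputable def XHL (t : ℝ) : ℝ :=
  -(t ^ ((1:ℝ)/4) * Real.exp (Real.pi * t / 4) / (1/4 + t ^ 2)) * XiF t

lemma Complex.log_add_one_sub_log {w : ℂ} (hw : 0 < w.re) :
    Complex.log (w + 1) = Complex.log w + Complex.log (1 + 1 / w) := by
  have hw0 : w ≠ 0 := by rintro rfl; simp at hw
  have h1 : w + 1 = w * (1 + 1 / w) := by field_simp
  have hinv : 0 < (1 + 1 / w).re := by
    have : 0 < (1 / w).re := by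
      rw [one_div, Complex.inv_re]; exact div_pos hw (Complex.normSq_pos.2 hw0)
    simp only [Complex.add_re, Complex.one_re]; linarith
  have h2 : (1 + 1 / w) ≠ 0 := by intro h; rw [h] at hinv; simp at hinv
  rw [h1, Complex.log_mul hw0 h2]
  have a1 := Complex.abs_arg_lt_pi_div_two_iff.2 (Or.inl hw)
  have a2 := Complex.abs_arg_lt_pi_div_two_iff.2 (Or.inl hinv)
  rw [abs_lt] at a1 a2
  constructor <;> linarith [a1.1, a1.2, a2.1, a2.2]

lemma norm_stirling_step_le {w : ℂ} (hw2 : 2 ≤ ‖w‖) :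
    ‖(w + 1 / 2) * Complex.log (1 + 1 / w) - 1‖ ≤ 2 / ‖w‖ ^ 2 := by
  have hpos : 0 < ‖w‖ := by linarith
  have hw0 : w ≠ 0 := norm_pos_iff.1 hpos
  have hz : ‖1 / w‖ ≤ 1 / 2 := by
    rw [norm_div, norm_one]; gcongr
  have hb := Complex.norm_log_sub_logTaylor_le 2 (z := 1 / w) (by linarith)
  have ht : Complex.logTaylor (2 + 1) (1 / w) = 1 / w - 1 / (2 * w ^ 2) := by
    simp [Complex.logTaylor, Finset.sum_range_succ]
    field_simp
    ring
  rw [ht] at hb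
  set E := Complex.log (1 + 1 / w) - (1 / w - 1 / (2 * w ^ 2)) with hE
  have hE' : ‖E‖ ≤ (2 / 3) * (1 / ‖w‖ ^ 3) := by
    refine hb.trans ?_
    have h3 : (1 - ‖1 / w‖)⁻¹ ≤ 2 := by
      rw [inv_le_comm₀ (by linarith) (by norm_num)]; linarith
    have h4 : ‖1 / w‖ ^ (2 + 1) = 1 / ‖w‖ ^ 3 := by simp
    rw [h4]
    have h5 : 0 ≤ 1 / ‖w‖ ^ 3 := by positivity
    push_cast
    nlinarith
  have heq : (w + 1 / 2) * Complex.log (1 + 1 / w) - 1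
      = (w + 1 / 2) * E - 1 / (4 * w ^ 2) := by
    rw [hE]; field_simp; ring
  rw [heq]
  calc ‖(w + 1 / 2) * E - 1 / (4 * w ^ 2)‖ ≤ ‖(w + 1 / 2)‖ * ‖E‖ + ‖1 / (4 * w ^ 2)‖ := by
        refine (norm_sub_le _ _).trans ?_; rw [norm_mul]
    _ ≤ (5 / 4 * ‖w‖) * ((2 / 3) * (1 / ‖w‖ ^ 3)) + 1 / (4 * ‖w‖ ^ 2) := by
        gcongr
        · refine (norm_add_le _ _).trans ?_
          norm_num; linarith
        · simp
    _ ≤ 2 / ‖w‖ ^ 2 := by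
        have h6 : (5 / 4 * ‖w‖) * ((2 / 3) * (1 / ‖w‖ ^ 3)) + 1 / (4 * ‖w‖ ^ 2)
          = (13 / 12) / ‖w‖ ^ 2 := by field_simp; norm_num
        rw [h6]; gcongr; norm_num

/-- The leading Stirling factor `z ^ (z - 1/2) e ^ (-z)`. -/
noncomputable def stirlingMain (z : ℂ) : ℂ :=
  Complex.exp ((z - 1 / 2) * Complex.log z - z)

/-- The increment of the logarithm of the Stirling correction. -/
noncomputable def stirlingStep (w : ℂ) : ℂ :=
  (w + 1 / 2) * Complex.log (1 + 1 / w) - 1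

lemma stirlingMain_add_one {z : ℂ} (hz : 0 < z.re) :
    stirlingMain (z + 1) = stirlingMain z * (z * Complex.exp (stirlingStep z)) := by
  have hz0 : z ≠ 0 := by rintro rfl; simp at hz
  unfold stirlingMain stirlingStep
  rw [Complex.log_add_one_sub_log hz]
  have h : z * Complex.exp ((z + 1 / 2) * Complex.log (1 + 1 / z) - 1) =
      Complex.exp (Complex.log z + ((z + 1 / 2) * Complex.log (1 + 1 / z) - 1)) := by
    rw [Complex.exp_add, Complex.exp_log hz0]
  rw [h, ← Complex.exp_add]
  congr 1; ring

lemma stirlingMain_add_nat {z : ℂ} (hz : 0 < z.re) (n : ℕ) :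
    stirlingMain (z + n) = stirlingMain z * (∏ j ∈ Finset.range n, (z + j)) *
      Complex.exp (∑ j ∈ Finset.range n, stirlingStep (z + j)) := by
  induction n with
  | zero => simp
  | succ n ih =>
    have : 0 < (z + n).re := by simp; positivity
    push_cast
    rw [← add_assoc, stirlingMain_add_one this, ih, Finset.prod_range_succ, Finset.sum_range_succ,
      Complex.exp_add]
    ring

lemma tendsto_factorial_div_stirlingMain {z : ℂ} (hz : 0 < z.re) :
    Tendsto (fun n : ℕ => (n : ℂ) ^ z * n.factorial / stirlingMain (z + (n + 1 : ℕ))) atTop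
      (𝓝 (Real.sqrt (2 * Real.pi))) := by
  have hlog : Tendsto (fun n : ℕ => (n : ℂ) * Complex.log (1 + (z + 1) / n)) atTop (𝓝 (z + 1)) := by
    apply Complex.tendsto_nat_mul_log_one_add_of_tendsto
    refine tendsto_const_nhds.congr' ?_
    filter_upwards [eventually_gt_atTop 0] with n hn
    have hnC : (n : ℂ) ≠ 0 := by exact_mod_cast hn.ne'
    field_simp
  have hsmall : Tendsto (fun n : ℕ => (z + 1 / 2) * Complex.log (1 + (z + 1) / n)) atTop (𝓝 0) := by
    have h0 : Tendsto (fun n : ℕ => (1 : ℂ) + (z + 1) / n) atTop (𝓝 1) := by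
      simpa using (tendsto_const_div_atTop_nhds_zero_nat (z + 1)).const_add 1
    have := (h0.clog (by simp)).const_mul (z + 1 / 2)
    simpa using this
  have hexp : Tendsto (fun n : ℕ => Complex.exp (z + 1 - ((n : ℂ) * Complex.log (1 + (z + 1) / n)
      + (z + 1 / 2) * Complex.log (1 + (z + 1) / n)))) atTop (𝓝 1) := by
    have := (((hlog.add hsmall).const_sub (z + 1)).cexp)
    simpa using this
  have hst : Tendsto (fun n : ℕ => ((Real.sqrt 2 * Stirling.stirlingSeq n : ℝ) : ℂ)) atTop
      (𝓝 ((Real.sqrt (2 * Real.pi) : ℝ) : ℂ)) := by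
    rw [Real.sqrt_mul (by norm_num)]
    exact (Complex.continuous_ofReal.tendsto _).comp
      (Stirling.tendsto_stirlingSeq_sqrt_pi.const_mul _)
  have := hst.mul hexp
  rw [mul_one] at this
  refine this.congr' ?_
  filter_upwards [eventually_gt_atTop 0] with n hn
  have hnR : (0 : ℝ) < n := by exact_mod_cast hn
  have hnC : (n : ℂ) ≠ 0 := by exact_mod_cast hn.ne'
  have hne : 1 + (z + 1) / n ≠ 0 := by
    intro h
    have h1 := congrArg Complex.re h
    have : 0 < ((z + 1) / n).re := by
      rw [Complex.div_natCast_re]; simp; positivity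
    rw [Complex.add_re] at h1; simp only [Complex.one_re, Complex.zero_re] at h1; linarith
  have hl : Complex.log (z + (n + 1 : ℕ)) = Complex.log n + Complex.log (1 + (z + 1) / n) := by
    have e : z + ((n + 1 : ℕ) : ℂ) = ((n : ℝ) : ℂ) * (1 + (z + 1) / n) := by
      push_cast; field_simp; ring
    rw [e, Complex.log_ofReal_mul hnR hne, ← Complex.ofReal_natCast n,
      Complex.ofReal_log hnR.le]
  have hS : stirlingMain (z + (n + 1 : ℕ)) ≠ 0 := Complex.exp_ne_zero _
  rw [eq_div_iff hS]
  have hfac : ((n.factorial : ℝ) : ℂ) = ((Real.sqrt 2 * Stirling.stirlingSeq n : ℝ) : ℂ) *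
      Complex.exp ((n + 1 / 2) * Complex.log n - n) := by
    have e1 : Complex.exp ((n + 1 / 2) * Complex.log n - n) =
        ((Real.exp ((n + 1 / 2) * Real.log n - n) : ℝ) : ℂ) := by
      push_cast [Complex.natCast_log]; rfl
    rw [e1, ← Complex.ofReal_mul]
    congr 1
    unfold Stirling.stirlingSeq
    have e2 : Real.exp (n * Real.log n) = (n : ℝ) ^ n := by
      rw [Real.exp_nat_mul, Real.exp_log hnR]
    have e3 : Real.exp (1 / 2 * Real.log n) = Real.sqrt n := by
      rw [Real.sqrt_eq_rpow, Real.rpow_def_of_pos hnR, mul_comm]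
    have e4 : Real.exp (n : ℝ) = Real.exp 1 ^ n := by rw [← Real.exp_nat_mul, mul_one]
    rw [Real.exp_sub, add_mul, Real.exp_add, e2, e3, e4, div_pow, Real.sqrt_mul (by norm_num)]
    field_simp
  rw [Complex.ofReal_natCast] at hfac
  rw [hfac, Complex.cpow_def_of_ne_zero hnC]
  unfold stirlingMain
  rw [hl]
  have : ∀ a b c d e : ℂ, b + c = d + e → a * Complex.exp b * Complex.exp c
      = Complex.exp d * (a * Complex.exp e) := by
    intro a b c d e h
    rw [mul_assoc, ← Complex.exp_add, h, Complex.exp_add]; ring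
  apply this
  push_cast
  ring

lemma sum_inv_sq_add_sq_le {y : ℝ} (hy : 1 ≤ y) (n : ℕ) :
    ∑ k ∈ Finset.range n, 1 / (y ^ 2 + (k : ℝ) ^ 2) ≤ 4 / y := by
  -- telescoping: `1/(y²+k²) ≤ 2/(y+k)² ≤ 2(1/(y+k-1/2) - 1/(y+k+1/2))`
  have hstep : ∀ k : ℕ, 1 / (y ^ 2 + (k : ℝ) ^ 2) ≤
      2 / (y + k - 1 / 2) - 2 / (y + ((k + 1 : ℕ) : ℝ) - 1 / 2) := by
    intro k
    have hk : (0 : ℝ) ≤ k := Nat.cast_nonneg k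
    have h1 : 0 < y + k - 1 / 2 := by linarith
    have h2 : 0 < y + ((k + 1 : ℕ) : ℝ) - 1 / 2 := by push_cast; linarith
    rw [div_sub_div _ _ h1.ne' h2.ne', div_le_div_iff₀ (by positivity) (by positivity)]
    push_cast
    nlinarith [sq_nonneg (y - k)]
  refine (Finset.sum_le_sum fun k _ => hstep k).trans ?_
  rw [Finset.sum_range_sub' (fun k : ℕ => 2 / (y + (k : ℝ) - 1 / 2))]
  have h2 : 0 ≤ 2 / (y + (n : ℝ) - 1 / 2) := by
    apply div_nonneg (by norm_num)
    have : (0 : ℝ) ≤ n := Nat.cast_nonneg n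
    linarith
  have h3 : 2 / (y + ((0 : ℕ) : ℝ) - 1 / 2) ≤ 4 / y := by
    rw [div_le_div_iff₀ (by push_cast; linarith) (by linarith)]
    push_cast
    linarith
  linarith

/-- **Stirling's formula** in the upper right quadrant. -/
theorem Complex.Gamma_stirling {z : ℂ} (hz : 0 < z.re) (hz2 : 2 ≤ z.im) :
    ∃ μ : ℂ, ‖μ‖ ≤ 8 / z.im ∧
      Complex.Gamma z = Real.sqrt (2 * Real.pi) * stirlingMain z * Complex.exp μ := by
  have hb : ∀ j : ℕ, ‖stirlingStep (z + j)‖ ≤ 2 * (1 / (z.im ^ 2 + (j : ℝ) ^ 2)) := by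
    intro j
    have hj : (0 : ℝ) ≤ j := Nat.cast_nonneg j
    have h1 : z.im ^ 2 + (j : ℝ) ^ 2 ≤ ‖z + j‖ ^ 2 := by
      rw [Complex.sq_norm, Complex.normSq_apply]
      simp only [Complex.add_re, Complex.natCast_re, Complex.add_im, Complex.natCast_im, add_zero]
      nlinarith
    have h2 : 2 ≤ ‖z + j‖ := by nlinarith [norm_nonneg (z + j)]
    refine (norm_stirling_step_le h2).trans ?_
    rw [mul_one_div]
    gcongr
  have hsum : ∀ n : ℕ, ∑ j ∈ Finset.range n, ‖stirlingStep (z + j)‖ ≤ 8 / z.im := by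
    intro n
    refine (Finset.sum_le_sum fun j _ => hb j).trans ?_
    rw [← Finset.mul_sum]
    have := sum_inv_sq_add_sq_le (y := z.im) (by linarith) n
    calc _ ≤ 2 * (4 / z.im) := by linarith
      _ = _ := by ring
  have hs : Summable fun j : ℕ => ‖stirlingStep (z + j)‖ :=
    summable_of_sum_range_le (fun _ => norm_nonneg _) hsum
  refine ⟨∑' j : ℕ, stirlingStep (z + j), ?_, ?_⟩
  · exact (norm_tsum_le_tsum_norm hs).trans (Real.tsum_le_of_sum_range_le (fun _ => norm_nonneg _) hsum)
  · have h1 : Tendsto (fun n : ℕ => Complex.exp (∑ j ∈ Finset.range (n + 1), stirlingStep (z + j)))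
        atTop (𝓝 (Complex.exp (∑' j : ℕ, stirlingStep (z + j)))) :=
      ((hs.of_norm.hasSum.tendsto_sum_nat).comp (tendsto_add_atTop_nat 1)).cexp
    have h2 := ((tendsto_factorial_div_stirlingMain hz).mul_const (stirlingMain z)).mul h1
    refine tendsto_nhds_unique (Complex.GammaSeq_tendsto_Gamma z) (h2.congr fun n => ?_)
    rw [stirlingMain_add_nat hz (n + 1), Complex.GammaSeq]
    have hp : ∏ j ∈ Finset.range (n + 1), (z + (j : ℂ)) ≠ 0 := by
      rw [Finset.prod_ne_zero_iff]
      intro j _ h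
      have := congrArg Complex.im h
      simp at this; linarith
    have hm : stirlingMain z ≠ 0 := Complex.exp_ne_zero _
    have he := Complex.exp_ne_zero (∑ j ∈ Finset.range (n + 1), stirlingStep (z + j))
    field_simp

/-- Stirling's formula on vertical lines in a fixed strip. -/
theorem Complex.Gamma_vertical {x y : ℝ} (hx : 1 / 4 ≤ x) (hx' : x ≤ 5 / 4) (hy : 2 ≤ y) :
    ∃ ν : ℂ, ‖ν‖ ≤ 14 / y ∧ Complex.Gamma (x + y * Complex.I) =
      Real.sqrt (2 * Real.pi) * Complex.exp (((x - 1 / 2) * Real.log y - Real.pi * y / 2 : ℝ) +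
        ((y * Real.log y - y + (x - 1 / 2) * (Real.pi / 2) : ℝ) : ℂ) * Complex.I + ν) := by
  have hy0 : 0 < y := by linarith
  have hyC : (y : ℂ) ≠ 0 := by exact_mod_cast hy0.ne'
  obtain ⟨μ, hμ, hG⟩ := Complex.Gamma_stirling (z := x + y * Complex.I)
    (by simp; linarith) (by simpa using hy)
  simp only [Complex.add_im, Complex.ofReal_im, Complex.mul_im, Complex.ofReal_re, Complex.I_im,
    mul_one, Complex.I_re, mul_zero, add_zero, zero_add] at hμ
  set u : ℂ := -(((x / y : ℝ) : ℂ) * Complex.I) with hu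
  have hun : ‖u‖ = x / y := by
    rw [hu, norm_neg, norm_mul, Complex.norm_I, mul_one, Complex.norm_real, Real.norm_eq_abs,
      abs_of_pos (by positivity)]
  have hub : ‖u‖ ≤ 5 / 8 := by
    rw [hun, div_le_iff₀ hy0]; linarith
  have hre : (1 + u).re = 1 := by simp [hu]
  have hu1 : 1 + u ≠ 0 := by intro h; rw [h] at hre; simp at hre
  have hlog : Complex.log (x + y * Complex.I) =
      Real.log y + (Real.pi / 2) * Complex.I + Complex.log (1 + u) := by
    have e : (x : ℂ) + y * Complex.I = (y : ℝ) * (Complex.I * (1 + u)) := by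
      rw [hu]; push_cast
      have := Complex.I_sq
      field_simp
      linear_combination (x : ℂ) * this
    have harg := Complex.abs_arg_lt_pi_div_two_iff.2 (Or.inl (by rw [hre]; norm_num : 0 < (1 + u).re))
    have hargle : (1 + u).arg ≤ 0 := by
      by_contra! h
      have : 0 ≤ (1 + u).im := Complex.arg_nonneg_iff.1 h.le
      have h2 : (1 + u).im = -(x / y) := by simp [hu, Complex.div_re]; field_simp
      have : 0 < x / y := by positivity
      linarith
    rw [e, Complex.log_ofReal_mul hy0 (mul_ne_zero Complex.I_ne_zero hu1),
      Complex.log_mul Complex.I_ne_zero hu1, Complex.log_I, add_assoc]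
    rw [abs_lt] at harg
    rw [Complex.arg_I]
    constructor <;> linarith [harg.1, harg.2, Real.pi_pos]
  set E := Complex.log (1 + u) - u with hE
  have hEb : ‖E‖ ≤ 3 / y ^ 2 := by
    refine (Complex.norm_log_one_add_sub_self_le (by linarith)).trans ?_
    have h3 : (1 - ‖u‖)⁻¹ ≤ 8 / 3 := by
      rw [inv_le_comm₀ (by linarith) (by norm_num)]; linarith
    have h4 : ‖u‖ ^ 2 ≤ (25 / 16) / y ^ 2 := by
      rw [hun, div_pow]; gcongr; nlinarith
    calc ‖u‖ ^ 2 * (1 - ‖u‖)⁻¹ / 2 ≤ (25 / 16) / y ^ 2 * (8 / 3) / 2 := by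
          have : 0 ≤ (1 - ‖u‖)⁻¹ := inv_nonneg.2 (by linarith)
          gcongr
      _ ≤ 3 / y ^ 2 := by
          rw [div_mul_eq_mul_div, div_div, div_le_div_iff₀ (by positivity) (by positivity)]
          nlinarith [sq_nonneg y]
  refine ⟨(x - 1 / 2 : ℝ) * Complex.log (1 + u) + y * Complex.I * E + μ, ?_, ?_⟩
  · have hl : ‖Complex.log (1 + u)‖ ≤ 3 / y := by
      have : Complex.log (1 + u) = u + E := by rw [hE]; ring
      rw [this]
      refine (norm_add_le _ _).trans ?_
      have : 3 / y ^ 2 ≤ (3 / 2) / y := by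
        rw [div_le_div_iff₀ (by positivity) (by positivity)]; nlinarith
      have h2 : x / y ≤ (5 / 4) / y := by gcongr
      have h5 : (5 / 4) / y + (3 / 2) / y ≤ 3 / y := by
        rw [← add_div]; gcongr; norm_num
      linarith
    have h1 : ‖((x - 1 / 2 : ℝ) : ℂ) * Complex.log (1 + u)‖ ≤ 3 / y := by
      rw [norm_mul, Complex.norm_real, Real.norm_eq_abs]
      have : |x - 1 / 2| ≤ 1 := by rw [abs_le]; constructor <;> linarith
      calc _ ≤ 1 * (3 / y) := by gcongr
        _ = _ := one_mul _
    have h2 : ‖(y : ℂ) * Complex.I * E‖ ≤ 3 / y := by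
      rw [norm_mul, norm_mul, Complex.norm_I, mul_one, Complex.norm_real, Real.norm_eq_abs,
        abs_of_pos hy0]
      calc y * ‖E‖ ≤ y * (3 / y ^ 2) := by gcongr
        _ = 3 / y := by field_simp
    refine (norm_add₃_le).trans ?_
    calc _ ≤ 3 / y + 3 / y + 8 / y := by gcongr
      _ = 14 / y := by ring
  · rw [hG, stirlingMain, mul_assoc, ← Complex.exp_add]
    congr 2
    rw [hlog]
    have hl : Complex.log (1 + u) = u + E := by rw [hE]; ring
    have hu' : (y : ℂ) * u = - x * Complex.I := by rw [hu]; push_cast; field_simp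
    have := Complex.I_sq
    push_cast
    rw [hl]
    linear_combination (Complex.I) * hu' + (-x + (Real.pi / 2 : ℂ) * y) * this

theorem Complex.exists_norm_Gamma_le_strip : ∃ C > (0 : ℝ), ∀ x y : ℝ, 1 / 4 ≤ x → x ≤ 5 / 4 →
    2 ≤ y → ‖Complex.Gamma (x + y * Complex.I)‖ ≤
      C * (y ^ (x - 1 / 2) * Real.exp (-(Real.pi * y / 2))) := by
  refine ⟨Real.sqrt (2 * Real.pi) * Real.exp 7, by positivity, fun x y hx hx' hy => ?_⟩
  obtain ⟨ν, hν, h⟩ := Complex.Gamma_vertical hx hx' hy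
  have hy0 : 0 < y := by linarith
  rw [h, norm_mul, Complex.norm_exp, Complex.norm_real, Real.norm_eq_abs,
    abs_of_nonneg (Real.sqrt_nonneg _), mul_assoc]
  gcongr
  rw [Real.rpow_def_of_pos hy0, ← Real.exp_add, ← Real.exp_add]
  gcongr
  have h7 : 14 / y ≤ 7 := by rw [div_le_iff₀ hy0]; linarith
  have := (Complex.re_le_norm ν).trans (hν.trans h7)
  simp
  linarith

/-- Uniform bound for the Gamma function on vertical lines, the abscissa being allowed to grow. -/
theorem Complex.exists_norm_Gamma_le : ∃ C > (0 : ℝ), ∀ x y : ℝ, 2 ≤ y → (|x| + 3) ^ 3 ≤ y ^ 2 →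
    ‖Complex.Gamma (x + y * Complex.I)‖ ≤
      C * (y ^ (x - 1 / 2) * Real.exp (-(Real.pi * y / 2))) := by
  obtain ⟨C, hC, hb⟩ := Complex.exists_norm_Gamma_le_strip
  refine ⟨C * Real.exp 1, by positivity, fun x y hy hxy => ?_⟩
  have hy0 : 0 < y := by linarith
  have hdown : ∀ (k : ℕ) (x : ℝ), 1 / 4 ≤ x → x ≤ 5 / 4 →
      ‖Complex.Gamma (((x - k : ℝ) : ℂ) + y * Complex.I)‖ ≤
      C * (y ^ (x - k - 1 / 2) * Real.exp (-(Real.pi * y / 2))) := by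
    intro k x hx hx'
    induction k with
    | zero => simpa using hb x y hx hx' hy
    | succ k ih =>
      set z : ℂ := ((x - (k + 1 : ℕ) : ℝ) : ℂ) + y * Complex.I with hz
      have hz1 : z + 1 = ((x - k : ℝ) : ℂ) + y * Complex.I := by rw [hz]; push_cast; ring
      have him : z.im = y := by simp [hz]
      have hz0 : z ≠ 0 := by intro h; rw [h] at him; simp at him; linarith
      have hzn : y ≤ ‖z‖ := by
        have := Complex.abs_im_le_norm z; rw [him, abs_of_pos hy0] at this; exact this
      rw [← hz1, Complex.Gamma_add_one z hz0, norm_mul] at ih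
      have e : y ^ (x - k - 1 / 2) = y * y ^ (x - (k + 1 : ℕ) - 1 / 2) := by
        rw [mul_comm, ← Real.rpow_add_one hy0.ne']; congr 1; push_cast; ring
      rw [e] at ih
      have h1 : y * ‖Complex.Gamma z‖ ≤
          y * (C * (y ^ (x - (k + 1 : ℕ) - 1 / 2) * Real.exp (-(Real.pi * y / 2)))) := by
        calc y * ‖Complex.Gamma z‖ ≤ ‖z‖ * ‖Complex.Gamma z‖ := by gcongr
          _ ≤ _ := ih
          _ = _ := by ring
      exact le_of_mul_le_mul_left h1 hy0
  have hup : ∀ (k : ℕ) (x : ℝ), 1 / 4 ≤ x → x ≤ 5 / 4 →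
      ‖Complex.Gamma (((x + k : ℝ) : ℂ) + y * Complex.I)‖ ≤
      C * (y ^ (x + k - 1 / 2) * Real.exp (-(Real.pi * y / 2))) *
        Real.exp (k * ((k + 5 / 4) ^ 2 / y ^ 2)) := by
    intro k x hx hx'
    induction k with
    | zero => simpa using hb x y hx hx' hy
    | succ k ih =>
      set z : ℂ := ((x + k : ℝ) : ℂ) + y * Complex.I with hz
      have hz1 : z + 1 = ((x + (k + 1 : ℕ) : ℝ) : ℂ) + y * Complex.I := by rw [hz]; push_cast; ring
      have him : z.im = y := by simp [hz]
      have hrez : z.re = x + k := by simp [hz]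
      have hz0 : z ≠ 0 := by intro h; rw [h] at him; simp at him; linarith
      have hk0 : (0 : ℝ) ≤ k := Nat.cast_nonneg k
      have hzn : ‖z‖ ≤ y * Real.exp ((k + 1 + 5 / 4) ^ 2 / y ^ 2) := by
        have h1 : ‖z‖ ^ 2 ≤ (y * Real.exp ((k + 1 + 5 / 4) ^ 2 / y ^ 2)) ^ 2 := by
          rw [Complex.sq_norm, Complex.normSq_apply, him, hrez, mul_pow, ← Real.exp_nat_mul]
          have h2 : 1 + (2 : ℕ) * ((k + 1 + 5 / 4) ^ 2 / y ^ 2) ≤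
              Real.exp ((2 : ℕ) * ((k + 1 + 5 / 4) ^ 2 / y ^ 2)) := by
            have := Real.add_one_le_exp ((2 : ℕ) * (((k : ℝ) + 1 + 5 / 4) ^ 2 / y ^ 2)); linarith
          calc (x + k) * (x + k) + y * y ≤ y ^ 2 + 2 * (k + 1 + 5 / 4) ^ 2 := by nlinarith
            _ = y ^ 2 * (1 + (2 : ℕ) * ((k + 1 + 5 / 4) ^ 2 / y ^ 2)) := by push_cast; field_simp
            _ ≤ _ := by gcongr
        exact abs_le_of_sq_le_sq' h1 (by positivity) |>.2
      rw [← hz1, Complex.Gamma_add_one z hz0, norm_mul]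
      have e : y ^ (x + (k + 1 : ℕ) - 1 / 2) = y * y ^ (x + k - 1 / 2) := by
        rw [mul_comm, ← Real.rpow_add_one hy0.ne']; congr 1; push_cast; ring
      rw [e]
      calc ‖z‖ * ‖Complex.Gamma z‖ ≤ (y * Real.exp ((k + 1 + 5 / 4) ^ 2 / y ^ 2)) *
            (C * (y ^ (x + k - 1 / 2) * Real.exp (-(Real.pi * y / 2))) *
              Real.exp (k * ((k + 1 + 5 / 4) ^ 2 / y ^ 2))) := by
            gcongr
            refine ih.trans ?_
            gcongr
            linarith
        _ = C * (y * y ^ (x + k - 1 / 2) * Real.exp (-(Real.pi * y / 2))) *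
            (Real.exp ((k + 1 + 5 / 4) ^ 2 / y ^ 2) * Real.exp (k * ((k + 1 + 5 / 4) ^ 2 / y ^ 2))) := by
            ring
        _ = _ := by
            rw [← Real.exp_add]; congr 2; push_cast; ring
  rcases le_total (1 / 4) x with hx | hx
  · set k := ⌊x - 1 / 4⌋₊ with hk
    have h1 : (k : ℝ) ≤ x - 1 / 4 := Nat.floor_le (by linarith)
    have h2 : x - 1 / 4 < k + 1 := Nat.lt_floor_add_one _
    have := hup k (x - k) (by linarith) (by linarith)
    rw [sub_add_cancel] at this
    refine this.trans ?_
    have hk0 : (0 : ℝ) ≤ k := Nat.cast_nonneg k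
    have h3 : k * ((k + 5 / 4) ^ 2 / y ^ 2) ≤ 1 := by
      rw [← mul_div_assoc, div_le_one (by positivity)]
      refine le_trans ?_ hxy
      have hxk : (k : ℝ) ≤ |x| := by rw [abs_of_pos (by linarith)]; linarith
      calc (k : ℝ) * (k + 5 / 4) ^ 2 ≤ (|x| + 3) * (|x| + 3) ^ 2 := by gcongr <;> linarith
        _ = _ := by ring
    calc _ ≤ C * (y ^ (x - 1 / 2) * Real.exp (-(Real.pi * y / 2))) * Real.exp 1 := by gcongr
      _ = _ := by ring
  · set k := ⌈1 / 4 - x⌉₊ with hk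
    have h1 : 1 / 4 - x ≤ k := Nat.le_ceil _
    have h2 : (k : ℝ) < 1 / 4 - x + 1 := Nat.ceil_lt_add_one (by linarith)
    have := hdown k (x + k) (by linarith) (by linarith)
    rw [add_sub_cancel_right] at this
    refine this.trans ?_
    have : 1 ≤ Real.exp 1 := Real.one_le_exp (by norm_num)
    have h0 : 0 ≤ y ^ (x - 1 / 2) * Real.exp (-(Real.pi * y / 2)) := by positivity
    calc _ ≤ (C * (y ^ (x - 1 / 2) * Real.exp (-(Real.pi * y / 2)))) * Real.exp 1 :=
          le_mul_of_one_le_right (by positivity) this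
      _ = _ := by ring

/-- The real weight normalising the completed zeta function on the critical line. -/
noncomputable def critWeight (t : ℝ) : ℝ := t ^ ((1 : ℝ) / 4) * Real.exp (Real.pi * t / 4) / 2

lemma critWeight_nonneg {t : ℝ} (ht : 0 ≤ t) : 0 ≤ critWeight t := by
  unfold critWeight; positivity

lemma completedRiemannZeta_eq_Gammaℝ_mul {s : ℂ} (hs : s.im ≠ 0) :
    completedRiemannZeta s = Complex.Gammaℝ s * riemannZeta s := by
  have hs0 : s ≠ 0 := by rintro rfl; simp at hs
  have hG : Complex.Gammaℝ s ≠ 0 := by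
    rw [Ne, Complex.Gammaℝ_eq_zero_iff]
    rintro ⟨n, rfl⟩
    apply hs; simp
  rw [riemannZeta_def_of_ne_zero hs0]; field_simp

lemma completedRiemannZeta_conj_of_im_ne_zero {s : ℂ} (hs : s.im ≠ 0) :
    completedRiemannZeta (starRingEnd ℂ s) = starRingEnd ℂ (completedRiemannZeta s) := by
  rw [completedRiemannZeta_eq_Gammaℝ_mul hs, completedRiemannZeta_eq_Gammaℝ_mul (by simpa using hs),
    riemannZeta_conj, map_mul, Complex.Gammaℝ_def, Complex.Gammaℝ_def, map_mul, ← Complex.Gamma_conj]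
  congr 2
  · have h := Complex.cpow_conj Real.pi (-s / 2)
      (by rw [Complex.arg_ofReal_of_nonneg Real.pi_pos.le]; exact Real.pi_pos.ne)
    rw [Complex.conj_ofReal] at h
    rw [← h]; simp [Complex.conj_ofNat]
  · simp [Complex.conj_ofNat]

lemma XHL_eq_critWeight_mul {t : ℝ} (ht : 0 < t) :
    XHL t = critWeight t * (completedRiemannZeta (1 / 2 + t * Complex.I)).re := by
  have e : (1 / 2 + Complex.I * t : ℂ) = 1 / 2 + t * Complex.I := by ring
  rw [completedRiemannZeta_eq_Gammaℝ_mul (by simp; exact ht.ne'), Complex.Gammaℝ_def]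
  unfold XHL XiF critWeight
  rw [e]
  have h1 : (1 / 2 + t * Complex.I : ℂ) * ((1 / 2 + t * Complex.I) - 1) / 2 =
      ((-(1 / 4 + t ^ 2) / 2 : ℝ) : ℂ) := by
    push_cast; linear_combination (t ^ 2 / 2 : ℂ) * Complex.I_sq
  rw [h1, mul_assoc, mul_assoc, Complex.re_ofReal_mul, mul_assoc]
  have : (1 / 4 + t ^ 2 : ℝ) ≠ 0 := by positivity
  field_simp

/-- The phase in Stirling's formula for the Gamma factor on the critical line. -/
noncomputable def stirlingPhase (t : ℝ) : ℝ :=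
  t / 2 * Real.log (t / (2 * Real.pi)) - t / 2 - Real.pi / 8

/-- The limit of the modulus of the normalised Gamma factor. -/
noncomputable def critAmp : ℝ := Real.sqrt (Real.sqrt (Real.pi / 2))

lemma critAmp_sq : critAmp ^ 2 = Real.sqrt (Real.pi / 2) := Real.sq_sqrt (Real.sqrt_nonneg _)

lemma critAmp_pos : 0 < critAmp := by unfold critAmp; positivity

lemma critAmp_eq : critAmp = Real.sqrt (2 * Real.pi) / 2 *
    Real.exp ((Real.log 2 - Real.log Real.pi) / 4) := by
  have hp := Real.pi_pos
  refine (pow_left_inj₀ critAmp_pos.le (by positivity) two_ne_zero).1 ?_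
  rw [critAmp_sq, mul_pow, div_pow, Real.sq_sqrt (by positivity), ← Real.exp_nat_mul]
  refine (pow_left_inj₀ (by positivity) (by positivity) two_ne_zero).1 ?_
  rw [Real.sq_sqrt (by positivity), mul_pow, ← Real.exp_nat_mul]
  have : Real.exp ((2 : ℕ) * ((2 : ℕ) * ((Real.log 2 - Real.log Real.pi) / 4))) = 2 / Real.pi := by
    rw [show ((2 : ℕ) : ℝ) * ((2 : ℕ) * ((Real.log 2 - Real.log Real.pi) / 4)) =
      Real.log 2 - Real.log Real.pi by push_cast; ring, Real.exp_sub, Real.exp_log hp,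
      Real.exp_log (by norm_num)]
  rw [this]; field_simp

/-- The normalised Gamma factor is `critAmp * exp (i * stirlingPhase t)` up to `O(1 / t)`. -/
theorem norm_critWeight_mul_Gammaℝ_sub_le {t : ℝ} (ht : 28 ≤ t) :
    ‖critWeight t * Complex.Gammaℝ (1 / 2 + t * Complex.I) -
      critAmp * Complex.exp (stirlingPhase t * Complex.I)‖ ≤ critAmp * (56 / t) := by
  have ht0 : 0 < t := by linarith
  have hp := Real.pi_pos
  obtain ⟨ν, hν, h⟩ := Complex.Gamma_vertical (x := 1 / 4) (y := t / 2) le_rfl (by norm_num)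
    (by linarith)
  have hν' : ‖ν‖ ≤ 28 / t := by
    refine hν.trans (le_of_eq ?_); field_simp; norm_num
  have hν1 : ‖ν‖ ≤ 1 := hν'.trans (by rw [div_le_one ht0]; exact ht)
  have key : (critWeight t : ℂ) * Complex.Gammaℝ (1 / 2 + t * Complex.I) =
      critAmp * Complex.exp (stirlingPhase t * Complex.I) * Complex.exp ν := by
    rw [Complex.Gammaℝ_def, show ((1 / 2 + t * Complex.I) / 2 : ℂ) =
      ((1 / 4 : ℝ) : ℂ) + ((t / 2 : ℝ) : ℂ) * Complex.I by push_cast; ring, h,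
      Complex.cpow_def_of_ne_zero (by exact_mod_cast hp.ne'), critAmp_eq]
    unfold critWeight
    rw [Real.rpow_def_of_pos ht0, ← Real.exp_add, ← Complex.ofReal_log hp.le]
    push_cast
    have : ∀ q a b c d e f : ℂ, a + b + c = d + e + f →
        Complex.exp a / 2 * (Complex.exp b * (q * Complex.exp c)) =
        q / 2 * Complex.exp d * Complex.exp e * Complex.exp f := by
      intro q a b c d e f h
      have : Complex.exp a * Complex.exp b * Complex.exp c =
          Complex.exp d * Complex.exp e * Complex.exp f := by
        rw [← Complex.exp_add, ← Complex.exp_add, h, Complex.exp_add, Complex.exp_add]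
      linear_combination (q / 2) * this
    apply this
    unfold stirlingPhase
    rw [Real.log_div ht0.ne' (by norm_num), Real.log_div ht0.ne' (by positivity),
      Real.log_mul (by norm_num) hp.ne']
    push_cast
    ring
  rw [key, show (critAmp : ℂ) * Complex.exp (stirlingPhase t * Complex.I) * Complex.exp ν -
    critAmp * Complex.exp (stirlingPhase t * Complex.I) =
    critAmp * Complex.exp (stirlingPhase t * Complex.I) * (Complex.exp ν - 1) by ring, norm_mul,
    norm_mul, Complex.norm_exp_ofReal_mul_I, mul_one, Complex.norm_real, Real.norm_eq_abs,
    abs_of_pos critAmp_pos]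
  have := critAmp_pos
  gcongr
  refine (Complex.norm_exp_sub_one_le hν1).trans ?_
  calc 2 * ‖ν‖ ≤ 2 * (28 / t) := by gcongr
    _ = 56 / t := by ring

/-- Uniform bound for the Gamma factor near height `T`, the abscissa being allowed to grow. -/
theorem exists_critWeight_mul_norm_Gammaℝ_le : ∃ C > (0 : ℝ), ∀ T t u v κ D : ℝ, 16 ≤ T → 1 ≤ κ →
    1024 * κ ^ 3 ≤ T ^ 2 → |u| ≤ κ → |t - T| + |v| ≤ D → D ≤ T / 2 → κ * D ≤ T →
    critWeight t * ‖Complex.Gammaℝ (1 / 2 + t * Complex.I + (u + v * Complex.I))‖ *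
      Real.exp (Real.pi * v / 4) ≤ C * (T / (2 * Real.pi)) ^ (u / 2) := by
  obtain ⟨C, hC, hb⟩ := Complex.exists_norm_Gamma_le
  refine ⟨C * 8 * Real.exp 1, by positivity, fun T t u v κ D hT hκ hκT hu hD hDT hκD => ?_⟩
  have hp := Real.pi_pos
  have hpi3 := Real.pi_gt_three
  have hT0 : 0 < T := by linarith
  have ht1 := abs_le.1 (le_refl |t - T|)
  have hv1 := abs_le.1 (le_refl |v|)
  have hv0 := abs_nonneg v
  have htT0 := abs_nonneg (t - T)
  have ht_lo : T / 2 ≤ t := by linarith [ht1.1]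
  have ht_hi : t ≤ 2 * T := by linarith [ht1.2]
  have hy_lo : T / 4 ≤ (t + v) / 2 := by linarith [ht1.1, hv1.1]
  have ht0 : 0 < t := by linarith
  set y := (t + v) / 2 with hy
  have hy0 : 0 < y := by linarith
  have hGam := hb (1 / 4 + u / 2) y (by linarith) (by
    have h1 : |1 / 4 + u / 2| + 3 ≤ 4 * κ := by
      have : |1 / 4 + u / 2| ≤ 1 / 4 + κ / 2 := by
        rw [abs_le] at hu ⊢; constructor <;> linarith [hu.1, hu.2]
      linarith
    calc (|1 / 4 + u / 2| + 3) ^ 3 ≤ (4 * κ) ^ 3 := by gcongr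
      _ ≤ (T / 4) ^ 2 := by nlinarith
      _ ≤ y ^ 2 := by gcongr)
  have e1 : ‖Complex.Gammaℝ (1 / 2 + t * Complex.I + (u + v * Complex.I))‖ =
      Real.pi ^ (-(1 / 4 + u / 2)) * ‖Complex.Gamma (((1 / 4 + u / 2 : ℝ) : ℂ) + y * Complex.I)‖ := by
    rw [Complex.Gammaℝ_def, norm_mul, Complex.norm_cpow_eq_rpow_re_of_pos hp]
    congr 2
    · simp; ring
    · congr 1; rw [hy]; push_cast; ring
  rw [e1]
  have hpow : t ^ ((1 : ℝ) / 4) ≤ 8 * y ^ ((1 : ℝ) / 4) := by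
    calc t ^ ((1 : ℝ) / 4) ≤ (8 * y) ^ ((1 : ℝ) / 4) := by gcongr; linarith
      _ = 8 ^ ((1 : ℝ) / 4) * y ^ ((1 : ℝ) / 4) := Real.mul_rpow (by norm_num) hy0.le
      _ ≤ 8 * y ^ ((1 : ℝ) / 4) := by
        gcongr
        calc (8 : ℝ) ^ ((1 : ℝ) / 4) ≤ 8 ^ (1 : ℝ) := by
              apply Real.rpow_le_rpow_of_exponent_le <;> norm_num
          _ = 8 := Real.rpow_one _
  have hpiq : Real.pi ^ (-(1 / 4 + u / 2)) ≤ Real.pi ^ (-(u / 2)) := by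
    apply Real.rpow_le_rpow_of_exponent_le <;> linarith
  have hrat : (y / Real.pi) ^ (u / 2) ≤ Real.exp 1 * (T / (2 * Real.pi)) ^ (u / 2) := by
    have e : y / Real.pi = (1 + (t + v - T) / T) * (T / (2 * Real.pi)) := by
      rw [hy]; field_simp; ring
    have hη : |(t + v - T) / T| ≤ D / T := by
      rw [abs_div, abs_of_pos hT0]; gcongr
      calc |t + v - T| = |(t - T) + v| := by ring_nf
        _ ≤ _ := (abs_add_le _ _).trans hD
    have hD2 : D / T ≤ 1 / 2 := by rw [div_le_iff₀ hT0]; linarith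
    have hη1 := abs_le.1 hη
    have hpos : 0 < 1 + (t + v - T) / T := by linarith [hη1.1]
    rw [e, Real.mul_rpow hpos.le (by positivity)]
    gcongr
    rw [Real.rpow_def_of_pos hpos]
    gcongr
    have hlog : |Real.log (1 + (t + v - T) / T)| ≤ 2 * (D / T) := by
      rw [abs_le]
      constructor
      · have := Real.one_sub_inv_le_log_of_pos hpos
        have h2 : (1 + (t + v - T) / T)⁻¹ ≤ 1 + 2 * (D / T) := by
          rw [inv_le_iff_one_le_mul₀ hpos]
          nlinarith [hη1.1, abs_nonneg ((t + v - T) / T)]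
        linarith
      · have := Real.log_le_sub_one_of_pos hpos
        linarith [hη1.2, abs_nonneg ((t + v - T) / T)]
    calc Real.log (1 + (t + v - T) / T) * (u / 2) ≤ |Real.log (1 + (t + v - T) / T) * (u / 2)| :=
          le_abs_self _
      _ = |Real.log (1 + (t + v - T) / T)| * (|u| / 2) := by
          rw [abs_mul, abs_div, abs_of_pos (by norm_num : (0 : ℝ) < 2)]
      _ ≤ 2 * (D / T) * (κ / 2) := by
          have := (abs_nonneg _).trans hη
          gcongr
      _ = κ * D / T := by ring
      _ ≤ 1 := by rw [div_le_one hT0]; exact hκD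
  unfold critWeight
  calc t ^ ((1 : ℝ) / 4) * Real.exp (Real.pi * t / 4) / 2 * (Real.pi ^ (-(1 / 4 + u / 2)) *
        ‖Complex.Gamma (((1 / 4 + u / 2 : ℝ) : ℂ) + y * Complex.I)‖) * Real.exp (Real.pi * v / 4)
      ≤ (8 * y ^ ((1 : ℝ) / 4)) * Real.exp (Real.pi * t / 4) / 1 * (Real.pi ^ (-(u / 2)) *
        (C * (y ^ (1 / 4 + u / 2 - 1 / 2) * Real.exp (-(Real.pi * y / 2))))) *
          Real.exp (Real.pi * v / 4) := by
        gcongr; norm_num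
    _ = C * 8 * (y ^ ((1 : ℝ) / 4) * y ^ (1 / 4 + u / 2 - 1 / 2) * Real.pi ^ (-(u / 2))) *
        (Real.exp (Real.pi * t / 4) * Real.exp (-(Real.pi * y / 2)) *
          Real.exp (Real.pi * v / 4)) := by ring
    _ = C * 8 * (y / Real.pi) ^ (u / 2) := by
        rw [← Real.exp_add, ← Real.exp_add, ← Real.rpow_add hy0, Real.rpow_neg hp.le,
          Real.div_rpow hy0.le hp.le,
          show Real.pi * t / 4 + -(Real.pi * y / 2) + Real.pi * v / 4 = 0 by rw [hy]; ring,
          Real.exp_zero, mul_one, show (1 : ℝ) / 4 + (1 / 4 + u / 2 - 1 / 2) = u / 2 by ring]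
        rfl
    _ ≤ C * 8 * (Real.exp 1 * (T / (2 * Real.pi)) ^ (u / 2)) := by gcongr
    _ = _ := by ring

/-- The integral of `F w / w` along the vertical segment `re w = u`, `|im w| ≤ L`, divided by
`2πi`. -/
noncomputable def vertInt (F : ℂ → ℂ) (L u : ℝ) : ℂ :=
  (1 / (2 * Real.pi)) * ∫ v in (-L)..L, F (u + v * Complex.I) / (u + v * Complex.I)

/-- The integral of `F w / w` along the horizontal segment `im w = y`, `|re w| ≤ κ`. -/
noncomputable def horizInt (F : ℂ → ℂ) (κ y : ℝ) : ℂ :=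
  ∫ u in (-κ)..κ, F (u + y * Complex.I) / (u + y * Complex.I)

lemma integral_inv_add_mul_I (L u : ℝ) (hu : u ≠ 0) :
    ∫ v in (-L)..L, (1 : ℂ) / (u + v * Complex.I) = 2 * Real.arctan (L / u) := by
  have hne : ∀ v : ℝ, (u + v * Complex.I : ℂ) ≠ 0 := fun v h => hu (by simpa using congrArg Complex.re h)
  have hcont : ∀ s : Set ℝ, ContinuousOn (fun v : ℝ => (1 : ℂ) / (u + v * Complex.I)) s := by
    intro s
    exact ContinuousOn.div continuousOn_const (by fun_prop) (fun v _ => hne v)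
  have hd : ∀ v ∈ Set.uIcc (-L) L, HasDerivAt
      (fun v : ℝ => ((Real.arctan (v / u) : ℝ) : ℂ) - Complex.I * ((Real.log (u ^ 2 + v ^ 2) / 2 : ℝ) : ℂ))
      ((1 : ℂ) / (u + v * Complex.I)) v := by
    intro v _
    have hpos : 0 < u ^ 2 + v ^ 2 := by positivity
    have h1 : HasDerivAt (fun v : ℝ => Real.arctan (v / u)) (u / (u ^ 2 + v ^ 2)) v := by
      have := ((hasDerivAt_id v).div_const u).arctan
      refine this.congr_deriv ?_
      simp only [id]; field_simp
    have h2 : HasDerivAt (fun v : ℝ => Real.log (u ^ 2 + v ^ 2) / 2) (v / (u ^ 2 + v ^ 2)) v := by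
      have := ((((hasDerivAt_id' v).pow 2).const_add (u ^ 2)).log hpos.ne').div_const 2
      refine this.congr_deriv ?_
      simp only [Pi.pow_apply]
      field_simp
      simp [mul_comm]
    refine (h1.ofReal_comp.sub (h2.ofReal_comp.const_mul Complex.I)).congr_deriv ?_
    rw [eq_div_iff (hne v)]
    have : ((u : ℂ) ^ 2 + v ^ 2) ≠ 0 := by exact_mod_cast hpos.ne'
    push_cast
    field_simp
    linear_combination (-(v : ℂ) ^ 2) * Complex.I_sq
  rw [intervalIntegral.integral_eq_sub_of_hasDerivAt hd (hcont _).intervalIntegrable]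
  simp [neg_div, Real.arctan_neg]
  ring

lemma horizInt_one (κ y : ℝ) (hy : y ≠ 0) :
    ∫ u in (-κ)..κ, (1 : ℂ) / (u + y * Complex.I) = -Complex.I * (2 * Real.arctan (κ / y)) := by
  have h := integral_inv_add_mul_I κ (-y) (neg_ne_zero.mpr hy)
  have : ∀ u : ℝ, (1 : ℂ) / (u + y * Complex.I) = Complex.I * (1 / (((-y : ℝ) : ℂ) + u * Complex.I)) := by
    intro u
    have h1 : (u + y * Complex.I : ℂ) ≠ 0 := fun h => hy (by simpa using congrArg Complex.im h)
    have h2 : (((-y : ℝ) : ℂ) + u * Complex.I) ≠ 0 := fun h => hy (by simpa using congrArg Complex.re h)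
    rw [mul_one_div, div_eq_div_iff h1 h2]
    push_cast
    linear_combination (-(y : ℂ)) * Complex.I_sq
  simp_rw [this]
  rw [intervalIntegral.integral_const_mul, h]
  simp [div_neg, Real.arctan_neg]

/-- Cauchy's formula on a rectangle centred at the origin. -/
lemma eq_vertInt_sub_vertInt {F : ℂ → ℂ} {κ L : ℝ} (hκ : 0 < κ) (hL : 0 < L)
    (hF : DifferentiableOn ℂ F (Set.Icc (-κ) κ ×ℂ Set.Icc (-L) L)) :
    F 0 = vertInt F L κ - vertInt F L (-κ)
      + (1 / (2 * Real.pi * Complex.I)) * (horizInt F κ (-L) - horizInt F κ L) := by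
  have hnhds : (Set.Icc (-κ) κ ×ℂ Set.Icc (-L) L) ∈ 𝓝 (0 : ℂ) := by
    refine mem_of_superset ((isOpen_Ioo.reProdIm isOpen_Ioo).mem_nhds
      (show (0 : ℂ) ∈ Set.Ioo (-κ) κ ×ℂ Set.Ioo (-L) L from ?_))
      fun z hz => ⟨Set.Ioo_subset_Icc_self hz.1, Set.Ioo_subset_Icc_self hz.2⟩
    simp [Complex.mem_reProdIm, hκ, hL]
  have hd := (Complex.differentiableOn_dslope hnhds).mpr hF
  have key := Complex.integral_boundary_rect_eq_zero_of_differentiableOn (dslope F 0)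
    (-κ + (-L : ℝ) * Complex.I) (κ + L * Complex.I) (by
      simpa [Set.uIcc_of_le (show -κ ≤ κ by linarith), Set.uIcc_of_le (show -L ≤ L by linarith)] using hd)
  have hFc : ContinuousOn F (Set.Icc (-κ) κ ×ℂ Set.Icc (-L) L) := hF.continuousOn
  have hvert : ∀ u : ℝ, u ≠ 0 → u ∈ Set.Icc (-κ) κ →
      ∫ v in (-L)..L, dslope F 0 (u + v * Complex.I) =
        2 * Real.pi * vertInt F L u - F 0 * (2 * Real.arctan (L / u)) := by
    intro u hu hu'
    have hne : ∀ v : ℝ, (u + v * Complex.I : ℂ) ≠ 0 :=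
      fun v h => hu (by simpa using congrArg Complex.re h)
    have e : ∀ v : ℝ, dslope F 0 (u + v * Complex.I) =
        F (u + v * Complex.I) / (u + v * Complex.I) - F 0 * (1 / (u + v * Complex.I)) := by
      intro v
      rw [dslope_of_ne _ (hne v), slope_def_field]; ring
    simp_rw [e]
    rw [intervalIntegral.integral_sub, intervalIntegral.integral_const_mul,
      integral_inv_add_mul_I _ _ hu, vertInt]
    · have : (Real.pi : ℂ) ≠ 0 := by exact_mod_cast Real.pi_ne_zero
      generalize (∫ v in (-L)..L, F (u + v * Complex.I) / (u + v * Complex.I)) = J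
      field_simp
    · refine ContinuousOn.intervalIntegrable (ContinuousOn.div (hFc.comp (by fun_prop) ?_)
        (by fun_prop) fun v _ => hne v)
      intro v hv
      rw [Set.uIcc_of_le (by linarith)] at hv
      simpa [Complex.mem_reProdIm] using ⟨hu', hv⟩
    · refine ContinuousOn.intervalIntegrable (ContinuousOn.mul continuousOn_const
        (ContinuousOn.div continuousOn_const (by fun_prop) fun v _ => hne v))
  have hhor : ∀ y : ℝ, y ≠ 0 → y ∈ Set.Icc (-L) L →
      ∫ u in (-κ)..κ, dslope F 0 (u + y * Complex.I) =
        horizInt F κ y - F 0 * (-Complex.I * (2 * Real.arctan (κ / y))) := by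
    intro y hy hy'
    have hne : ∀ u : ℝ, (u + y * Complex.I : ℂ) ≠ 0 :=
      fun v h => hy (by simpa using congrArg Complex.im h)
    have e : ∀ u : ℝ, dslope F 0 (u + y * Complex.I) =
        F (u + y * Complex.I) / (u + y * Complex.I) - F 0 * (1 / (u + y * Complex.I)) := by
      intro v
      rw [dslope_of_ne _ (hne v), slope_def_field]; ring
    simp_rw [e]
    rw [intervalIntegral.integral_sub, intervalIntegral.integral_const_mul,
      horizInt_one _ _ hy, horizInt]
    · refine ContinuousOn.intervalIntegrable (ContinuousOn.div (hFc.comp (by fun_prop) ?_)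
        (by fun_prop) fun v _ => hne v)
      intro v hv
      rw [Set.uIcc_of_le (by linarith)] at hv
      simpa [Complex.mem_reProdIm] using ⟨hv, hy'⟩
    · refine ContinuousOn.intervalIntegrable (ContinuousOn.mul continuousOn_const
        (ContinuousOn.div continuousOn_const (by fun_prop) fun v _ => hne v))
  have h1 := hvert κ hκ.ne' ⟨by linarith, le_rfl⟩
  have h2 := hvert (-κ) (neg_ne_zero.mpr hκ.ne') ⟨le_rfl, by linarith⟩
  have h3 := hhor L hL.ne' ⟨by linarith, le_rfl⟩
  have h4 := hhor (-L) (neg_ne_zero.mpr hL.ne') ⟨le_rfl, by linarith⟩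
  have harc : Real.arctan (κ / L) = Real.pi / 2 - Real.arctan (L / κ) := by
    rw [← inv_div, Real.arctan_inv_of_pos (by positivity)]
  rw [div_neg, Real.arctan_neg] at h2 h4
  simp only [Complex.add_re, Complex.add_im, Complex.neg_re, Complex.neg_im, Complex.ofReal_re,
    Complex.ofReal_im, Complex.re_ofReal_mul, Complex.im_ofReal_mul, Complex.I_re, Complex.I_im,
    mul_zero, mul_one, add_zero, zero_add, neg_zero, smul_eq_mul] at key
  rw [h1, h2, h3, h4, harc] at key
  have hpi : (Real.pi : ℂ) ≠ 0 := by exact_mod_cast Real.pi_ne_zero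
  field_simp
  push_cast at key
  linear_combination (-1) * key

/-- A Mellin transform is bounded on vertical strips inside its domain of convergence. -/
lemma exists_norm_mellin_le {f : ℝ → ℂ} {α β : ℝ} (hα : MellinConvergent f α)
    (hβ : MellinConvergent f β) :
    ∃ C > 0, ∀ s : ℂ, α ≤ s.re → s.re ≤ β → ‖mellin f s‖ ≤ C := by
  have hint := hα.norm.add hβ.norm
  refine ⟨(∫ t : ℝ in Set.Ioi 0, (‖(t : ℂ) ^ ((α : ℂ) - 1) • f t‖ + ‖(t : ℂ) ^ ((β : ℂ) - 1) • f t‖)) + 1,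
    by positivity, fun s h1 h2 => ?_⟩
  refine le_trans (MeasureTheory.norm_integral_le_of_norm_le hint ?_) (by simp [Pi.add_apply])
  refine (MeasureTheory.ae_restrict_iff' measurableSet_Ioi).mpr (Eventually.of_forall fun t ht => ?_)
  have ht : 0 < t := ht
  simp only [Pi.add_apply, norm_smul, Complex.norm_cpow_eq_rpow_re_of_pos ht, Complex.sub_re,
    Complex.one_re, Complex.ofReal_re]
  rw [← add_mul]
  refine mul_le_mul_of_nonneg_right ?_ (norm_nonneg _)
  rcases le_total 1 t with h | h
  · exact (Real.rpow_le_rpow_of_exponent_le h (by linarith)).trans (le_add_of_nonneg_left (by positivity))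
  · exact (Real.rpow_le_rpow_of_exponent_ge ht h (by linarith)).trans (le_add_of_nonneg_right (by positivity))

lemma exists_norm_completedRiemannZeta_le :
    ∃ C > 0, ∀ s : ℂ, -1 ≤ s.re → s.re ≤ 2 → 1 ≤ |s.im| → ‖completedRiemannZeta s‖ ≤ C := by
  have hM : ∀ z : ℂ, MellinConvergent (HurwitzZeta.hurwitzEvenFEPair 0).f_modif z := fun z =>
    ((HurwitzZeta.hurwitzEvenFEPair 0).isStrongFEPair_toStrongFEPair.hasMellin z).1
  obtain ⟨C, hC, hb⟩ := exists_norm_mellin_le (hM ((-1 : ℝ) : ℂ)) (hM ((1 : ℝ) : ℂ))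
  refine ⟨C + 2, by positivity, fun s h1 h2 h3 => ?_⟩
  have hΛ : ‖completedRiemannZeta₀ s‖ ≤ C := by
    have e : completedRiemannZeta₀ s = mellin (HurwitzZeta.hurwitzEvenFEPair 0).f_modif (s / 2) / 2 := rfl
    have := hb (s / 2) (by simp; linarith) (by simp; linarith)
    rw [e, norm_div]; simp; linarith
  have hi1 : ‖1 / s‖ ≤ 1 := by
    rw [norm_div, norm_one]
    exact div_le_one_of_le₀ (h3.trans (Complex.abs_im_le_norm s)) (norm_nonneg _)
  have hi2 : ‖1 / (1 - s)‖ ≤ 1 := by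
    rw [norm_div, norm_one]
    refine div_le_one_of_le₀ (h3.trans ?_) (norm_nonneg _)
    simpa using Complex.abs_im_le_norm (1 - s)
  rw [completedRiemannZeta_eq]
  linarith [norm_sub_le (completedRiemannZeta₀ s - 1 / s) (1 / (1 - s)),
    norm_sub_le (completedRiemannZeta₀ s) (1 / s)]

lemma tsum_one_div_nat_sq_le : ∑' n : ℕ, 1 / (n : ℝ) ^ 2 ≤ 2 := by
  rw [hasSum_zeta_two.tsum_eq]
  nlinarith [Real.pi_lt_d2, Real.pi_pos]

lemma norm_riemannZeta_le_two {s : ℂ} (hs : 2 ≤ s.re) : ‖riemannZeta s‖ ≤ 2 := by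
  rw [zeta_eq_tsum_one_div_nat_cpow (by linarith)]
  refine le_trans (tsum_of_norm_bounded hasSum_zeta_two.summable.hasSum fun n => ?_) tsum_one_div_nat_sq_le
  rcases Nat.eq_zero_or_pos n with rfl | hn
  · have : s ≠ 0 := by rintro rfl; simp at hs; linarith
    simp [this]
  · rw [norm_div, norm_one, Complex.norm_natCast_cpow_of_pos hn]
    refine one_div_le_one_div_of_le (by positivity) ?_
    rw [← Real.rpow_natCast]
    exact Real.rpow_le_rpow_of_exponent_le (by exact_mod_cast hn) (by simpa using hs)

/-- The tail of the Dirichlet series of `ζ` far to the right of the critical strip. -/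
lemma rpow_mul_norm_zeta_sub_sum_le {N κ : ℝ} {P : ℕ} (hN : 0 < N) (hκ : 2 ≤ κ) (hP : 2 * N ≤ P)
    {z : ℂ} (hz : z.re = 1 / 2 + κ) :
    N ^ κ * ‖riemannZeta z - ∑ n ∈ Finset.Icc 1 P, (n : ℂ) ^ (-z)‖ ≤ 8 * N ^ 2 * 2 ^ (-κ) := by
  have hz1 : 1 < z.re := by linarith
  have hz0 : z ≠ 0 := by rintro rfl; simp at hz1; linarith
  have hsum := Complex.summable_one_div_nat_cpow.mpr hz1
  have h1 := hsum.sum_add_tsum_nat_add (P + 1)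
  rw [← zeta_eq_tsum_one_div_nat_cpow hz1] at h1
  have h2 : ∑ n ∈ Finset.range (P + 1), 1 / (n : ℂ) ^ z = ∑ n ∈ Finset.Icc 1 P, (n : ℂ) ^ (-z) := by
    rw [Finset.range_eq_Ico, Finset.sum_eq_sum_Ico_succ_bot (by lia)]
    simp only [Nat.cast_zero, Complex.zero_cpow hz0, div_zero, zero_add]
    refine Finset.sum_congr (by ext; simp) fun n _ => by rw [Complex.cpow_neg, one_div]
  rw [h2] at h1
  have h3 : riemannZeta z - ∑ n ∈ Finset.Icc 1 P, (n : ℂ) ^ (-z) =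
      ∑' n : ℕ, 1 / ((n + (P + 1) : ℕ) : ℂ) ^ z := by rw [← h1]; ring
  rw [h3]
  have hsq : Summable fun n : ℕ => (2 * N) ^ (2 - κ) * (1 / ((n + (P + 1) : ℕ) : ℝ) ^ 2) :=
    ((summable_nat_add_iff (P + 1)).mpr hasSum_zeta_two.summable).mul_left _
  have h4 : ‖∑' n : ℕ, 1 / ((n + (P + 1) : ℕ) : ℂ) ^ z‖ ≤
      ∑' n : ℕ, (2 * N) ^ (2 - κ) * (1 / ((n + (P + 1) : ℕ) : ℝ) ^ 2) := by
    refine tsum_of_norm_bounded hsq.hasSum fun n => ?_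
    rw [norm_div, norm_one, Complex.norm_natCast_cpow_of_pos (by lia)]
    set q : ℝ := ((n + (P + 1) : ℕ) : ℝ) with hq
    have hqN : 2 * N ≤ q := by rw [hq]; push_cast; have : (0 : ℝ) ≤ n := by positivity
                               linarith
    have hq1 : 1 ≤ q := by rw [hq]; push_cast; have : (0 : ℝ) ≤ n := by positivity
                           have : (0 : ℝ) ≤ P := by positivity
                           linarith
    have hq0 : 0 < q := by linarith
    have : 1 / q ^ z.re ≤ q ^ (2 - κ) * (1 / q ^ 2) := by
      rw [one_div, one_div, ← Real.rpow_neg hq0.le, ← Real.rpow_natCast, ← Real.rpow_neg hq0.le,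
        ← Real.rpow_add hq0]
      exact Real.rpow_le_rpow_of_exponent_le hq1 (by rw [hz]; push_cast; linarith)
    refine this.trans (mul_le_mul_of_nonneg_right ?_ (by positivity))
    exact Real.rpow_le_rpow_of_nonpos (by positivity) hqN (by linarith)
  rw [tsum_mul_left] at h4
  have h5 : ∑' n : ℕ, (1 / ((n + (P + 1) : ℕ) : ℝ) ^ 2) ≤ 2 := by
    have := hasSum_zeta_two.summable.sum_add_tsum_nat_add (P + 1)
    have h0 : 0 ≤ ∑ n ∈ Finset.range (P + 1), 1 / (n : ℝ) ^ 2 :=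
      Finset.sum_nonneg fun _ _ => by positivity
    linarith [tsum_one_div_nat_sq_le]
  have h6 : N ^ κ * ((2 * N) ^ (2 - κ) * 2) = 8 * N ^ 2 * 2 ^ (-κ) := by
    rw [Real.mul_rpow (by norm_num) hN.le, sub_eq_add_neg, Real.rpow_add (by norm_num),
      Real.rpow_add hN, Real.rpow_neg hN.le]
    have := (Real.rpow_pos_of_pos hN κ).ne'
    field_simp
    norm_num
    ring
  rw [← h6]
  gcongr
  exact h4.trans (by gcongr)

/-- A Dirichlet polynomial on a vertical line. -/
noncomputable def dirSum (s : Finset ℕ) (a : ℕ → ℂ) (t : ℝ) : ℂ :=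
  ∑ n ∈ s, a n * Complex.exp (-(t * Real.log n : ℝ) * Complex.I)

lemma continuous_dirSum (s : Finset ℕ) (a : ℕ → ℂ) : Continuous (dirSum s a) := by
  unfold dirSum; fun_prop

lemma natCast_cpow_neg_eq {n : ℕ} (hn : 0 < n) (x y : ℝ) :
    (n : ℂ) ^ (-(x + y * Complex.I)) =
      ((n : ℝ) ^ (-x) : ℝ) * Complex.exp (-(y * Real.log n : ℝ) * Complex.I) := by
  have h : (n : ℂ) ≠ 0 := by exact_mod_cast hn.ne'
  rw [Complex.cpow_def_of_ne_zero h, Real.rpow_def_of_pos (by exact_mod_cast hn), Complex.ofReal_exp,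
    ← Complex.exp_add, ← Complex.natCast_log]
  congr 1
  push_cast
  ring

/-- The smoothing kernel in the approximate functional equation. -/
noncomputable def afeKer (κ : ℝ) (w : ℂ) : ℂ :=
  Complex.exp (w ^ 2 / κ ^ 2 - Complex.I * (Real.pi * w / 4))

lemma afeKer_zero (κ : ℝ) : afeKer κ 0 = 1 := by simp [afeKer]

lemma differentiable_afeKer (κ : ℝ) : Differentiable ℂ (afeKer κ) := by
  unfold afeKer; fun_prop

lemma norm_afeKer (κ u v : ℝ) :
    ‖afeKer κ (u + v * Complex.I)‖ = Real.exp ((u ^ 2 - v ^ 2) / κ ^ 2) * Real.exp (Real.pi * v / 4) := by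
  rw [afeKer, Complex.norm_exp, ← Real.exp_add]
  congr 1
  have h1 : ((u + v * Complex.I : ℂ) ^ 2 / κ ^ 2) = (((u ^ 2 - v ^ 2) / κ ^ 2 : ℝ) : ℂ)
      + ((2 * u * v / κ ^ 2 : ℝ) : ℂ) * Complex.I := by
    push_cast
    linear_combination ((v : ℂ) ^ 2 / κ ^ 2) * Complex.I_sq
  have h2 : Complex.I * (Real.pi * (u + v * Complex.I) / 4) = ((-(Real.pi * v / 4) : ℝ) : ℂ)
      + ((Real.pi * u / 4 : ℝ) : ℂ) * Complex.I := by
    push_cast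
    linear_combination (Real.pi * v / 4 : ℂ) * Complex.I_sq
  rw [h1, h2]
  simp only [Complex.sub_re, Complex.add_re, Complex.ofReal_re, Complex.re_ofReal_mul, Complex.I_re]
  ring

lemma norm_afeKer_le {κ u : ℝ} (v : ℝ) (hκ : 0 < κ) (hu : |u| ≤ κ) :
    ‖afeKer κ (u + v * Complex.I)‖ ≤
      Real.exp 1 * Real.exp (-(v ^ 2 / κ ^ 2)) * Real.exp (Real.pi * v / 4) := by
  rw [norm_afeKer, ← Real.exp_add 1]
  gcongr
  rw [sub_div]
  have : u ^ 2 / κ ^ 2 ≤ 1 := by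
    rw [div_le_one (by positivity)]
    exact sq_le_sq.mpr (by rwa [abs_of_pos hκ])
  linarith

lemma afeKer_neg_conj (κ : ℝ) (w : ℂ) :
    afeKer κ (-(starRingEnd ℂ w)) = starRingEnd ℂ (afeKer κ w) := by
  rw [afeKer, afeKer, ← Complex.exp_conj]
  congr 1
  simp [Complex.conj_ofNat]
  ring

lemma completedRiemannZeta_neg_conj {t : ℝ} {w : ℂ} (h : t + w.im ≠ 0) :
    completedRiemannZeta (1 / 2 + t * Complex.I + -(starRingEnd ℂ w)) =
      starRingEnd ℂ (completedRiemannZeta (1 / 2 + t * Complex.I + w)) := by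
  rw [← completedRiemannZeta_conj_of_im_ne_zero (by simpa using h), ← completedRiemannZeta_one_sub]
  congr 1
  simp [Complex.conj_ofNat]
  ring

/-- The integrand of the contour integral representing the completed zeta function. -/
noncomputable def afeZeta (κ t : ℝ) (w : ℂ) : ℂ :=
  completedRiemannZeta (1 / 2 + t * Complex.I + w) * afeKer κ w

/-- The integrand with the zeta function replaced by a partial sum of its Dirichlet series. -/
noncomputable def afePartial (κ t : ℝ) (m : ℕ) (w : ℂ) : ℂ :=
  Complex.Gammaℝ (1 / 2 + t * Complex.I + w) *
    (∑ n ∈ Finset.Icc 1 m, (n : ℂ) ^ (-(1 / 2 + t * Complex.I + w))) * afeKer κ w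

lemma vertInt_neg {κ L t : ℝ} (hL : 0 ≤ L) (ht : L < t) :
    vertInt (afeZeta κ t) L (-κ) = -(starRingEnd ℂ (vertInt (afeZeta κ t) L κ)) := by
  unfold vertInt
  rw [map_mul, ← mul_neg]
  congr 1
  · simp [Complex.conj_ofNat]
  rw [← intervalIntegral.intervalIntegral_conj, ← intervalIntegral.integral_neg]
  refine intervalIntegral.integral_congr fun v hv => ?_
  rw [Set.uIcc_of_le (by linarith)] at hv
  have e : (((-κ : ℝ) : ℂ) + v * Complex.I) = -(starRingEnd ℂ (κ + v * Complex.I)) := by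
    simp; ring
  simp only [afeZeta]
  rw [e, completedRiemannZeta_neg_conj (by simp; linarith [hv.1]), afeKer_neg_conj, map_div₀, map_mul,
    div_neg]

lemma norm_horizInt_le {F : ℂ → ℂ} {κ y B : ℝ} (hκ : 0 ≤ κ) (hy : κ ≤ |y|) (hB : 0 ≤ B)
    (hF : ∀ u : ℝ, |u| ≤ κ → ‖F (u + y * Complex.I)‖ ≤ B) : ‖horizInt F κ y‖ ≤ 2 * B := by
  rcases hκ.eq_or_lt with rfl | hκ0
  · simp [horizInt, hB]
  have h := intervalIntegral.norm_integral_le_of_norm_le_const (a := -κ) (b := κ) (C := B / κ)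
    (f := fun u : ℝ => F (u + y * Complex.I) / (u + y * Complex.I)) (fun u hu => by
      rw [Set.uIoc_of_le (by linarith)] at hu
      rw [norm_div]
      have h1 : |y| ≤ ‖(u + y * Complex.I : ℂ)‖ := by
        simpa using Complex.abs_im_le_norm (u + y * Complex.I)
      exact div_le_div₀ hB (hF u (abs_le.mpr ⟨hu.1.le, hu.2⟩)) hκ0 (hy.trans h1))
  refine h.trans (le_of_eq ?_)
  rw [abs_of_pos (by linarith)]
  field_simp
  ring

/-- The length `√(T / 2π)` of the main sum in the approximate functional equation. -/
noncomputable def afeLength (T : ℝ) : ℝ := √(T / (2 * Real.pi))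

/-- Admissible parameters for the smoothed approximate functional equation. -/
structure AFEData (T κ L W : ℝ) (m P : ℕ) : Prop where
  hT : 16 ≤ T
  hκ : 2 ≤ κ
  hκT : 1024 * κ ^ 3 ≤ T ^ 2
  hκL : κ ≤ L
  hW : 0 ≤ W
  hWL : W + L ≤ T / 2
  hκD : κ * (W + L) ≤ T
  hLT : 8 * T * κ ^ 2 ≤ L ^ 2
  hN : afeLength T ^ κ ≤ Real.exp T
  hm : (m : ℝ) ≤ afeLength T
  hP : 2 * afeLength T ≤ P
  h2 : T ^ 3 ≤ 2 ^ κ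

lemma afeLength_rpow {T : ℝ} (hT : 0 < T) (u : ℝ) : afeLength T ^ u = (T / (2 * Real.pi)) ^ (u / 2) := by
  rw [afeLength, Real.sqrt_eq_rpow, ← Real.rpow_mul (by positivity)]
  congr 1; ring

lemma afeLength_pos {T : ℝ} (hT : 0 < T) : 0 < afeLength T := by
  unfold afeLength; positivity

lemma afeLength_sq {T : ℝ} (hT : 0 < T) : afeLength T ^ 2 = T / (2 * Real.pi) :=
  Real.sq_sqrt (by positivity)

lemma one_le_afeLength {T : ℝ} (hT : 16 ≤ T) : 1 ≤ afeLength T := by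
  unfold afeLength
  rw [Real.one_le_sqrt, le_div_iff₀ (by positivity)]
  linarith [Real.pi_lt_four]

/-- The coefficients of the Dirichlet polynomials in the approximate functional equation. -/
noncomputable def afeCoef (N u : ℝ) (n : ℕ) : ℂ := ((N / n) ^ u * (n : ℝ) ^ (-(1 / 2) : ℝ) : ℝ)

lemma rpow_mul_sum_cpow_eq {N : ℝ} (hN : 0 < N) {s : Finset ℕ} (hs : ∀ n ∈ s, 0 < n) (t u v : ℝ) :
    ((N ^ u : ℝ) : ℂ) * ∑ n ∈ s, (n : ℂ) ^ (-(1 / 2 + t * Complex.I + (u + v * Complex.I))) =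
      dirSum s (afeCoef N u) (t + v) := by
  rw [Finset.mul_sum, dirSum]
  refine Finset.sum_congr rfl fun n hn => ?_
  have hn := hs n hn
  have e : (1 / 2 + t * Complex.I + (u + v * Complex.I) : ℂ) =
      ((1 / 2 + u : ℝ) : ℂ) + ((t + v : ℝ) : ℂ) * Complex.I := by push_cast; ring
  rw [e, natCast_cpow_neg_eq hn, ← mul_assoc, ← Complex.ofReal_mul, afeCoef]
  congr 2
  have hn' : (0 : ℝ) < n := by exact_mod_cast hn
  rw [Real.div_rpow hN.le hn'.le, neg_add, Real.rpow_add hn', Real.rpow_neg hn'.le u]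
  ring

lemma norm_dirSum_le (s : Finset ℕ) (a : ℕ → ℂ) (t : ℝ) : ‖dirSum s a t‖ ≤ ∑ n ∈ s, ‖a n‖ := by
  refine (norm_sum_le _ _).trans (Finset.sum_le_sum fun n _ => ?_)
  rw [norm_mul, ← Complex.ofReal_neg, Complex.norm_exp_ofReal_mul_I, mul_one]

lemma exists_critWeight_mul_norm_Gammaℝ_mul_afeKer_le :
    ∃ C > 0, ∀ T κ L W : ℝ, ∀ m P : ℕ, AFEData T κ L W m P → ∀ t u v : ℝ, T ≤ t → t ≤ T + W →
      |u| ≤ κ → |v| ≤ L →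
      critWeight t * (‖Complex.Gammaℝ (1 / 2 + t * Complex.I + (u + v * Complex.I))‖ *
        ‖afeKer κ (u + v * Complex.I)‖) ≤ C * (afeLength T ^ u * Real.exp (-(v ^ 2 / κ ^ 2))) := by
  obtain ⟨C, hC, h⟩ := exists_critWeight_mul_norm_Gammaℝ_le
  refine ⟨C * Real.exp 1, by positivity, fun T κ L W m P hd t u v h1 h2 hu hv => ?_⟩
  have hT := hd.hT
  have hκ := hd.hκ
  have hb := h T t u v κ (W + L) hd.hT (by linarith) hd.hκT hu
    (by rw [abs_of_nonneg (by linarith)]; linarith) hd.hWL hd.hκD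
  rw [← afeLength_rpow (by linarith)] at hb
  have hk := norm_afeKer_le v (by linarith : 0 < κ) hu
  calc _ ≤ critWeight t * (‖Complex.Gammaℝ (1 / 2 + t * Complex.I + (u + v * Complex.I))‖ *
        (Real.exp 1 * Real.exp (-(v ^ 2 / κ ^ 2)) * Real.exp (Real.pi * v / 4))) := by
        have := critWeight_nonneg (t := t) (by linarith)
        gcongr
    _ = (critWeight t * ‖Complex.Gammaℝ (1 / 2 + t * Complex.I + (u + v * Complex.I))‖ *
        Real.exp (Real.pi * v / 4)) * (Real.exp 1 * Real.exp (-(v ^ 2 / κ ^ 2))) := by ring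
    _ ≤ C * afeLength T ^ u * (Real.exp 1 * Real.exp (-(v ^ 2 / κ ^ 2))) := by gcongr
    _ = _ := by ring

lemma exp_neg_sq_div_le {T κ L W : ℝ} {m P : ℕ} (hd : AFEData T κ L W m P) :
    Real.exp (-(L ^ 2 / κ ^ 2)) ≤ Real.exp (-(8 * T)) := by
  have hκ := hd.hκ
  gcongr
  rw [le_div_iff₀ (by positivity)]
  exact hd.hLT

lemma norm_afeCoef_le {N u κ : ℝ} {n : ℕ} (hn : 0 < n) (hnN : n ≤ N) (hu : u ≤ κ) (hκ : 0 ≤ κ) :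
    ‖afeCoef N u n‖ ≤ N ^ κ := by
  have hn' : (1 : ℝ) ≤ n := by exact_mod_cast hn
  have hN : 1 ≤ N := hn'.trans hnN
  have h1 : 1 ≤ N / n := by rw [le_div_iff₀ (by linarith)]; linarith
  rw [afeCoef, Complex.norm_real, Real.norm_of_nonneg (by positivity)]
  calc (N / n) ^ u * (n : ℝ) ^ (-(1 / 2) : ℝ) ≤ N ^ κ * 1 := by
        refine mul_le_mul ?_ (Real.rpow_le_one_of_one_le_of_nonpos hn' (by norm_num)) (by positivity)
          (by positivity)
        exact (Real.rpow_le_rpow_of_exponent_le h1 hu).trans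
          (Real.rpow_le_rpow (by positivity) (div_le_self (by linarith) hn') hκ)
    _ = _ := mul_one _

lemma exists_afePartial_horiz_le :
    ∃ C > 0, ∀ T κ L W : ℝ, ∀ m P : ℕ, AFEData T κ L W m P → ∀ t u v : ℝ, T ≤ t → t ≤ T + W →
      |u| ≤ κ → |v| = L → ‖critWeight t * afePartial κ t m (u + v * Complex.I)‖ ≤ C / T := by
  obtain ⟨C, hC, h⟩ := exists_critWeight_mul_norm_Gammaℝ_mul_afeKer_le
  refine ⟨C, hC, fun T κ L W m P hd t u v h1 h2 hu hv => ?_⟩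
  have hT := hd.hT
  have hκ := hd.hκ
  have hb := h T κ L W m P hd t u v h1 h2 hu hv.le
  have hN0 : 0 < afeLength T := afeLength_pos (by linarith)
  have hS := rpow_mul_sum_cpow_eq hN0 (s := Finset.Icc 1 m) (fun n hn => by simp at hn; lia) t u v
  have hS' := congrArg norm hS
  rw [norm_mul, Complex.norm_real, Real.norm_of_nonneg (by positivity)] at hS'
  have hD : ‖dirSum (Finset.Icc 1 m) (afeCoef (afeLength T) u) (t + v)‖ ≤ T * Real.exp T := by
    refine (norm_dirSum_le _ _ _).trans ?_
    refine (Finset.sum_le_card_nsmul _ _ (afeLength T ^ κ) fun n hn => ?_).trans ?_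
    · simp at hn
      refine norm_afeCoef_le (by lia) (le_trans ?_ hd.hm) (le_of_abs_le hu) (by linarith)
      exact_mod_cast hn.2
    · simp only [Nat.card_Icc, Nat.add_sub_cancel, nsmul_eq_mul]
      refine mul_le_mul (hd.hm.trans ?_) hd.hN (by positivity) (by linarith)
      have : afeLength T ^ 2 ≤ T := by
        rw [afeLength_sq (by linarith)]
        exact div_le_self (by linarith) (by linarith [Real.pi_gt_three])
      nlinarith [one_le_afeLength hT]
  have hw := critWeight_nonneg (t := t) (by linarith)
  have hexp : Real.exp (-(v ^ 2 / κ ^ 2)) ≤ Real.exp (-(8 * T)) := by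
    rw [← sq_abs v, hv]; exact exp_neg_sq_div_le hd
  have hTe : T * Real.exp T * Real.exp (-(8 * T)) ≤ 1 / T := by
    rw [le_div_iff₀ (by linarith)]
    have h3 : T ≤ Real.exp T := by linarith [Real.add_one_le_exp T]
    calc T * Real.exp T * Real.exp (-(8 * T)) * T
        ≤ Real.exp T * Real.exp T * Real.exp (-(8 * T)) * Real.exp T := by gcongr
      _ = Real.exp (-(5 * T)) := by rw [← Real.exp_add, ← Real.exp_add, ← Real.exp_add]; ring_nf
      _ ≤ 1 := by rw [Real.exp_le_one_iff]; linarith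
  rw [afePartial, norm_mul, norm_mul, norm_mul, Complex.norm_real, Real.norm_of_nonneg hw]
  set Z := ‖∑ n ∈ Finset.Icc 1 m, (n : ℂ) ^ (-(1 / 2 + t * Complex.I + (u + v * Complex.I)))‖
  calc _ = (critWeight t * (‖Complex.Gammaℝ (1 / 2 + t * Complex.I + (u + v * Complex.I))‖ *
        ‖afeKer κ (u + v * Complex.I)‖)) * Z := by ring
    _ ≤ C * (afeLength T ^ u * Real.exp (-(v ^ 2 / κ ^ 2))) * Z := by gcongr
    _ = C * ((afeLength T ^ u * Z) * Real.exp (-(v ^ 2 / κ ^ 2))) := by ring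
    _ ≤ C * ((T * Real.exp T) * Real.exp (-(8 * T))) := by
        rw [hS']; gcongr
    _ ≤ C * (1 / T) := by gcongr
    _ = _ := by ring

lemma critWeight_mul_exp_le {T t v : ℝ} (hT : 1 ≤ T) (ht0 : 0 ≤ t) (ht : t ≤ 3 / 2 * T)
    (hv : v ≤ T / 2) : critWeight t * Real.exp (Real.pi * v / 4) ≤ Real.exp (4 * T) := by
  have h1 : t ^ ((1 : ℝ) / 4) ≤ 2 * Real.exp T := by
    calc t ^ ((1 : ℝ) / 4) ≤ (2 * T) ^ ((1 : ℝ) / 4) := by gcongr; linarith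
      _ ≤ (2 * T) ^ (1 : ℝ) := Real.rpow_le_rpow_of_exponent_le (by linarith) (by norm_num)
      _ = 2 * T := Real.rpow_one _
      _ ≤ 2 * Real.exp T := by linarith [Real.add_one_le_exp T]
  have hpi := Real.pi_lt_four
  unfold critWeight
  calc t ^ ((1 : ℝ) / 4) * Real.exp (Real.pi * t / 4) / 2 * Real.exp (Real.pi * v / 4)
      ≤ 2 * Real.exp T * Real.exp (Real.pi * t / 4) / 2 * Real.exp (Real.pi * v / 4) := by gcongr
    _ = Real.exp (T + Real.pi * t / 4 + Real.pi * v / 4) := by rw [Real.exp_add, Real.exp_add]; ring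
    _ ≤ _ := by
        gcongr
        nlinarith [Real.pi_pos]

lemma exists_afeZeta_horiz_le :
    ∃ C > 0, ∀ T κ L W : ℝ, ∀ m P : ℕ, AFEData T κ L W m P → ∀ t u v : ℝ, T ≤ t → t ≤ T + W →
      |u| ≤ κ → |v| = L → ‖critWeight t * afeZeta κ t (u + v * Complex.I)‖ ≤ C / T := by
  obtain ⟨C₁, hC₁, h⟩ := exists_critWeight_mul_norm_Gammaℝ_le
  obtain ⟨C₂, hC₂, hΛ⟩ := exists_norm_completedRiemannZeta_le
  refine ⟨(2 * C₁ + C₂) * Real.exp 1, by positivity, fun T κ L W m P hd t u v h1 h2 hu hv => ?_⟩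
  have hT := hd.hT
  have hκ := hd.hκ
  have hWL := hd.hWL
  have hW := hd.hW
  have hL := hd.hκL
  have hw := critWeight_nonneg (t := t) (by linarith)
  have hv2 := abs_le.mp (hv.le.trans (by linarith : L ≤ T / 2))
  have hτ : 1 ≤ t + v := by linarith [hv2.1]
  have key : ∀ u : ℝ, 0 ≤ u → u ≤ κ →
      critWeight t * ‖completedRiemannZeta (1 / 2 + t * Complex.I + (u + v * Complex.I))‖ *
        Real.exp (Real.pi * v / 4) ≤ (2 * C₁ + C₂) * Real.exp (4 * T) := by
    intro u hu0 hu1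
    have him : (1 / 2 + t * Complex.I + (u + v * Complex.I) : ℂ).im = t + v := by simp
    have hre : (1 / 2 + t * Complex.I + (u + v * Complex.I) : ℂ).re = 1 / 2 + u := by simp
    rcases le_total (1 / 2 + u) 2 with hc | hc
    · have h3 := hΛ (1 / 2 + t * Complex.I + (u + v * Complex.I)) (by rw [hre]; linarith)
        (by rw [hre]; exact hc) (by rw [him, abs_of_pos] <;> linarith)
      have h4 := critWeight_mul_exp_le (T := T) (t := t) (v := v) (by linarith) (by linarith)
        (by linarith) hv2.2
      calc _ ≤ critWeight t * C₂ * Real.exp (Real.pi * v / 4) := by gcongr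
        _ = C₂ * (critWeight t * Real.exp (Real.pi * v / 4)) := by ring
        _ ≤ C₂ * Real.exp (4 * T) := by gcongr
        _ ≤ _ := by gcongr; linarith
    · have hb := h T t u v κ (W + L) hd.hT (by linarith) hd.hκT (by rwa [abs_of_nonneg hu0])
        (by rw [abs_of_nonneg (by linarith), hv]; linarith) hd.hWL hd.hκD
      rw [← afeLength_rpow (by linarith)] at hb
      have h3 := norm_riemannZeta_le_two (s := 1 / 2 + t * Complex.I + (u + v * Complex.I))
        (by rw [hre]; exact hc)
      have h4 : afeLength T ^ u ≤ Real.exp (4 * T) :=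
        (Real.rpow_le_rpow_of_exponent_le (one_le_afeLength hT) hu1).trans
          (hd.hN.trans (Real.exp_le_exp.mpr (by linarith)))
      have h5 : 0 ≤ C₁ * afeLength T ^ u := by
        have := afeLength_pos (T := T) (by linarith)
        positivity
      rw [completedRiemannZeta_eq_Gammaℝ_mul (by rw [him]; linarith), norm_mul]
      calc _ = (critWeight t * ‖Complex.Gammaℝ (1 / 2 + t * Complex.I + (u + v * Complex.I))‖ *
          Real.exp (Real.pi * v / 4)) * ‖riemannZeta (1 / 2 + t * Complex.I + (u + v * Complex.I))‖ := by
            ring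
        _ ≤ (C₁ * afeLength T ^ u) * 2 := by gcongr
        _ ≤ (C₁ * Real.exp (4 * T)) * 2 := by gcongr
        _ ≤ _ := by nlinarith [Real.exp_pos (4 * T)]
  have key2 : critWeight t * ‖completedRiemannZeta (1 / 2 + t * Complex.I + (u + v * Complex.I))‖ *
        Real.exp (Real.pi * v / 4) ≤ (2 * C₁ + C₂) * Real.exp (4 * T) := by
    rcases le_total 0 u with hu0 | hu0
    · exact key u hu0 (le_of_abs_le hu)
    · have e := completedRiemannZeta_neg_conj (t := t) (w := ((-u : ℝ) : ℂ) + v * Complex.I)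
        (by simp; linarith)
      have e2 : -(starRingEnd ℂ (((-u : ℝ) : ℂ) + v * Complex.I)) = (u + v * Complex.I) := by
        simp; ring
      rw [e2] at e
      rw [e, RCLike.norm_conj]
      exact key (-u) (by linarith) (by linarith [neg_le_of_abs_le hu])
  have hk := norm_afeKer_le v (by linarith : 0 < κ) hu
  have hexp : Real.exp (-(v ^ 2 / κ ^ 2)) ≤ Real.exp (-(8 * T)) := by
    rw [← sq_abs v, hv]; exact exp_neg_sq_div_le hd
  have hTe : Real.exp (4 * T) * Real.exp (-(8 * T)) ≤ 1 / T := by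
    rw [le_div_iff₀ (by linarith)]
    have h3 : T ≤ Real.exp T := by linarith [Real.add_one_le_exp T]
    calc Real.exp (4 * T) * Real.exp (-(8 * T)) * T
        ≤ Real.exp (4 * T) * Real.exp (-(8 * T)) * Real.exp T := by gcongr
      _ = Real.exp (-(3 * T)) := by rw [← Real.exp_add, ← Real.exp_add]; ring_nf
      _ ≤ 1 := by rw [Real.exp_le_one_iff]; linarith
  rw [afeZeta, norm_mul, norm_mul, Complex.norm_real, Real.norm_of_nonneg hw]
  calc _ ≤ critWeight t * (‖completedRiemannZeta (1 / 2 + t * Complex.I + (u + v * Complex.I))‖ *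
        (Real.exp 1 * Real.exp (-(v ^ 2 / κ ^ 2)) * Real.exp (Real.pi * v / 4))) := by gcongr
    _ = (critWeight t * ‖completedRiemannZeta (1 / 2 + t * Complex.I + (u + v * Complex.I))‖ *
        Real.exp (Real.pi * v / 4)) * (Real.exp 1 * Real.exp (-(v ^ 2 / κ ^ 2))) := by ring
    _ ≤ ((2 * C₁ + C₂) * Real.exp (4 * T)) * (Real.exp 1 * Real.exp (-(8 * T))) := by gcongr
    _ = (2 * C₁ + C₂) * Real.exp 1 * (Real.exp (4 * T) * Real.exp (-(8 * T))) := by ring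
    _ ≤ (2 * C₁ + C₂) * Real.exp 1 * (1 / T) := by gcongr
    _ = _ := by ring

lemma norm_mul_vertInt_le {F : ℂ → ℂ} {L u w : ℝ} {g : ℝ → ℝ} (hL : 0 ≤ L) (hu : u ≠ 0) (hw : 0 ≤ w)
    (hg : IntervalIntegrable g MeasureTheory.volume (-L) L)
    (hF : ∀ v : ℝ, |v| ≤ L → w * ‖F (u + v * Complex.I)‖ ≤ g v) :
    ‖w * vertInt F L u‖ ≤ 1 / |u| * ∫ v in (-L)..L, g v := by
  have hu' : 0 < |u| := abs_pos.mpr hu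
  have h1 : ‖(w : ℂ) * ∫ v in (-L)..L, F (u + v * Complex.I) / (u + v * Complex.I)‖ ≤
      ∫ v in (-L)..L, 1 / |u| * g v := by
    rw [← intervalIntegral.integral_const_mul]
    refine intervalIntegral.norm_integral_le_of_norm_le (by linarith) ?_ (hg.const_mul _)
    refine Eventually.of_forall fun v hv => ?_
    have h2 : |u| ≤ ‖(u + v * Complex.I : ℂ)‖ := by
      simpa using Complex.abs_re_le_norm (u + v * Complex.I)
    have h3 := hF v (abs_le.mpr ⟨hv.1.le, hv.2⟩)
    rw [norm_mul, norm_div, Complex.norm_real, Real.norm_of_nonneg hw, ← mul_div_assoc,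
      one_div_mul_eq_div]
    exact div_le_div₀ ((mul_nonneg hw (norm_nonneg _)).trans h3) h3 hu' h2
  rw [intervalIntegral.integral_const_mul] at h1
  rw [vertInt, mul_left_comm, norm_mul]
  have h4 : ‖(1 / (2 * Real.pi) : ℂ)‖ ≤ 1 := by
    have : (1 / (2 * Real.pi) : ℂ) = ((1 / (2 * Real.pi) : ℝ) : ℂ) := by push_cast; rfl
    rw [this, Complex.norm_real, Real.norm_of_nonneg (by positivity), div_le_one (by positivity)]
    linarith [Real.pi_gt_three]
  exact (mul_le_of_le_one_left (norm_nonneg _) h4).trans h1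

lemma norm_mul_horiz_le {F : ℂ → ℂ} {κ L w B : ℝ} (hκ : 0 ≤ κ) (hL : κ ≤ L) (hB : 0 ≤ B)
    (hF : ∀ u v : ℝ, |u| ≤ κ → |v| = L → ‖w * F (u + v * Complex.I)‖ ≤ B) :
    ‖w * ((1 / (2 * Real.pi * Complex.I)) * (horizInt F κ (-L) - horizInt F κ L))‖ ≤ B := by
  have e : ∀ y : ℝ, (w : ℂ) * horizInt F κ y = horizInt (fun z => w * F z) κ y := by
    intro y
    rw [horizInt, ← intervalIntegral.integral_const_mul, horizInt]
    simp_rw [mul_div_assoc]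
  have hLa : |L| = L := abs_of_nonneg (by linarith)
  have h1 := norm_horizInt_le (F := fun z => w * F z) (κ := κ) (y := -L) hκ (by rwa [abs_neg, hLa]) hB
    (fun u hu => hF u (-L) hu (by rwa [abs_neg]))
  have h2 := norm_horizInt_le (F := fun z => w * F z) (κ := κ) (y := L) hκ (by rwa [hLa]) hB
    (fun u hu => hF u L hu hLa)
  rw [mul_left_comm, mul_sub, e, e, norm_mul]
  have h4 : ‖(1 / (2 * Real.pi * Complex.I) : ℂ)‖ ≤ 1 / 4 := by
    have : ‖(1 / (2 * Real.pi * Complex.I) : ℂ)‖ = 1 / (2 * Real.pi) := by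
      simp [abs_of_pos Real.pi_pos]
    rw [this]
    exact one_div_le_one_div_of_le (by norm_num) (by linarith [Real.pi_gt_three])
  calc _ ≤ 1 / 4 * (2 * B + 2 * B) := by
        gcongr
        exact (norm_sub_le _ _).trans (add_le_add h1 h2)
    _ = B := by ring

lemma differentiableAt_Gammaℝ_of_im_ne_zero {z : ℂ} (hz : z.im ≠ 0) :
    DifferentiableAt ℂ Complex.Gammaℝ z := by
  have h : Complex.Gammaℝ = fun z : ℂ => (Real.pi : ℂ) ^ (-z / 2) * Complex.Gamma (z / 2) := by
    funext z; exact Complex.Gammaℝ_def z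
  have hpi : (Real.pi : ℂ) ≠ 0 := by exact_mod_cast Real.pi_ne_zero
  rw [h]
  refine DifferentiableAt.mul ?_ ?_
  · exact DifferentiableAt.const_cpow (by fun_prop) (Or.inl hpi)
  · refine DifferentiableAt.comp z (Complex.differentiableAt_Gamma _ fun n h => hz ?_) (by fun_prop)
    have := congrArg Complex.im h
    simpa using this

lemma differentiableOn_afeZeta {κ L t : ℝ} (ht : L < t) :
    DifferentiableOn ℂ (afeZeta κ t) (Set.Icc (-κ) κ ×ℂ Set.Icc (-L) L) := by
  intro z hz
  have him : (1 / 2 + t * Complex.I + z).im ≠ 0 := by simp; linarith [hz.2.1]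
  refine DifferentiableAt.differentiableWithinAt ?_
  refine DifferentiableAt.mul ?_ (differentiable_afeKer κ z)
  refine DifferentiableAt.comp z (differentiableAt_completedZeta ?_ ?_) (by fun_prop)
  · intro h; rw [h] at him; simp at him
  · intro h; rw [h] at him; simp at him

lemma differentiableOn_afePartial {κ L t : ℝ} (m : ℕ) (ht : L < t) :
    DifferentiableOn ℂ (afePartial κ t m) (Set.Icc (-κ) κ ×ℂ Set.Icc (-L) L) := by
  intro z hz
  have him : (1 / 2 + t * Complex.I + z).im ≠ 0 := by simp; linarith [hz.2.1]
  refine DifferentiableAt.differentiableWithinAt ?_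
  refine DifferentiableAt.mul (DifferentiableAt.mul ?_ ?_) (differentiable_afeKer κ z)
  · exact DifferentiableAt.comp z (differentiableAt_Gammaℝ_of_im_ne_zero him) (by fun_prop)
  · refine DifferentiableAt.fun_sum fun n hn => DifferentiableAt.const_cpow (by fun_prop) (Or.inl ?_)
    simp at hn
    exact_mod_cast (by lia : n ≠ 0)

lemma vertInt_sub {F G : ℂ → ℂ} {κ L u : ℝ} (hu : u ≠ 0) (huκ : u ∈ Set.Icc (-κ) κ) (hL : 0 ≤ L)
    (hF : ContinuousOn F (Set.Icc (-κ) κ ×ℂ Set.Icc (-L) L))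
    (hG : ContinuousOn G (Set.Icc (-κ) κ ×ℂ Set.Icc (-L) L)) :
    vertInt (fun z => F z - G z) L u = vertInt F L u - vertInt G L u := by
  have hint : ∀ F : ℂ → ℂ, ContinuousOn F (Set.Icc (-κ) κ ×ℂ Set.Icc (-L) L) →
      IntervalIntegrable (fun v : ℝ => F (u + v * Complex.I) / (u + v * Complex.I))
        MeasureTheory.volume (-L) L := by
    intro F hF
    refine ContinuousOn.intervalIntegrable (ContinuousOn.div (hF.comp (by fun_prop) ?_)
        (by fun_prop) fun v _ h => hu (by simpa using congrArg Complex.re h))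
    intro v hv
    rw [Set.uIcc_of_le (by linarith)] at hv
    simpa [Complex.mem_reProdIm] using ⟨huκ, hv⟩
  unfold vertInt
  simp_rw [sub_div]
  rw [intervalIntegral.integral_sub (hint F hF) (hint G hG), mul_sub]

/-- The remainder in the smoothed approximate functional equation. -/
noncomputable def afeRem (T κ L : ℝ) (m P : ℕ) (t : ℝ) : ℝ :=
  1 / κ * ∫ v in (-L)..L, Real.exp (-(v ^ 2 / κ ^ 2)) *
    (‖dirSum (Finset.Ioc m P) (afeCoef (afeLength T) κ) (t + v)‖ +
      ‖dirSum (Finset.Icc 1 m) (afeCoef (afeLength T) (-κ)) (t + v)‖)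

/-- Smoothed approximate functional equation for the Hardy–Littlewood function. -/
theorem exists_abs_XHL_sub_le :
    ∃ C > 0, ∀ T κ L W : ℝ, ∀ m P : ℕ, AFEData T κ L W m P → ∀ t : ℝ, T ≤ t → t ≤ T + W →
      |XHL t - 2 * (critWeight t * Complex.Gammaℝ (1 / 2 + t * Complex.I) *
        dirSum (Finset.Icc 1 m) (fun n => ((n : ℝ) ^ (-(1 / 2) : ℝ) : ℝ)) t).re| ≤
        C * (afeRem T κ L m P t + 1 / T) := by
  obtain ⟨C, hC, hG⟩ := exists_critWeight_mul_norm_Gammaℝ_mul_afeKer_le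
  obtain ⟨C₁, hC₁, hE1⟩ := exists_afeZeta_horiz_le
  obtain ⟨C₂, hC₂, hE2⟩ := exists_afePartial_horiz_le
  refine ⟨16 * C + 2 * C₂ + C₁, by positivity, fun T κ L W m P hd t h1 h2 => ?_⟩
  have hT := hd.hT
  have hκ := hd.hκ
  have hW := hd.hW
  have hκL := hd.hκL
  have hWL := hd.hWL
  have hw := critWeight_nonneg (t := t) (by linarith)
  have hLt : L < t := by linarith
  set N := afeLength T with hNdef
  have hN0 : 0 < N := afeLength_pos (by linarith)
  have hmP : m ≤ P := by
    have := hd.hm.trans (by linarith [hN0] : afeLength T ≤ 2 * afeLength T) |>.trans hd.hP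
    exact_mod_cast this
  set w := critWeight t
  set F₁ := afeZeta κ t
  set F₂ := afePartial κ t m
  set S₁ : ℝ → ℝ := fun τ => ‖dirSum (Finset.Ioc m P) (afeCoef N κ) τ‖
  set S₂ : ℝ → ℝ := fun τ => ‖dirSum (Finset.Icc 1 m) (afeCoef N (-κ)) τ‖
  have hS₁c : Continuous S₁ := (continuous_dirSum _ _).norm
  have hS₂c : Continuous S₂ := (continuous_dirSum _ _).norm
  have hd1 : DifferentiableOn ℂ F₁ _ := differentiableOn_afeZeta (κ := κ) hLt
  have hd2 : DifferentiableOn ℂ F₂ _ := differentiableOn_afePartial (κ := κ) m hLt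
  have c1 := eq_vertInt_sub_vertInt (by linarith) (by linarith) hd1
  have c2 := eq_vertInt_sub_vertInt (by linarith) (by linarith) hd2
  rw [vertInt_neg (by linarith) hLt, sub_neg_eq_add] at c1
  have c3 := vertInt_sub (u := κ) (by linarith) ⟨by linarith, le_rfl⟩ (by linarith : (0 : ℝ) ≤ L)
    hd1.continuousOn hd2.continuousOn
  have b1 := norm_mul_horiz_le (by linarith) hκL (by positivity)
    (fun u v hu hv => hE1 T κ L W m P hd t u v h1 h2 hu hv)
  have b2 := norm_mul_horiz_le (by linarith) hκL (by positivity)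
    (fun u v hu hv => hE2 T κ L W m P hd t u v h1 h2 hu hv)
  set E₁ := (1 / (2 * Real.pi * Complex.I)) * (horizInt F₁ κ (-L) - horizInt F₁ κ L)
  set E₂ := (1 / (2 * Real.pi * Complex.I)) * (horizInt F₂ κ (-L) - horizInt F₂ κ L)
  have b3 := norm_mul_vertInt_le (F := F₂) (u := -κ) (w := w) (L := L)
    (g := fun v => C * (Real.exp (-(v ^ 2 / κ ^ 2)) * S₂ (t + v))) (by linarith)
    (by linarith) hw (Continuous.intervalIntegrable (by fun_prop) _ _) (by
      intro v hv
      have hb := hG T κ L W m P hd t (-κ) v h1 h2 (by rw [abs_neg, abs_of_pos] <;> linarith) hv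
      have hS := congrArg norm (rpow_mul_sum_cpow_eq hN0 (s := Finset.Icc 1 m)
        (fun n hn => by simp at hn; lia) t (-κ) v)
      rw [norm_mul, Complex.norm_real, Real.norm_of_nonneg (by positivity)] at hS
      simp only [F₂, afePartial, norm_mul, S₂]
      rw [← hS]
      calc _ = w * (‖Complex.Gammaℝ (1 / 2 + t * Complex.I + ((-κ : ℝ) + v * Complex.I))‖ *
            ‖afeKer κ ((-κ : ℝ) + v * Complex.I)‖) *
            ‖∑ n ∈ Finset.Icc 1 m, (n : ℂ) ^ (-(1 / 2 + t * Complex.I + ((-κ : ℝ) + v * Complex.I)))‖ := by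
            ring
        _ ≤ C * (N ^ (-κ) * Real.exp (-(v ^ 2 / κ ^ 2))) *
            ‖∑ n ∈ Finset.Icc 1 m, (n : ℂ) ^ (-(1 / 2 + t * Complex.I + ((-κ : ℝ) + v * Complex.I)))‖ := by
            gcongr
        _ = _ := by ring)
  have b4 := norm_mul_vertInt_le (F := fun z => F₁ z - F₂ z) (u := κ) (w := w) (L := L)
    (g := fun v => C * (Real.exp (-(v ^ 2 / κ ^ 2)) * S₁ (t + v)) + C * (8 * N ^ 2 * 2 ^ (-κ)))
    (by linarith) (by linarith) hw (Continuous.intervalIntegrable (by fun_prop) _ _) (by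
      intro v hv
      have hb := hG T κ L W m P hd t κ v h1 h2 (by rw [abs_of_pos]; linarith) hv
      set z : ℂ := 1 / 2 + t * Complex.I + (κ + v * Complex.I) with hz
      have hzre : z.re = 1 / 2 + κ := by simp [hz]
      have hzim : z.im ≠ 0 := by simp [hz]; linarith [(abs_le.mp hv).1]
      have hS := congrArg norm (rpow_mul_sum_cpow_eq hN0 (s := Finset.Ioc m P)
        (fun n hn => by simp at hn; lia) t κ v)
      rw [norm_mul, Complex.norm_real, Real.norm_of_nonneg (by positivity), ← hz] at hS
      have htail := rpow_mul_norm_zeta_sub_sum_le hN0 hκ hd.hP hzre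
      have hsplit : riemannZeta z - ∑ n ∈ Finset.Icc 1 m, (n : ℂ) ^ (-z) =
          (riemannZeta z - ∑ n ∈ Finset.Icc 1 P, (n : ℂ) ^ (-z)) + ∑ n ∈ Finset.Ioc m P, (n : ℂ) ^ (-z) := by
        have : Finset.Icc 1 P = Finset.Icc 1 m ∪ Finset.Ioc m P := by ext; simp; lia
        rw [this, Finset.sum_union (by
          rw [Finset.disjoint_left]; intro n hn hn'; simp at hn hn'; lia)]
        ring
      have hF : F₁ (κ + v * Complex.I) - F₂ (κ + v * Complex.I) =
          Complex.Gammaℝ z * (riemannZeta z - ∑ n ∈ Finset.Icc 1 m, (n : ℂ) ^ (-z)) *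
            afeKer κ (κ + v * Complex.I) := by
        simp only [F₁, F₂, afeZeta, afePartial, ← hz]
        rw [completedRiemannZeta_eq_Gammaℝ_mul hzim]; ring
      have hle : N ^ κ * ‖riemannZeta z - ∑ n ∈ Finset.Icc 1 m, (n : ℂ) ^ (-z)‖ ≤
          8 * N ^ 2 * 2 ^ (-κ) + S₁ (t + v) := by
        simp only [S₁]
        rw [hsplit, ← hS]
        calc _ ≤ N ^ κ * (‖riemannZeta z - ∑ n ∈ Finset.Icc 1 P, (n : ℂ) ^ (-z)‖ +
            ‖∑ n ∈ Finset.Ioc m P, (n : ℂ) ^ (-z)‖) := by gcongr; exact norm_add_le _ _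
          _ ≤ _ := by rw [mul_add]; gcongr
      rw [hF, norm_mul, norm_mul]
      have hexp : Real.exp (-(v ^ 2 / κ ^ 2)) ≤ 1 := by
        rw [Real.exp_le_one_iff]; have := sq_nonneg (v / κ); rw [div_pow] at this; linarith
      set Z := ‖riemannZeta z - ∑ n ∈ Finset.Icc 1 m, (n : ℂ) ^ (-z)‖
      calc _ = w * (‖Complex.Gammaℝ z‖ * ‖afeKer κ (κ + v * Complex.I)‖) * Z := by ring
        _ ≤ C * (N ^ κ * Real.exp (-(v ^ 2 / κ ^ 2))) * Z := by gcongr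
        _ = C * Real.exp (-(v ^ 2 / κ ^ 2)) * (N ^ κ * Z) := by ring
        _ ≤ C * Real.exp (-(v ^ 2 / κ ^ 2)) * (8 * N ^ 2 * 2 ^ (-κ) + S₁ (t + v)) := by gcongr
        _ = C * (Real.exp (-(v ^ 2 / κ ^ 2)) * S₁ (t + v)) +
            C * (8 * N ^ 2 * 2 ^ (-κ)) * Real.exp (-(v ^ 2 / κ ^ 2)) := by ring
        _ ≤ _ := add_le_add le_rfl (mul_le_of_le_one_right (by positivity) hexp))
  rw [c3] at b4
  rw [abs_neg, abs_of_pos (by linarith)] at b3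
  rw [abs_of_pos (by linarith)] at b4
  have hi1 : IntervalIntegrable (fun v => Real.exp (-(v ^ 2 / κ ^ 2)) * S₁ (t + v))
      MeasureTheory.volume (-L) L := Continuous.intervalIntegrable (by fun_prop) _ _
  have hi2 : IntervalIntegrable (fun v => Real.exp (-(v ^ 2 / κ ^ 2)) * S₂ (t + v))
      MeasureTheory.volume (-L) L := Continuous.intervalIntegrable (by fun_prop) _ _
  rw [intervalIntegral.integral_const_mul] at b3
  rw [intervalIntegral.integral_add (hi1.const_mul C) (by simp), intervalIntegral.integral_const_mul,
    intervalIntegral.integral_const, smul_eq_mul] at b4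
  have hrem : afeRem T κ L m P t = 1 / κ * (∫ v in (-L)..L, Real.exp (-(v ^ 2 / κ ^ 2)) * S₁ (t + v)) +
      1 / κ * (∫ v in (-L)..L, Real.exp (-(v ^ 2 / κ ^ 2)) * S₂ (t + v)) := by
    rw [afeRem, ← mul_add, ← intervalIntegral.integral_add hi1 hi2]
    simp_rw [mul_add]
    rfl
  set J₁ := ∫ v in (-L)..L, Real.exp (-(v ^ 2 / κ ^ 2)) * S₁ (t + v)
  set J₂ := ∫ v in (-L)..L, Real.exp (-(v ^ 2 / κ ^ 2)) * S₂ (t + v)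
  have hJ₁ : 0 ≤ 1 / κ * J₁ := mul_nonneg (by positivity)
    (intervalIntegral.integral_nonneg (by linarith) fun v _ => by positivity)
  have hJ₂ : 0 ≤ 1 / κ * J₂ := mul_nonneg (by positivity)
    (intervalIntegral.integral_nonneg (by linarith) fun v _ => by positivity)
  have htl : 1 / κ * ((L - -L) * (C * (8 * N ^ 2 * 2 ^ (-κ)))) ≤ 4 * C * (1 / T) := by
    have q1 : (2 : ℝ) ^ (-κ) ≤ 1 / T ^ 3 := by
      rw [Real.rpow_neg (by norm_num), ← one_div]
      exact one_div_le_one_div_of_le (by positivity) hd.h2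
    have q2 : N ^ 2 ≤ T := by
      rw [hNdef, afeLength_sq (by linarith)]
      exact div_le_self (by linarith) (by linarith [Real.pi_gt_three])
    have q3 : 1 / κ ≤ 1 / 2 := one_div_le_one_div_of_le (by norm_num) hκ
    have q4 : L - -L ≤ T := by linarith
    have q5 : 0 ≤ L - -L := by linarith
    calc _ ≤ 1 / 2 * (T * (C * (8 * T * (1 / T ^ 3)))) := by gcongr
      _ = _ := by field_simp; ring
  have hX := XHL_eq_critWeight_mul (t := t) (by linarith)
  have hF10 : F₁ 0 = completedRiemannZeta (1 / 2 + t * Complex.I) := by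
    simp [F₁, afeZeta, afeKer_zero]
  have hF20 : F₂ 0 = Complex.Gammaℝ (1 / 2 + t * Complex.I) *
      dirSum (Finset.Icc 1 m) (fun n => ((n : ℝ) ^ (-(1 / 2) : ℝ) : ℝ)) t := by
    have := rpow_mul_sum_cpow_eq hN0 (s := Finset.Icc 1 m) (fun n hn => by simp at hn; lia) t 0 0
    simp only [F₂, afePartial, afeKer_zero, mul_one]
    have hco : afeCoef N 0 = fun n : ℕ => (((n : ℝ) ^ (-(1 / 2) : ℝ) : ℝ) : ℂ) := by
      funext n; simp [afeCoef]
    rw [← hco]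
    simp at this
    simp [this]
  have hmain : XHL t - 2 * (w * Complex.Gammaℝ (1 / 2 + t * Complex.I) *
        dirSum (Finset.Icc 1 m) (fun n => ((n : ℝ) ^ (-(1 / 2) : ℝ) : ℝ)) t).re =
      2 * (w * (vertInt F₁ L κ - vertInt F₂ L κ)).re + 2 * (w * vertInt F₂ L (-κ)).re
        - 2 * (w * E₂).re + (w * E₁).re := by
    rw [mul_assoc (w : ℂ), ← hF20, hX, ← hF10, c1, c2]
    simp only [Complex.re_ofReal_mul, Complex.add_re, Complex.sub_re, Complex.conj_re]
    ring
  rw [hmain, hrem]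
  have a1 := (Complex.abs_re_le_norm _).trans b1
  have a2 := (Complex.abs_re_le_norm _).trans b2
  have a3 := (Complex.abs_re_le_norm _).trans b3
  have a4 := (Complex.abs_re_le_norm _).trans b4
  rw [abs_le] at a1 a2 a3 a4 ⊢
  have e1 : C₁ / T = C₁ * (1 / T) := by ring
  have e2 : C₂ / T = C₂ * (1 / T) := by ring
  rw [e1] at a1
  rw [e2] at a2
  have hT1 : 0 ≤ 1 / T := by positivity
  have p1 := mul_nonneg hC.le hJ₁
  have p2 := mul_nonneg hC.le hJ₂
  have p3 := mul_nonneg hC₁.le hJ₁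
  have p4 := mul_nonneg hC₁.le hJ₂
  have p5 := mul_nonneg hC₂.le hJ₁
  have p6 := mul_nonneg hC₂.le hJ₂
  have p7 := mul_nonneg hC.le hT1
  have f3 : 1 / κ * (C * J₂) = C * (1 / κ * J₂) := by ring
  have f4 : 1 / κ * (C * J₁ + (L - -L) * (C * (8 * N ^ 2 * 2 ^ (-κ)))) =
    C * (1 / κ * J₁) + 1 / κ * ((L - -L) * (C * (8 * N ^ 2 * 2 ^ (-κ)))) := by ring
  rw [f3] at a3
  rw [f4] at a4
  constructor
  · linarith [a1.1, a2.2, a3.1, a4.1]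
  · linarith [a1.2, a2.1, a3.2, a4.2]

lemma norm_integral_exp_mul_I_le {θ : ℝ} (hθ : θ ≠ 0) (A B : ℝ) :
    ‖∫ t in A..B, Complex.exp ((t * θ : ℝ) * Complex.I)‖ ≤ 2 / |θ| := by
  have hc : (θ * Complex.I : ℂ) ≠ 0 := by simp [hθ]
  have e : ∀ t : ℝ, Complex.exp ((t * θ : ℝ) * Complex.I) = Complex.exp ((θ * Complex.I) * t) := by
    intro t; congr 1; push_cast; ring
  simp_rw [e]
  rw [integral_exp_mul_complex hc, norm_div]
  have h1 : ‖(θ * Complex.I : ℂ)‖ = |θ| := by simp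
  rw [h1]
  gcongr
  refine (norm_sub_le _ _).trans ?_
  rw [← e, ← e, Complex.norm_exp_ofReal_mul_I, Complex.norm_exp_ofReal_mul_I]
  norm_num

lemma one_div_abs_log_sub_log_le {m n M : ℕ} (hm : 0 < m) (hn : 0 < n) (hmM : m ≤ M) (hnM : n ≤ M)
    (hne : m ≠ n) : 1 / |Real.log n - Real.log m| ≤ M / |(m : ℝ) - n| := by
  have key : ∀ {m n : ℕ}, 0 < m → m < n → n ≤ M →
      1 / |Real.log n - Real.log m| ≤ M / |(m : ℝ) - n| := by
    intro m n hm hmn hn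
    have hm' : (0 : ℝ) < m := by exact_mod_cast hm
    have hmn' : (m : ℝ) < n := by exact_mod_cast hmn
    have hnM : (n : ℝ) ≤ M := by exact_mod_cast hn
    have hn' : (0 : ℝ) < n := by linarith
    have h1 : Real.log m < Real.log n := Real.log_lt_log hm' hmn'
    rw [abs_of_pos (by linarith), abs_of_neg (by linarith), div_le_div_iff₀ (by linarith) (by linarith)]
    have h2 : Real.log (m / n) ≤ m / n - 1 := Real.log_le_sub_one_of_pos (by positivity)
    rw [Real.log_div hm'.ne' (by linarith)] at h2
    have h3 : 1 - (m : ℝ) / n ≤ Real.log n - Real.log m := by linarith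
    have h4 : (n : ℝ) - m = n * (1 - m / n) := by
      have : (n : ℝ) ≠ 0 := by linarith
      field_simp
    have h5 : (0 : ℝ) ≤ 1 - m / n := by
      rw [sub_nonneg, div_le_one (by linarith)]; linarith
    nlinarith
  rcases lt_or_gt_of_ne hne with h | h
  · exact key hm h hnM
  · rw [abs_sub_comm, abs_sub_comm (m : ℝ)]; exact key hn h hmM

lemma sum_one_div_abs_sub_le {s : Finset ℕ} {M : ℕ} (hs : s ⊆ Finset.Icc 1 M) {m : ℕ} (hm : m ∈ s) :
    ∑ n ∈ s.erase m, 1 / |(m : ℝ) - n| ≤ 2 * (1 + Real.log M) := by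
  have hmM := Finset.mem_Icc.mp (hs hm)
  have hH : ∑ k ∈ Finset.Icc 1 M, 1 / (k : ℝ) ≤ 1 + Real.log M := by
    have := harmonic_le_one_add_log M
    rw [harmonic_eq_sum_Icc] at this
    push_cast at this
    simpa [one_div] using this
  have h1 : s.erase m ⊆ (Finset.Icc 1 M).filter (· < m) ∪ (Finset.Icc 1 M).filter (m < ·) := by
    intro n hn
    have := hs (Finset.mem_of_mem_erase hn)
    have := Finset.ne_of_mem_erase hn
    simp at *
    lia
  have hinj : ∀ (t : Finset ℕ) (f : ℕ → ℕ), Set.InjOn f t → (∀ n ∈ t, f n ∈ Finset.Icc 1 M) →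
      (∀ n ∈ t, |(m : ℝ) - n| = f n) → ∑ n ∈ t, 1 / |(m : ℝ) - n| ≤ 1 + Real.log M := by
    intro t f hf hmem heq
    rw [Finset.sum_congr rfl fun n hn => by rw [heq n hn],
      ← Finset.sum_image (f := fun k : ℕ => 1 / (k : ℝ)) hf]
    refine (Finset.sum_le_sum_of_subset_of_nonneg ?_ fun _ _ _ => by positivity).trans hH
    exact Finset.image_subset_iff.mpr hmem
  have a1 := hinj ((Finset.Icc 1 M).filter (· < m)) (fun n => m - n)
    (by intro x hx y hy hxy; simp at hx hy hxy; lia) (by intro n hn; simp at hn ⊢; lia)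
    (by
      intro n hn
      have hnm := (Finset.mem_filter.mp hn).2
      rw [Nat.cast_sub hnm.le, abs_of_nonneg (by rw [sub_nonneg]; exact_mod_cast hnm.le)])
  have a2 := hinj ((Finset.Icc 1 M).filter (m < ·)) (fun n => n - m)
    (by intro x hx y hy hxy; simp at hx hy hxy; lia) (by intro n hn; simp at hn ⊢; lia)
    (by
      intro n hn
      have hnm := (Finset.mem_filter.mp hn).2
      rw [Nat.cast_sub hnm.le, abs_sub_comm,
        abs_of_nonneg (by rw [sub_nonneg]; exact_mod_cast hnm.le)])
  have h2 := Finset.sum_le_sum_of_subset_of_nonneg (f := fun n : ℕ => 1 / |(m : ℝ) - n|) h1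
    fun _ _ _ => by positivity
  have h3 := Finset.sum_union_inter (s₁ := (Finset.Icc 1 M).filter (· < m))
    (s₂ := (Finset.Icc 1 M).filter (m < ·)) (f := fun n : ℕ => 1 / |(m : ℝ) - n|)
  have h4 : 0 ≤ ∑ n ∈ (Finset.Icc 1 M).filter (· < m) ∩ (Finset.Icc 1 M).filter (m < ·),
      1 / |(m : ℝ) - n| := Finset.sum_nonneg fun _ _ => by positivity
  linarith

lemma abs_integral_norm_sq_dirSum_sub_le {s : Finset ℕ} {M : ℕ} (hs : s ⊆ Finset.Icc 1 M) (a : ℕ → ℂ)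
    (A B : ℝ) : |(∫ t in A..B, ‖dirSum s a t‖ ^ 2) - (B - A) * ∑ n ∈ s, ‖a n‖ ^ 2| ≤
      4 * M * (1 + Real.log M) * ∑ n ∈ s, ‖a n‖ ^ 2 := by
  set J : ℕ → ℕ → ℂ := fun m n =>
    ∫ t in A..B, Complex.exp ((t * (Real.log n - Real.log m) : ℝ) * Complex.I)
  have hJd : ∀ m, J m m = (B - A : ℝ) := by intro m; simp [J]
  have hexp : ∀ t : ℝ, ((‖dirSum s a t‖ ^ 2 : ℝ) : ℂ) = ∑ m ∈ s, ∑ n ∈ s, a m * starRingEnd ℂ (a n) *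
      Complex.exp ((t * (Real.log n - Real.log m) : ℝ) * Complex.I) := by
    intro t
    push_cast
    rw [← Complex.mul_conj', dirSum, map_sum, Finset.sum_mul_sum]
    refine Finset.sum_congr rfl fun m _ => Finset.sum_congr rfl fun n _ => ?_
    rw [map_mul, ← Complex.exp_conj, mul_mul_mul_comm, ← Complex.exp_add]
    congr 2
    rw [map_mul, Complex.conj_I, ← Complex.ofReal_neg, ← Complex.ofReal_neg, Complex.conj_ofReal]
    push_cast
    ring
  have hint : ((∫ t in A..B, ‖dirSum s a t‖ ^ 2 : ℝ) : ℂ) =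
      ∑ m ∈ s, ∑ n ∈ s, a m * starRingEnd ℂ (a n) * J m n := by
    rw [← intervalIntegral.integral_ofReal]
    simp_rw [hexp]
    rw [intervalIntegral.integral_finsetSum fun m _ => Continuous.intervalIntegrable (by fun_prop) _ _]
    refine Finset.sum_congr rfl fun m _ => ?_
    rw [intervalIntegral.integral_finsetSum fun m _ => Continuous.intervalIntegrable (by fun_prop) _ _]
    refine Finset.sum_congr rfl fun n _ => ?_
    rw [intervalIntegral.integral_const_mul]
  have hdiag : ((∫ t in A..B, ‖dirSum s a t‖ ^ 2 : ℝ) : ℂ) - ((B - A) * ∑ n ∈ s, ‖a n‖ ^ 2 : ℝ) =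
      ∑ m ∈ s, ∑ n ∈ s.erase m, a m * starRingEnd ℂ (a n) * J m n := by
    rw [hint]
    push_cast
    rw [Finset.mul_sum, ← Finset.sum_sub_distrib]
    refine Finset.sum_congr rfl fun m hm => ?_
    rw [← Finset.add_sum_erase _ _ hm, hJd, Complex.mul_conj']
    push_cast
    ring
  rw [← Complex.ofReal_sub] at hdiag
  rw [← Real.norm_eq_abs, ← Complex.norm_real, hdiag]
  have hterm : ∀ m ∈ s, ∀ n ∈ s.erase m, ‖a m * starRingEnd ℂ (a n) * J m n‖ ≤
      M * (‖a m‖ ^ 2 * (1 / |(m : ℝ) - n|)) + M * (‖a n‖ ^ 2 * (1 / |(m : ℝ) - n|)) := by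
    intro m hm n hn
    have h1 := Finset.mem_Icc.mp (hs hm)
    have h2 := Finset.mem_Icc.mp (hs (Finset.mem_of_mem_erase hn))
    have hne := (Finset.ne_of_mem_erase hn).symm
    have hθ : Real.log n - Real.log m ≠ 0 := by
      rw [sub_ne_zero]
      intro h
      have := Real.log_injOn_pos (Set.mem_Ioi.mpr (by exact_mod_cast (by lia : 0 < n)))
        (Set.mem_Ioi.mpr (by exact_mod_cast (by lia : 0 < m))) h
      exact hne (by exact_mod_cast this.symm)
    have h3 := norm_integral_exp_mul_I_le hθ A B
    have h4 := one_div_abs_log_sub_log_le (by lia) (by lia) h1.2 h2.2 hne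
    have h5 : ‖J m n‖ ≤ 2 * (M / |(m : ℝ) - n|) := h3.trans (by rw [← mul_one_div]; gcongr)
    rw [norm_mul, norm_mul, RCLike.norm_conj]
    calc ‖a m‖ * ‖a n‖ * ‖J m n‖ ≤ ‖a m‖ * ‖a n‖ * (2 * (M / |(m : ℝ) - n|)) := by gcongr
      _ = (2 * ‖a m‖ * ‖a n‖) * (M / |(m : ℝ) - n|) := by ring
      _ ≤ (‖a m‖ ^ 2 + ‖a n‖ ^ 2) * (M / |(m : ℝ) - n|) := by
          gcongr; exact two_mul_le_add_sq _ _
      _ = _ := by ring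
  have hswap : ∑ m ∈ s, ∑ n ∈ s.erase m, M * (‖a n‖ ^ 2 * (1 / |(m : ℝ) - n|)) =
      ∑ m ∈ s, ∑ n ∈ s.erase m, M * (‖a m‖ ^ 2 * (1 / |(m : ℝ) - n|)) := by
    rw [Finset.sum_comm' (t' := s) (s' := fun n => s.erase n) (by intro x y; simp; tauto)]
    refine Finset.sum_congr rfl fun m _ => Finset.sum_congr rfl fun n _ => ?_
    rw [abs_sub_comm]
  have hmain : ∑ m ∈ s, ∑ n ∈ s.erase m, M * (‖a m‖ ^ 2 * (1 / |(m : ℝ) - n|)) ≤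
      2 * M * (1 + Real.log M) * ∑ n ∈ s, ‖a n‖ ^ 2 := by
    rw [Finset.mul_sum]
    refine Finset.sum_le_sum fun m hm => ?_
    rw [← Finset.mul_sum, ← Finset.mul_sum]
    calc _ ≤ M * (‖a m‖ ^ 2 * (2 * (1 + Real.log M))) := by
          gcongr; exact sum_one_div_abs_sub_le hs hm
      _ = _ := by ring
  calc _ ≤ ∑ m ∈ s, ∑ n ∈ s.erase m, (M * (‖a m‖ ^ 2 * (1 / |(m : ℝ) - n|)) +
        M * (‖a n‖ ^ 2 * (1 / |(m : ℝ) - n|))) :=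
        (norm_sum_le _ _).trans (Finset.sum_le_sum fun m hm =>
          (norm_sum_le _ _).trans (Finset.sum_le_sum fun n hn => hterm m hm n hn))
    _ = 2 * ∑ m ∈ s, ∑ n ∈ s.erase m, M * (‖a m‖ ^ 2 * (1 / |(m : ℝ) - n|)) := by
        simp_rw [Finset.sum_add_distrib]
        rw [hswap]; ring
    _ ≤ 2 * (2 * M * (1 + Real.log M) * ∑ n ∈ s, ‖a n‖ ^ 2) := by gcongr
    _ = _ := by ring

lemma sq_integral_mul_le {p f : ℝ → ℝ} (hp : Continuous p) (hp0 : ∀ v, 0 ≤ p v) (hf : Continuous f)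
    {α β : ℝ} (hαβ : α ≤ β) :
    (∫ v in α..β, p v * f v) ^ 2 ≤ (∫ v in α..β, p v) * ∫ v in α..β, p v * f v ^ 2 := by
  have h : ∀ x : ℝ, 0 ≤ (∫ v in α..β, p v) * (x * x) + (-2 * ∫ v in α..β, p v * f v) * x +
      ∫ v in α..β, p v * f v ^ 2 := by
    intro x
    have e : (∫ v in α..β, p v) * (x * x) + (-2 * ∫ v in α..β, p v * f v) * x +
      ∫ v in α..β, p v * f v ^ 2 = ∫ v in α..β, p v * (f v - x) ^ 2 := by
      rw [mul_comm (∫ v in α..β, p v), mul_assoc (-2 : ℝ), mul_comm (∫ v in α..β, p v * f v),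
        ← intervalIntegral.integral_const_mul, ← intervalIntegral.integral_const_mul,
        ← intervalIntegral.integral_const_mul, ← intervalIntegral.integral_add,
        ← intervalIntegral.integral_add]
      · refine intervalIntegral.integral_congr fun v _ => ?_
        ring
      all_goals exact Continuous.intervalIntegrable (by fun_prop) _ _
    rw [e]
    exact intervalIntegral.integral_nonneg hαβ fun v _ => mul_nonneg (hp0 v) (sq_nonneg _)
  have := discrim_le_zero h
  rw [discrim] at this
  nlinarith

/-- A weighted average of translates is bounded in mean square. -/
lemma integral_sq_integral_mul_le {p f : ℝ → ℝ} (hp : Continuous p) (hp0 : ∀ v, 0 ≤ p v)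
    (hf : Continuous f) {α β A B K : ℝ} (hαβ : α ≤ β) (hAB : A ≤ B)
    (hK : ∀ v ∈ Set.Icc α β, ∫ t in A..B, f (t + v) ^ 2 ≤ K) :
    ∫ t in A..B, (∫ v in α..β, p v * f (t + v)) ^ 2 ≤ (∫ v in α..β, p v) ^ 2 * K := by
  have hP : 0 ≤ ∫ v in α..β, p v := intervalIntegral.integral_nonneg hαβ fun v _ => hp0 v
  have hc1 : Continuous fun t => ∫ v in α..β, p v * f (t + v) := by
    refine intervalIntegral.continuous_parametric_intervalIntegral_of_continuous' ?_ _ _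
    fun_prop
  have hc2 : Continuous fun t => ∫ v in α..β, p v * f (t + v) ^ 2 := by
    refine intervalIntegral.continuous_parametric_intervalIntegral_of_continuous' ?_ _ _
    fun_prop
  have hc3 : Continuous fun v => ∫ t in A..B, f (t + v) ^ 2 := by
    refine intervalIntegral.continuous_parametric_intervalIntegral_of_continuous' ?_ _ _
    fun_prop
  have hswap : (∫ t in A..B, ∫ v in α..β, p v * f (t + v) ^ 2) =
      ∫ v in α..β, ∫ t in A..B, p v * f (t + v) ^ 2 := by
    rw [intervalIntegral.integral_of_le hAB, intervalIntegral.integral_of_le hαβ]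
    simp_rw [intervalIntegral.integral_of_le hAB, intervalIntegral.integral_of_le hαβ]
    refine MeasureTheory.integral_integral_swap ?_
    rw [MeasureTheory.Measure.prod_restrict]
    refine MeasureTheory.IntegrableOn.mono_set (t := Set.Icc A B ×ˢ Set.Icc α β) ?_
      (Set.prod_mono Set.Ioc_subset_Icc_self Set.Ioc_subset_Icc_self)
    refine ContinuousOn.integrableOn_compact (isCompact_Icc.prod isCompact_Icc) ?_
    exact Continuous.continuousOn (by fun_prop)
  calc _ ≤ ∫ t in A..B, (∫ v in α..β, p v) * ∫ v in α..β, p v * f (t + v) ^ 2 := by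
        refine intervalIntegral.integral_mono_on hAB ((hc1.pow 2).intervalIntegrable _ _)
          ((hc2.const_mul _).intervalIntegrable _ _) fun t _ => ?_
        exact sq_integral_mul_le hp hp0 (by fun_prop) hαβ
    _ = (∫ v in α..β, p v) * ∫ v in α..β, p v * ∫ t in A..B, f (t + v) ^ 2 := by
        rw [intervalIntegral.integral_const_mul, hswap]
        simp_rw [intervalIntegral.integral_const_mul]
    _ ≤ (∫ v in α..β, p v) * ∫ v in α..β, p v * K := by
        refine mul_le_mul_of_nonneg_left ?_ hP
        refine intervalIntegral.integral_mono_on hαβ ((hp.mul hc3).intervalIntegrable _ _)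
          ((hp.mul continuous_const).intervalIntegrable _ _) fun v hv => ?_
        exact mul_le_mul_of_nonneg_left (hK v hv) (hp0 v)
    _ = _ := by rw [intervalIntegral.integral_mul_const]; ring

lemma norm_sq_afeCoef {N u : ℝ} (hN : 0 < N) {n : ℕ} (hn : 0 < n) :
    ‖afeCoef N u n‖ ^ 2 = (N / n) ^ (2 * u) / n := by
  have hn' : (0 : ℝ) < n := by exact_mod_cast hn
  rw [afeCoef, Complex.norm_real, Real.norm_eq_abs, sq_abs, mul_pow, ← Real.rpow_natCast,
    ← Real.rpow_natCast, ← Real.rpow_mul (by positivity), ← Real.rpow_mul (by positivity)]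
  norm_num
  rw [Real.rpow_neg_one, mul_comm u, ← div_eq_mul_inv]

lemma rpow_div_le_sub {q : ℝ} (hq : 1 ≤ q) {y : ℝ} (hy : 0 < y) :
    y ^ q / y ≤ ((y + 1) ^ q - y ^ q) / q := by
  have h := one_add_mul_self_le_rpow_one_add (s := 1 / y) (by have : 0 < 1 / y := by positivity
                                                              linarith) hq
  have e : (y + 1) ^ q = y ^ q * (1 + 1 / y) ^ q := by
    rw [← Real.mul_rpow hy.le (by positivity)]; congr 1; field_simp
  rw [le_div_iff₀ (by linarith), e]
  have := mul_le_mul_of_nonneg_left h (Real.rpow_nonneg hy.le q)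
  have e2 : y ^ q * (1 + q * (1 / y)) = y ^ q + y ^ q / y * q := by ring
  linarith

lemma rpow_neg_div_le_sub {q : ℝ} (hq : 1 ≤ q) {y : ℝ} (hy : 0 < y) :
    (y + 1) ^ (-q) / (y + 1) ≤ (y ^ (-q) - (y + 1) ^ (-q)) / q := by
  have h := one_add_mul_self_le_rpow_one_add (s := 1 / y) (by have : 0 < 1 / y := by positivity
                                                              linarith) hq
  have e : y ^ (-q) = (y + 1) ^ (-q) * (1 + 1 / y) ^ q := by
    have : (1 + 1 / y) = (y + 1) / y := by field_simp
    rw [this, Real.div_rpow (by positivity) hy.le, Real.rpow_neg hy.le,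
      Real.rpow_neg (by positivity : 0 ≤ y + 1)]
    have : 0 < (y + 1) ^ q := by positivity
    field_simp
  rw [le_div_iff₀ (by linarith), e]
  have h1 : (1 : ℝ) / (y + 1) ≤ 1 / y := by gcongr; linarith
  have h2 : 1 + q * (1 / (y + 1)) ≤ (1 + 1 / y) ^ q := by nlinarith
  have := mul_le_mul_of_nonneg_left h2 (Real.rpow_nonneg (by positivity : 0 ≤ y + 1) (-q))
  have e2 : (y + 1) ^ (-q) * (1 + q * (1 / (y + 1))) = (y + 1) ^ (-q) + (y + 1) ^ (-q) / (y + 1) * q := by ring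
  linarith

lemma sum_norm_sq_afeCoef_neg_le {N κ : ℝ} {m : ℕ} (hN : 0 < N) (hκ : 1 ≤ κ) (hm : (m : ℝ) + 1 ≤ N) :
    ∑ n ∈ Finset.Icc 1 m, ‖afeCoef N (-κ) n‖ ^ 2 ≤ 1 / (2 * κ) := by
  have key : ∀ k : ℕ, ∑ n ∈ Finset.Icc 1 k, (n : ℝ) ^ (2 * κ) / n ≤ ((k : ℝ) + 1) ^ (2 * κ) / (2 * κ) := by
    intro k
    induction k with
    | zero => simp; positivity
    | succ k ih =>
      rw [Finset.sum_Icc_succ_top (by lia)]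
      have := rpow_div_le_sub (q := 2 * κ) (by linarith) (y := (k : ℝ) + 1) (by positivity)
      push_cast
      rw [sub_div] at this
      linarith
  have e : ∀ n ∈ Finset.Icc 1 m, ‖afeCoef N (-κ) n‖ ^ 2 = (n : ℝ) ^ (2 * κ) / n / N ^ (2 * κ) := by
    intro n hn
    have hn1 : 0 < n := by have := (Finset.mem_Icc.mp hn).1; lia
    have hn' : (0 : ℝ) < n := by exact_mod_cast hn1
    rw [norm_sq_afeCoef hN hn1, mul_neg, Real.rpow_neg (by positivity),
      Real.div_rpow hN.le hn'.le, inv_div]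
    ring
  rw [Finset.sum_congr rfl e, ← Finset.sum_div, div_le_iff₀ (by positivity)]
  refine (key m).trans ?_
  rw [one_div, inv_mul_eq_div]
  gcongr

lemma sum_norm_sq_afeCoef_le {N κ : ℝ} {m P : ℕ} (hN : 0 < N) (hκ : 1 ≤ κ)
    (hm : N * Real.exp (-(1 / κ)) ≤ m + 1) :
    ∑ n ∈ Finset.Ioc m P, ‖afeCoef N κ n‖ ^ 2 ≤ 9 * (1 / (m + 1) + 1 / (2 * κ)) := by
  have hm0 : (0 : ℝ) < m + 1 := by positivity
  have key : ∀ k : ℕ, m + 1 ≤ k → ∑ n ∈ Finset.Ioc m k, (n : ℝ) ^ (-(2 * κ)) / n ≤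
      (m + 1 : ℝ) ^ (-(2 * κ)) / (m + 1) + (m + 1 : ℝ) ^ (-(2 * κ)) / (2 * κ) - (k : ℝ) ^ (-(2 * κ)) / (2 * κ) := by
    intro k hk
    induction k, hk using Nat.le_induction with
    | base => simp
    | succ k hk ih =>
      rw [Finset.sum_Ioc_succ_top (by lia)]
      have hk0 : (0 : ℝ) < k := by exact_mod_cast (by lia : 0 < k)
      have := rpow_neg_div_le_sub (q := 2 * κ) (by linarith) hk0
      push_cast
      rw [sub_div] at this
      linarith
  have hexp : N ^ (2 * κ) * (m + 1 : ℝ) ^ (-(2 * κ)) ≤ 9 := by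
    have h1 : N ≤ (m + 1) * Real.exp (1 / κ) := by
      rw [Real.exp_neg, ← div_eq_mul_inv, div_le_iff₀ (Real.exp_pos _)] at hm
      exact hm
    calc N ^ (2 * κ) * (m + 1 : ℝ) ^ (-(2 * κ)) ≤
        ((m + 1) * Real.exp (1 / κ)) ^ (2 * κ) * (m + 1 : ℝ) ^ (-(2 * κ)) := by gcongr
      _ = Real.exp 1 ^ 2 := by
          rw [Real.mul_rpow hm0.le (Real.exp_pos _).le, ← Real.exp_mul, mul_right_comm,
            ← Real.rpow_add hm0, add_neg_cancel, Real.rpow_zero, one_mul, ← Real.exp_nat_mul]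
          congr 1; field_simp; norm_num
      _ ≤ 9 := by
          have := Real.exp_one_lt_three
          have := Real.exp_pos 1
          nlinarith
  have e : ∀ n ∈ Finset.Ioc m P, ‖afeCoef N κ n‖ ^ 2 = N ^ (2 * κ) * ((n : ℝ) ^ (-(2 * κ)) / n) := by
    intro n hn
    have hn1 : 0 < n := by have := (Finset.mem_Ioc.mp hn).1; lia
    have hn' : (0 : ℝ) < n := by exact_mod_cast hn1
    rw [norm_sq_afeCoef hN hn1, Real.div_rpow hN.le hn'.le, Real.rpow_neg hn'.le]
    ring
  rw [Finset.sum_congr rfl e, ← Finset.mul_sum]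
  rcases Nat.lt_or_ge m P with h | h
  · have h1 := key P h
    have h2 : (0 : ℝ) ≤ (P : ℝ) ^ (-(2 * κ)) / (2 * κ) := by positivity
    calc _ ≤ N ^ (2 * κ) * ((m + 1 : ℝ) ^ (-(2 * κ)) / (m + 1) + (m + 1 : ℝ) ^ (-(2 * κ)) / (2 * κ)) := by
          gcongr; linarith
      _ = N ^ (2 * κ) * (m + 1 : ℝ) ^ (-(2 * κ)) * (1 / (m + 1) + 1 / (2 * κ)) := by ring
      _ ≤ _ := by gcongr
  · rw [Finset.Ioc_eq_empty_of_le h]; simp; positivity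

lemma integral_exp_neg_sq_div_le {κ : ℝ} (hκ : 0 < κ) {L : ℝ} (hL : 0 ≤ L) :
    ∫ v in (-L)..L, 1 / κ * Real.exp (-(v ^ 2 / κ ^ 2)) ≤ 2 := by
  have e : ∀ v : ℝ, Real.exp (-(v ^ 2 / κ ^ 2)) = Real.exp (-(1 / κ ^ 2) * v ^ 2) := by
    intro v; congr 1; ring
  simp_rw [e]
  rw [intervalIntegral.integral_const_mul, intervalIntegral.integral_of_le (by linarith)]
  have hi := integrable_exp_neg_mul_sq (b := 1 / κ ^ 2) (by positivity)
  have h1 := MeasureTheory.setIntegral_le_integral (s := Set.Ioc (-L) L) hi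
    (Eventually.of_forall fun v => (Real.exp_pos _).le)
  rw [integral_gaussian, div_div_eq_mul_div, div_one, Real.sqrt_mul Real.pi_pos.le,
    Real.sqrt_sq hκ.le] at h1
  have h2 : √Real.pi ≤ 2 := by
    rw [Real.sqrt_le_left (by norm_num)]
    linarith [Real.pi_le_four]
  calc _ ≤ 1 / κ * (√Real.pi * κ) := by gcongr
    _ = √Real.pi := by field_simp
    _ ≤ 2 := h2

/-- The mean square of the remainder in the approximate functional equation. -/
lemma integral_afeRem_sq_le {T κ L A B : ℝ} {m P : ℕ} (hT : 0 < T) (hκ : 1 ≤ κ) (hL : 0 ≤ L)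
    (hm1 : (m : ℝ) + 1 ≤ afeLength T) (hm2 : afeLength T * Real.exp (-(1 / κ)) ≤ m + 1)
    (hmκ : κ ≤ m + 1) (hmP : m ≤ P) (hP : 0 < P) (hAB : A ≤ B) :
    ∫ t in A..B, afeRem T κ L m P t ^ 2 ≤ 112 * ((B - A) + 4 * P * (1 + Real.log P)) / κ := by
  set N := afeLength T
  have hN : 0 < N := afeLength_pos hT
  set D₁ := dirSum (Finset.Ioc m P) (afeCoef N κ)
  set D₂ := dirSum (Finset.Icc 1 m) (afeCoef N (-κ))
  have hc1 : Continuous D₁ := continuous_dirSum _ _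
  have hc2 : Continuous D₂ := continuous_dirSum _ _
  have hP1 : (1 : ℝ) ≤ P := by exact_mod_cast hP
  have hlog : 0 ≤ Real.log P := Real.log_nonneg hP1
  set Q := (B - A) + 4 * P * (1 + Real.log P)
  have hQ : 0 ≤ Q := by simp only [Q]; have := sub_nonneg.mpr hAB; positivity
  have e : ∀ t, afeRem T κ L m P t =
      ∫ v in (-L)..L, 1 / κ * Real.exp (-(v ^ 2 / κ ^ 2)) * (‖D₁ (t + v)‖ + ‖D₂ (t + v)‖) := by
    intro t
    rw [afeRem, ← intervalIntegral.integral_const_mul]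
    refine intervalIntegral.integral_congr fun v _ => ?_
    simp only [D₁, D₂, N]; ring
  have hmv : ∀ (s : Finset ℕ) (a : ℕ → ℂ), s ⊆ Finset.Icc 1 P → ∀ v : ℝ,
      ∫ t in A..B, ‖dirSum s a (t + v)‖ ^ 2 ≤ Q * ∑ n ∈ s, ‖a n‖ ^ 2 := by
    intro s a hs v
    rw [intervalIntegral.integral_comp_add_right (fun t => ‖dirSum s a t‖ ^ 2)]
    have h := (abs_le.mp (abs_integral_norm_sq_dirSum_sub_le hs a (A + v) (B + v))).2
    simp only [Q]
    nlinarith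
  have hK : ∀ v ∈ Set.Icc (-L) L, ∫ t in A..B, (‖D₁ (t + v)‖ + ‖D₂ (t + v)‖) ^ 2 ≤ 28 * Q / κ := by
    intro v _
    have h1 := hmv (Finset.Ioc m P) (afeCoef N κ) (by intro n; simp; lia) v
    have h2 := hmv (Finset.Icc 1 m) (afeCoef N (-κ)) (by intro n; simp; lia) v
    have h3 := sum_norm_sq_afeCoef_le (P := P) hN hκ hm2
    have h4 := sum_norm_sq_afeCoef_neg_le hN hκ hm1
    have h5 : 1 / ((m : ℝ) + 1) ≤ 1 / κ := by gcongr
    have h6 : 1 / (2 * κ) = 1 / κ / 2 := by ring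
    calc _ ≤ ∫ t in A..B, (2 * ‖D₁ (t + v)‖ ^ 2 + 2 * ‖D₂ (t + v)‖ ^ 2) := by
          refine intervalIntegral.integral_mono_on hAB
            (Continuous.intervalIntegrable (by fun_prop) _ _)
            (Continuous.intervalIntegrable (by fun_prop) _ _) fun t _ => ?_
          nlinarith [sq_nonneg (‖D₁ (t + v)‖ - ‖D₂ (t + v)‖)]
      _ = 2 * (∫ t in A..B, ‖D₁ (t + v)‖ ^ 2) + 2 * ∫ t in A..B, ‖D₂ (t + v)‖ ^ 2 := by
          rw [intervalIntegral.integral_add (Continuous.intervalIntegrable (by fun_prop) _ _)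
            (Continuous.intervalIntegrable (by fun_prop) _ _), intervalIntegral.integral_const_mul,
            intervalIntegral.integral_const_mul]
      _ ≤ 2 * (Q * ∑ n ∈ Finset.Ioc m P, ‖afeCoef N κ n‖ ^ 2) +
          2 * (Q * ∑ n ∈ Finset.Icc 1 m, ‖afeCoef N (-κ) n‖ ^ 2) := by linarith
      _ ≤ 2 * (Q * (9 * (1 / κ + 1 / κ / 2))) + 2 * (Q * (1 / κ / 2)) := by
          rw [h6] at h3 h4; gcongr; linarith
      _ = 28 * Q / κ := by ring
  simp_rw [e]
  have hfin := integral_sq_integral_mul_le (p := fun v => 1 / κ * Real.exp (-(v ^ 2 / κ ^ 2)))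
    (f := fun t => ‖D₁ t‖ + ‖D₂ t‖) (by fun_prop) (fun v => by positivity) (by fun_prop)
    (by linarith : -L ≤ L) hAB hK
  refine hfin.trans ?_
  have h2 := integral_exp_neg_sq_div_le (by linarith : 0 < κ) hL
  have h0 : 0 ≤ ∫ v in (-L)..L, 1 / κ * Real.exp (-(v ^ 2 / κ ^ 2)) :=
    intervalIntegral.integral_nonneg (by linarith) fun v _ => by positivity
  calc _ ≤ 2 ^ 2 * (28 * Q / κ) := by gcongr
    _ = _ := by ring

/-- The integral of `e^{ihy}` over `0 ≤ h ≤ H`. -/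
noncomputable def gapInt (H y : ℝ) : ℂ := ∫ h in (0 : ℝ)..H, Complex.exp ((h * y : ℝ) * Complex.I)

lemma norm_gapInt_le {H : ℝ} (hH : 0 ≤ H) (y : ℝ) : ‖gapInt H y‖ ≤ H := by
  have := intervalIntegral.norm_integral_le_of_norm_le_const (a := 0) (b := H) (C := 1)
    (f := fun h : ℝ => Complex.exp ((h * y : ℝ) * Complex.I))
    (fun h _ => (Complex.norm_exp_ofReal_mul_I _).le)
  simpa [gapInt, abs_of_nonneg hH] using this

lemma norm_gapInt_le_div (H : ℝ) {y : ℝ} (hy : y ≠ 0) : ‖gapInt H y‖ ≤ 2 / |y| :=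
  norm_integral_exp_mul_I_le hy 0 H

lemma norm_exp_mul_I_sub_le (a b : ℝ) :
    ‖Complex.exp (a * Complex.I) - Complex.exp (b * Complex.I)‖ ≤ |a - b| := by
  have e : Complex.exp (a * Complex.I) - Complex.exp (b * Complex.I) =
      Complex.exp (b * Complex.I) * (Complex.exp (Complex.I * (a - b : ℝ)) - 1) := by
    rw [mul_sub, ← Complex.exp_add, mul_one]
    congr 2
    push_cast
    ring
  rw [e, norm_mul, Complex.norm_exp_ofReal_mul_I, one_mul]
  exact Real.norm_exp_I_mul_ofReal_sub_one_le

lemma norm_gapInt_sub_le {H : ℝ} (hH : 0 ≤ H) (y z : ℝ) :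
    ‖gapInt H y - gapInt H z‖ ≤ H ^ 2 * |y - z| := by
  rw [gapInt, gapInt, ← intervalIntegral.integral_sub
    (Continuous.intervalIntegrable (by fun_prop) _ _)
    (Continuous.intervalIntegrable (by fun_prop) _ _)]
  have := intervalIntegral.norm_integral_le_of_norm_le_const (a := 0) (b := H) (C := H * |y - z|)
    (f := fun h : ℝ => Complex.exp ((h * y : ℝ) * Complex.I) - Complex.exp ((h * z : ℝ) * Complex.I))
    (fun h hh => by
      rw [Set.uIoc_of_le hH] at hh
      refine (norm_exp_mul_I_sub_le _ _).trans ?_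
      rw [← mul_sub, abs_mul, abs_of_pos hh.1]
      exact mul_le_mul_of_nonneg_right hh.2 (abs_nonneg _))
  refine this.trans_eq ?_
  rw [sub_zero, abs_of_nonneg hH]; ring

lemma continuous_gapInt (H : ℝ) : Continuous (gapInt H) := by
  refine intervalIntegral.continuous_parametric_intervalIntegral_of_continuous' ?_ _ _
  fun_prop

lemma abs_norm_sq_gapInt_sub_le {H : ℝ} (hH : 0 ≤ H) (y z : ℝ) :
    |‖gapInt H y‖ ^ 2 - ‖gapInt H z‖ ^ 2| ≤ 2 * H ^ 3 * |y - z| := by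
  have h1 := (abs_norm_sub_norm_le (gapInt H y) (gapInt H z)).trans (norm_gapInt_sub_le hH y z)
  have h2 := norm_gapInt_le hH y
  have h3 := norm_gapInt_le hH z
  rw [sq_sub_sq, abs_mul, abs_of_nonneg (by positivity)]
  calc _ ≤ (H + H) * (H ^ 2 * |y - z|) := by gcongr
    _ = _ := by ring

lemma gapInt_eq (H : ℝ) {y : ℝ} (hy : y ≠ 0) :
    gapInt H y = (Complex.exp (H * y * Complex.I) - 1) / (y * Complex.I) := by
  have hc : (y * Complex.I : ℂ) ≠ 0 := by simp [hy]
  have e : ∀ t : ℝ, Complex.exp ((t * y : ℝ) * Complex.I) = Complex.exp ((y * Complex.I) * t) := by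
    intro t; congr 1; push_cast; ring
  simp_rw [gapInt, e]
  rw [integral_exp_mul_complex hc]
  simp only [Complex.ofReal_zero, mul_zero, Complex.exp_zero]
  congr 3; ring

lemma norm_sq_gapInt_eq (H : ℝ) {y : ℝ} (hy : y ≠ 0) : ((‖gapInt H y‖ ^ 2 : ℝ) : ℂ) =
    (2 - Complex.exp (H * y * Complex.I) - Complex.exp (-(H * y * Complex.I))) / y ^ 2 := by
  have hy' : (y : ℂ) ≠ 0 := by exact_mod_cast hy
  have hconj : starRingEnd ℂ (Complex.exp (H * y * Complex.I)) = Complex.exp (-(H * y * Complex.I)) := by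
    rw [← Complex.exp_conj]; simp
  push_cast
  rw [← Complex.mul_conj', gapInt_eq H hy, map_div₀, map_sub, hconj, map_mul, Complex.conj_I,
    Complex.conj_ofReal, map_one, div_mul_div_comm]
  have hmul : Complex.exp (H * y * Complex.I) * Complex.exp (-(H * y * Complex.I)) = 1 := by
    rw [← Complex.exp_add]; simp
  have hden : (y * Complex.I : ℂ) * (y * -Complex.I) = y ^ 2 := by
    linear_combination (-(y : ℂ) ^ 2) * Complex.I_sq
  rw [hden]
  congr 1
  linear_combination hmul

lemma integral_exp_mul_sub (H : ℝ) {c : ℂ} (hc : c ≠ 0) :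
    ∫ v in (0 : ℝ)..H, Complex.exp (c * v) * (H - v) =
      Complex.exp (c * H) / c ^ 2 - H / c - 1 / c ^ 2 := by
  have hd : ∀ v ∈ Set.uIcc 0 H, HasDerivAt
      (fun v : ℝ => Complex.exp (c * v) * (H - v) / c + Complex.exp (c * v) / c ^ 2)
      (Complex.exp (c * v) * (H - v)) v := by
    intro v _
    have h1 : HasDerivAt (fun v : ℝ => (v : ℂ)) 1 v := Complex.ofRealCLM.hasDerivAt
    have h2 := (h1.const_mul c).cexp
    have h3 := ((h2.mul (h1.const_sub (H : ℂ))).div_const c).add (h2.div_const (c ^ 2))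
    refine HasDerivAt.congr_deriv h3 ?_
    field_simp
    ring
  rw [intervalIntegral.integral_eq_sub_of_hasDerivAt hd
    (Continuous.intervalIntegrable (by fun_prop) _ _)]
  simp
  ring

lemma fourier_triangle {H : ℝ} (hH : 0 ≤ H) {w : ℝ} (hw : w ≠ 0) :
    FourierTransform.fourier (fun v : ℝ => ((max 0 (H - |v|) : ℝ) : ℂ)) w =
      (‖gapInt H (2 * Real.pi * w)‖ ^ 2 : ℝ) := by
  have hy : 2 * Real.pi * w ≠ 0 := by simp [hw, Real.pi_ne_zero]
  set y := 2 * Real.pi * w with hydef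
  have hy' : (y : ℂ) ≠ 0 := by exact_mod_cast hy
  rw [Real.fourier_real_eq_integral_exp_smul, norm_sq_gapInt_eq H hy]
  have e : ∀ v : ℝ, Complex.exp (↑(-2 * Real.pi * v * w) * Complex.I) • ((max 0 (H - |v|) : ℝ) : ℂ) =
      Complex.exp (-(y * Complex.I) * v) * ((max 0 (H - |v|) : ℝ) : ℂ) := by
    intro v
    rw [smul_eq_mul]
    congr 2
    simp only [hydef]; push_cast; ring
  simp_rw [e]
  rw [← MeasureTheory.setIntegral_eq_integral_of_forall_compl_eq_zero (s := Set.Ioc (-H) H)]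
  swap
  · intro v hv
    have : H ≤ |v| := by
      by_contra h
      push Not at h
      have := abs_lt.mp h
      exact hv ⟨this.1, this.2.le⟩
    rw [max_eq_left (by linarith)]; simp
  have hcont : Continuous fun v : ℝ => Complex.exp (-(y * Complex.I) * v) *
      ((max 0 (H - |v|) : ℝ) : ℂ) := by fun_prop
  rw [← intervalIntegral.integral_of_le (by linarith),
    ← intervalIntegral.integral_add_adjacent_intervals (b := 0) (hcont.intervalIntegrable _ _)
      (hcont.intervalIntegrable _ _)]
  have h1 : ∫ v in (0 : ℝ)..H, Complex.exp (-(y * Complex.I) * v) * ((max 0 (H - |v|) : ℝ) : ℂ) =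
      ∫ v in (0 : ℝ)..H, Complex.exp (-(y * Complex.I) * v) * (H - v) := by
    refine intervalIntegral.integral_congr fun v hv => ?_
    rw [Set.uIcc_of_le hH] at hv
    rw [abs_of_nonneg hv.1, max_eq_right (by linarith [hv.2])]
    push_cast; rfl
  have h2 : ∫ v in (-H)..0, Complex.exp (-(y * Complex.I) * v) * ((max 0 (H - |v|) : ℝ) : ℂ) =
      ∫ v in (0 : ℝ)..H, Complex.exp ((y * Complex.I) * v) * (H - v) := by
    have h0 := intervalIntegral.integral_comp_neg (a := 0) (b := H)
      (fun v : ℝ => Complex.exp (-(y * Complex.I) * v) * ((max 0 (H - |v|) : ℝ) : ℂ))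
    rw [neg_zero] at h0
    rw [h0.symm]
    refine intervalIntegral.integral_congr fun v hv => ?_
    rw [Set.uIcc_of_le hH] at hv
    rw [abs_neg, abs_of_nonneg hv.1, max_eq_right (by linarith [hv.2])]
    push_cast
    congr 2; ring
  have hc : (y * Complex.I : ℂ) ≠ 0 := by simp [hy]
  have hc' : -(y * Complex.I : ℂ) ≠ 0 := neg_ne_zero.mpr hc
  rw [h1, h2, integral_exp_mul_sub H hc, integral_exp_mul_sub H hc']
  have hsq : (y * Complex.I : ℂ) ^ 2 = -y ^ 2 := by rw [mul_pow, Complex.I_sq]; ring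
  have a1 : (y * Complex.I : ℂ) * H = H * y * Complex.I := by ring
  have a2 : -(y * Complex.I : ℂ) * H = -(H * y * Complex.I) := by ring
  rw [neg_sq, hsq, a1, a2]
  field_simp
  ring

lemma norm_sq_gapInt_le {H : ℝ} (hH : 0 ≤ H) (y : ℝ) :
    ‖gapInt H y‖ ^ 2 ≤ (H ^ 2 + 4) * (1 + y ^ 2)⁻¹ := by
  rw [← div_eq_mul_inv, le_div_iff₀ (by positivity)]
  have h1 : ‖gapInt H y‖ ^ 2 ≤ H ^ 2 := by have := norm_gapInt_le hH y; gcongr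
  have h2 : ‖gapInt H y‖ ^ 2 * y ^ 2 ≤ 4 := by
    rcases eq_or_ne y 0 with rfl | hy
    · norm_num
    · have := norm_gapInt_le_div H hy
      rw [le_div_iff₀ (abs_pos.mpr hy)] at this
      rw [← sq_abs y, ← mul_pow]
      calc _ ≤ (2 : ℝ) ^ 2 := by gcongr
        _ = 4 := by norm_num
  nlinarith

lemma integrable_norm_sq_gapInt {H : ℝ} (hH : 0 ≤ H) :
    MeasureTheory.Integrable fun y => ‖gapInt H y‖ ^ 2 := by
  have hc := continuous_gapInt H
  refine (integrable_inv_one_add_sq.const_mul (H ^ 2 + 4)).mono'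
    (Continuous.aestronglyMeasurable (by fun_prop)) (Eventually.of_forall fun y => ?_)
  rw [Real.norm_of_nonneg (by positivity)]
  exact norm_sq_gapInt_le hH y

lemma integral_norm_sq_gapInt {H : ℝ} (hH : 0 ≤ H) : ∫ y, ‖gapInt H y‖ ^ 2 = 2 * Real.pi * H := by
  set f : ℝ → ℂ := fun v : ℝ => ((max 0 (H - |v|) : ℝ) : ℂ) with hf
  have hfc : Continuous f := by fun_prop
  have hfi : MeasureTheory.Integrable f := by
    refine hfc.integrable_of_hasCompactSupport ?_
    refine HasCompactSupport.intro (isCompact_Icc (a := -H) (b := H)) fun v hv => ?_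
    have : H ≤ |v| := by
      by_contra h
      push Not at h
      have := abs_lt.mp h
      exact hv ⟨this.1.le, this.2.le⟩
    simp only [hf]
    rw [max_eq_left (by linarith)]; simp
  have hpi : (2 * Real.pi) ≠ 0 := by positivity
  have hae : (FourierTransform.fourier f : ℝ → ℂ) =ᵐ[MeasureTheory.volume]
      fun w => ((‖gapInt H (2 * Real.pi * w)‖ ^ 2 : ℝ) : ℂ) := by
    filter_upwards [MeasureTheory.Measure.ae_ne MeasureTheory.volume (0 : ℝ)] with w hw
    exact fourier_triangle hH hw
  have hFi : MeasureTheory.Integrable (FourierTransform.fourier f : ℝ → ℂ) := by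
    rw [MeasureTheory.integrable_congr hae]
    exact ((integrable_norm_sq_gapInt hH).comp_mul_left' hpi).ofReal
  have hinv := congrFun (hfc.fourierInv_fourier_eq hfi hFi) 0
  rw [Real.fourierInv_eq'] at hinv
  simp only [inner_zero_right, mul_zero, Complex.ofReal_zero, zero_mul, Complex.exp_zero, one_smul] at hinv
  rw [MeasureTheory.integral_congr_ae hae, integral_complex_ofReal,
    MeasureTheory.Measure.integral_comp_mul_left (fun y => ‖gapInt H y‖ ^ 2)] at hinv
  simp only [hf, abs_zero, sub_zero, max_eq_right hH, smul_eq_mul] at hinv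
  have := Complex.ofReal_injective hinv
  rw [abs_of_pos (by positivity)] at this
  field_simp at this
  linarith

lemma abs_integral_norm_sq_gapInt_sub_le {H Y : ℝ} (hH : 0 ≤ H) (hY : 0 < Y) :
    |(∫ y in (0 : ℝ)..Y, ‖gapInt H y‖ ^ 2) - Real.pi * H| ≤ 4 / Y := by
  have hi := integrable_norm_sq_gapInt hH
  have heven : ∀ y : ℝ, ‖gapInt H (-y)‖ ^ 2 = ‖gapInt H y‖ ^ 2 := by
    intro y
    have : gapInt H (-y) = starRingEnd ℂ (gapInt H y) := by
      rw [gapInt, gapInt, intervalIntegral.integral_of_le hH, intervalIntegral.integral_of_le hH,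
        ← integral_conj]
      refine MeasureTheory.integral_congr_ae (Eventually.of_forall fun h => ?_)
      simp only
      rw [← Complex.exp_conj, map_mul, Complex.conj_I, Complex.conj_ofReal]
      congr 1; push_cast; ring
    rw [this, RCLike.norm_conj]
  have hhalf : ∫ y in Set.Ioi (0 : ℝ), ‖gapInt H y‖ ^ 2 = Real.pi * H := by
    have h1 := integral_comp_abs (f := fun y => ‖gapInt H y‖ ^ 2)
    have h2 : (fun y : ℝ => ‖gapInt H |y|‖ ^ 2) = fun y => ‖gapInt H y‖ ^ 2 := by
      ext y
      rcases abs_choice y with h | h <;> rw [h]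
      exact heven y
    rw [h2, integral_norm_sq_gapInt hH] at h1
    linarith
  have hsplit := intervalIntegral.integral_Ioi_sub_Ioi (f := fun y => ‖gapInt H y‖ ^ 2) (a := 0) (b := Y)
    hi.integrableOn hY.le
  rw [hhalf] at hsplit
  have htail : ∫ y in Set.Ioi Y, ‖gapInt H y‖ ^ 2 ≤ 4 / Y := by
    have h1 : ∫ y in Set.Ioi Y, 4 * y ^ (-2 : ℝ) = 4 / Y := by
      rw [MeasureTheory.integral_const_mul, integral_Ioi_rpow_of_lt (by norm_num) hY]
      norm_num
      rw [Real.rpow_neg_one]; ring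
    rw [← h1]
    refine MeasureTheory.setIntegral_mono_on hi.integrableOn
      ((integrableOn_Ioi_rpow_of_lt (by norm_num) hY).const_mul 4) measurableSet_Ioi fun y hy => ?_
    have hy0 : 0 < y := hY.trans hy
    have h2 := norm_gapInt_le_div H hy0.ne'
    rw [abs_of_pos hy0] at h2
    calc _ ≤ (2 / y) ^ 2 := by gcongr
      _ = _ := by rw [Real.rpow_neg hy0.le]; norm_num; ring
  have h0 : 0 ≤ ∫ y in Set.Ioi Y, ‖gapInt H y‖ ^ 2 :=
    MeasureTheory.integral_nonneg fun y => by positivity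
  rw [abs_le]
  have : 0 < 4 / Y := by positivity
  constructor <;> linarith

/-- Comparison of the sum over integers in `(r, m]` with the corresponding integral. -/
lemma abs_sum_norm_sq_gapInt_sub_integral_le {H N : ℝ} {r m : ℕ} (hH : 0 ≤ H) (hN : 0 < N)
    (hr : 0 < r) (hrm : r ≤ m) :
    |(∑ n ∈ Finset.Ioc r m, ‖gapInt H (Real.log (N / n))‖ ^ 2 / n) -
      ∫ y in (Real.log (N / (m + 1)))..(Real.log (N / (r + 1))), ‖gapInt H y‖ ^ 2| ≤
      (2 * H ^ 3 + H ^ 2) / r := by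
  have hgc := continuous_gapInt H
  have hcont : ContinuousOn (fun u : ℝ => ‖gapInt H (Real.log (N / u))‖ ^ 2 / u) (Set.Ioi 0) := by
    intro u hu
    have hu0 : u ≠ 0 := ne_of_gt hu
    have hl : ContinuousAt (fun u => Real.log (N / u)) u :=
      ContinuousAt.log (by fun_prop (disch := assumption)) (by positivity)
    have : ContinuousAt (fun u : ℝ => ‖gapInt H (Real.log (N / u))‖ ^ 2 / u) u := by
      refine ContinuousAt.div ?_ continuousAt_id hu0
      exact (ContinuousAt.norm (ContinuousAt.comp' hgc.continuousAt hl)).pow 2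
    exact this.continuousWithinAt
  have hii : ∀ a b : ℝ, 0 < a → a ≤ b → IntervalIntegrable
      (fun u : ℝ => ‖gapInt H (Real.log (N / u))‖ ^ 2 / u) MeasureTheory.volume a b := by
    intro a b ha hab
    refine ContinuousOn.intervalIntegrable (hcont.mono ?_)
    rw [Set.uIcc_of_le hab]
    exact fun u hu => ha.trans_le hu.1
  have hterm : ∀ n : ℕ, 0 < n → |‖gapInt H (Real.log (N / n))‖ ^ 2 / n -
      ∫ u in (n : ℝ)..(n + 1), ‖gapInt H (Real.log (N / u))‖ ^ 2 / u| ≤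
        (2 * H ^ 3 + H ^ 2) * (1 / (n : ℝ) ^ 2) := by
    intro n hn
    have hn0 : (0 : ℝ) < n := by exact_mod_cast hn
    have e : ‖gapInt H (Real.log (N / n))‖ ^ 2 / n =
        ∫ u in (n : ℝ)..(n + 1), ‖gapInt H (Real.log (N / n))‖ ^ 2 / n := by
      simp
    rw [e, ← intervalIntegral.integral_sub (by simp) (hii _ _ hn0 (by linarith)), ← Real.norm_eq_abs]
    have := intervalIntegral.norm_integral_le_of_norm_le_const (a := (n : ℝ)) (b := n + 1)
      (C := (2 * H ^ 3 + H ^ 2) * (1 / (n : ℝ) ^ 2))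
      (f := fun u : ℝ => ‖gapInt H (Real.log (N / n))‖ ^ 2 / n - ‖gapInt H (Real.log (N / u))‖ ^ 2 / u)
      (fun u hu => ?_)
    · simpa using this
    · rw [Set.uIoc_of_le (by linarith)] at hu
      have hu0 : 0 < u := hn0.trans hu.1
      have h1 := abs_norm_sq_gapInt_sub_le hH (Real.log (N / n)) (Real.log (N / u))
      have hlog : |Real.log (N / n) - Real.log (N / u)| ≤ 1 / n := by
        rw [Real.log_div hN.ne' hn0.ne', Real.log_div hN.ne' hu0.ne']
        have e1 : Real.log N - Real.log n - (Real.log N - Real.log u) = Real.log (u / n) := by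
          rw [Real.log_div hu0.ne' hn0.ne']; ring
        rw [e1, abs_of_nonneg (Real.log_nonneg (by rw [le_div_iff₀ hn0]; linarith [hu.1]))]
        have := Real.log_le_sub_one_of_pos (div_pos hu0 hn0)
        have h3 : u / n ≤ 1 + 1 / n := by rw [div_le_iff₀ hn0]; field_simp; linarith [hu.2]
        linarith
      have h2 : ‖gapInt H (Real.log (N / u))‖ ^ 2 ≤ H ^ 2 := by
        have := norm_gapInt_le hH (Real.log (N / u)); gcongr
      have h4 : |1 / (n : ℝ) - 1 / u| ≤ 1 / (n : ℝ) ^ 2 := by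
        rw [abs_of_nonneg (by rw [sub_nonneg]; exact one_div_le_one_div_of_le hn0 hu.1.le),
          div_sub_div _ _ hn0.ne' hu0.ne', div_le_div_iff₀ (by positivity) (by positivity)]
        nlinarith [hu.1, hu.2]
      have e2 : ‖gapInt H (Real.log (N / n))‖ ^ 2 / n - ‖gapInt H (Real.log (N / u))‖ ^ 2 / u =
          (‖gapInt H (Real.log (N / n))‖ ^ 2 - ‖gapInt H (Real.log (N / u))‖ ^ 2) * (1 / n) +
          ‖gapInt H (Real.log (N / u))‖ ^ 2 * (1 / n - 1 / u) := by ring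
      rw [e2, Real.norm_eq_abs]
      refine (abs_add_le _ _).trans ?_
      rw [abs_mul, abs_mul, abs_of_nonneg (by positivity : (0 : ℝ) ≤ 1 / n),
        abs_of_nonneg (by positivity : 0 ≤ ‖gapInt H (Real.log (N / u))‖ ^ 2)]
      calc _ ≤ (2 * H ^ 3 * (1 / n)) * (1 / n) + H ^ 2 * (1 / (n : ℝ) ^ 2) := by
            gcongr
            exact h1.trans (by gcongr)
        _ = _ := by ring
  have hsq : ∀ k : ℕ, r ≤ k → ∑ n ∈ Finset.Ioc r k, 1 / (n : ℝ) ^ 2 ≤ 1 / (r : ℝ) - 1 / (k : ℝ) := by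
    intro k hk
    induction k, hk using Nat.le_induction with
    | base => simp
    | succ k hk ih =>
      rw [Finset.sum_Ioc_succ_top (by lia)]
      have hk0 : (0 : ℝ) < k := by exact_mod_cast (by lia : 0 < k)
      have : 1 / ((k : ℝ) + 1) ^ 2 ≤ 1 / k - 1 / (k + 1) := by
        rw [div_sub_div _ _ hk0.ne' (by positivity), div_le_div_iff₀ (by positivity) (by positivity)]
        nlinarith
      push_cast
      linarith
  have hint : ∀ k : ℕ, r ≤ k →
      ∑ n ∈ Finset.Ioc r k, ∫ u in (n : ℝ)..(n + 1), ‖gapInt H (Real.log (N / u))‖ ^ 2 / u =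
        ∫ u in ((r : ℝ) + 1)..(k + 1), ‖gapInt H (Real.log (N / u))‖ ^ 2 / u := by
    intro k hk
    induction k, hk using Nat.le_induction with
    | base => simp
    | succ k hk ih =>
      have hrk : (r : ℝ) ≤ k := by exact_mod_cast hk
      rw [Finset.sum_Ioc_succ_top (by lia), ih]
      push_cast
      rw [intervalIntegral.integral_add_adjacent_intervals (hii _ _ (by positivity) (by linarith))
        (hii _ _ (by positivity) (by linarith))]
  have hsub : ∫ y in (Real.log (N / (m + 1)))..(Real.log (N / (r + 1))), ‖gapInt H y‖ ^ 2 =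
      ∫ u in ((r : ℝ) + 1)..(m + 1), ‖gapInt H (Real.log (N / u))‖ ^ 2 / u := by
    have hrm' : (r : ℝ) ≤ m := by exact_mod_cast hrm
    have hpos : ∀ u ∈ Set.uIcc ((r : ℝ) + 1) (m + 1), 0 < u := by
      intro u hu
      rw [Set.uIcc_of_le (by linarith)] at hu
      have : (0 : ℝ) < r + 1 := by positivity
      linarith [hu.1]
    have h1 := intervalIntegral.integral_comp_mul_deriv' (a := (r : ℝ) + 1) (b := m + 1)
      (f := fun u => Real.log (N / u)) (f' := fun u => -(1 / u)) (g := fun y => ‖gapInt H y‖ ^ 2)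
      (fun u hu => by
        have hu0 := hpos u hu
        have : HasDerivAt (fun u => Real.log N - Real.log u) (-(1 / u)) u := by
          simpa [one_div] using (Real.hasDerivAt_log hu0.ne').const_sub (Real.log N)
        refine this.congr_of_eventuallyEq ?_
        filter_upwards [lt_mem_nhds hu0] with x hx
        rw [Real.log_div hN.ne' hx.ne'])
      (by
        intro u hu
        have hu0 := (hpos u hu).ne'
        exact ContinuousAt.continuousWithinAt (by fun_prop (disch := assumption)))
      (by fun_prop)
    rw [intervalIntegral.integral_symm, ← h1, ← intervalIntegral.integral_neg]
    refine intervalIntegral.integral_congr fun u _ => ?_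
    simp only [Function.comp]
    ring
  rw [hsub, ← hint m hrm, ← Finset.sum_sub_distrib]
  refine (Finset.abs_sum_le_sum_abs _ _).trans ?_
  refine (Finset.sum_le_sum fun n hn => hterm n (by have := (Finset.mem_Ioc.mp hn).1; lia)).trans ?_
  rw [← Finset.mul_sum, div_eq_mul_one_div]
  have := hsq m hrm
  have h0 : (0 : ℝ) ≤ 1 / m := by positivity
  gcongr
  linarith

/-- Asymptotic evaluation of the diagonal sum. -/
lemma abs_sum_norm_sq_gapInt_sub_le {H N κ : ℝ} {m : ℕ} (hH : 0 ≤ H) (hκ : 1 ≤ κ) (hN : 16 ≤ N)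
    (hm1 : (m : ℝ) + 1 ≤ N) (hm2 : N * Real.exp (-(1 / κ)) ≤ m + 1) :
    |(∑ n ∈ Finset.Icc 1 m, ‖gapInt H (Real.log (N / n))‖ ^ 2 / n) - Real.pi * H| ≤
      40 / Real.log N + H ^ 2 / κ + 2 * (2 * H ^ 3 + H ^ 2) / √N := by
  have hN0 : 0 < N := by linarith
  set s := √N with hs
  have hs4 : 4 ≤ s := Real.le_sqrt_of_sq_le (by norm_num; exact hN)
  have hsN : s ^ 2 = N := Real.sq_sqrt hN0.le
  set r := ⌊s⌋₊ with hr
  have hr1 : (r : ℝ) ≤ s := Nat.floor_le (by positivity)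
  have hr2 : s < r + 1 := Nat.lt_floor_add_one s
  have hr0 : 0 < r := Nat.floor_pos.mpr (by linarith)
  have hm0 : (0 : ℝ) < m + 1 := by positivity
  have hm3 : N ≤ (m + 1) * Real.exp (1 / κ) := by
    rw [Real.exp_neg, ← div_eq_mul_inv, div_le_iff₀ (Real.exp_pos _)] at hm2
    exact hm2
  have hrm : r ≤ m := by
    have h1 : Real.exp (1 / κ) ≤ 3 := by
      refine (Real.exp_le_exp.mpr ?_).trans Real.exp_one_lt_three.le
      rw [div_le_one (by linarith)]; exact hκ
    have h2 : N ≤ (m + 1) * 3 := hm3.trans (by gcongr)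
    have : (r : ℝ) ≤ m := by nlinarith
    exact_mod_cast this
  have hlogN : 1 ≤ Real.log N := by
    rw [Real.le_log_iff_exp_le hN0]
    linarith [Real.exp_one_lt_three]
  have hlogs : Real.log s = Real.log N / 2 := by
    rw [← hsN, Real.log_pow]; push_cast; ring
  set δ := Real.log (N / (m + 1)) with hδ
  set Y := Real.log (N / (r + 1)) with hY
  have hδ0 : 0 ≤ δ := Real.log_nonneg (by rw [le_div_iff₀ hm0]; linarith)
  have hδ1 : δ ≤ 1 / κ := by
    rw [hδ, Real.log_le_iff_le_exp (by positivity), div_le_iff₀ hm0, mul_comm]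
    exact hm3
  have hY1 : Real.log N / 4 ≤ Y := by
    have h1 : √s ≤ N / (r + 1) := by
      rw [le_div_iff₀ (by positivity), ← hsN]
      have h2 : √s ^ 2 = s := Real.sq_sqrt (by linarith)
      have h3 : 2 ≤ √s := Real.le_sqrt_of_sq_le (by norm_num; exact hs4)
      calc √s * (r + 1) ≤ √s * (2 * s) := by gcongr; linarith
        _ ≤ √s * √s * s := by rw [mul_assoc]; gcongr
        _ = s ^ 2 := by rw [← sq, h2]; ring
    have h2 := Real.log_le_log (by positivity) h1
    rw [Real.log_sqrt (by linarith), hlogs] at h2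
    linarith
  have hY0 : 0 < Y := by linarith
  have hsmall : ∑ n ∈ Finset.Icc 1 r, ‖gapInt H (Real.log (N / n))‖ ^ 2 / n ≤ 24 / Real.log N := by
    have h1 : ∀ n ∈ Finset.Icc 1 r, ‖gapInt H (Real.log (N / n))‖ ^ 2 / n ≤
        16 / Real.log N ^ 2 * (1 / (n : ℝ)) := by
      intro n hn
      have hn1 := Finset.mem_Icc.mp hn
      have hn0 : (0 : ℝ) < n := by exact_mod_cast (by lia : 0 < n)
      have hnr : (n : ℝ) ≤ r := by exact_mod_cast hn1.2
      have h2 : Real.log N / 2 ≤ Real.log (N / n) := by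
        rw [← hlogs]
        refine Real.log_le_log (by linarith) ?_
        rw [le_div_iff₀ hn0]
        nlinarith
      have h3 := norm_gapInt_le_div H (y := Real.log (N / n)) (by linarith)
      rw [abs_of_pos (by linarith)] at h3
      rw [div_eq_mul_one_div]
      gcongr
      calc _ ≤ (2 / (Real.log N / 2)) ^ 2 := by
            gcongr
            exact h3.trans (by gcongr)
        _ = _ := by field_simp; norm_num
    have hH' : ∑ k ∈ Finset.Icc 1 r, 1 / (k : ℝ) ≤ 1 + Real.log r := by
      have := harmonic_le_one_add_log r
      rw [harmonic_eq_sum_Icc] at this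
      push_cast at this
      simpa [one_div] using this
    have hlr : Real.log r ≤ Real.log N / 2 := by
      rw [← hlogs]; exact Real.log_le_log (by exact_mod_cast hr0) hr1
    refine (Finset.sum_le_sum h1).trans ?_
    rw [← Finset.mul_sum]
    calc _ ≤ 16 / Real.log N ^ 2 * (3 / 2 * Real.log N) := by gcongr; linarith
      _ = _ := by field_simp; norm_num
  have hsmall0 : 0 ≤ ∑ n ∈ Finset.Icc 1 r, ‖gapInt H (Real.log (N / n))‖ ^ 2 / n :=
    Finset.sum_nonneg fun _ _ => by positivity
  have hbig := abs_sum_norm_sq_gapInt_sub_integral_le hH hN0 hr0 hrm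
  have hsum : ∑ n ∈ Finset.Icc 1 m, ‖gapInt H (Real.log (N / n))‖ ^ 2 / n =
      (∑ n ∈ Finset.Icc 1 r, ‖gapInt H (Real.log (N / n))‖ ^ 2 / n) +
        ∑ n ∈ Finset.Ioc r m, ‖gapInt H (Real.log (N / n))‖ ^ 2 / n := by
    rw [← Finset.sum_union]
    · congr 1; ext n; simp; lia
    · rw [Finset.disjoint_left]; intro n; simp; lia
  have hgc := continuous_gapInt H
  have hii : ∀ a b : ℝ, IntervalIntegrable (fun y => ‖gapInt H y‖ ^ 2) MeasureTheory.volume a b :=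
    fun a b => Continuous.intervalIntegrable (by fun_prop) _ _
  have hadj := intervalIntegral.integral_add_adjacent_intervals (hii 0 δ) (hii δ Y)
  have hδint : |∫ y in (0 : ℝ)..δ, ‖gapInt H y‖ ^ 2| ≤ H ^ 2 / κ := by
    have := intervalIntegral.norm_integral_le_of_norm_le_const (a := 0) (b := δ) (C := H ^ 2)
      (f := fun y => ‖gapInt H y‖ ^ 2) (fun y _ => by
        rw [norm_pow, norm_norm]
        have := norm_gapInt_le hH y
        gcongr)
    rw [Real.norm_eq_abs, sub_zero, abs_of_nonneg hδ0] at this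
    refine this.trans ?_
    rw [div_eq_mul_one_div]
    gcongr
  have hpi := abs_integral_norm_sq_gapInt_sub_le hH hY0
  have h4Y : 4 / Y ≤ 16 / Real.log N := by
    rw [div_le_div_iff₀ hY0 (by linarith)]; linarith
  have hrs : (2 * H ^ 3 + H ^ 2) / r ≤ 2 * (2 * H ^ 3 + H ^ 2) / s := by
    rw [div_le_div_iff₀ (by exact_mod_cast hr0) (by linarith)]
    have : s ≤ 2 * r := by
      have : (1 : ℝ) ≤ r := by exact_mod_cast hr0
      linarith
    have h0 : 0 ≤ 2 * H ^ 3 + H ^ 2 := by positivity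
    nlinarith
  have h40 : 40 / Real.log N = 24 / Real.log N + 16 / Real.log N := by ring
  rw [hsum, h40]
  rw [abs_le] at *
  constructor <;> linarith [hbig.1, hbig.2, hδint.1, hδint.2, hpi.1, hpi.2]

/-- First derivative test for a phase with increasing derivative `log (t / c) ≥ δ`. -/
lemma norm_integral_exp_phase_le {f : ℝ → ℝ} {A B c δ : ℝ} (hA : 0 < A) (hAB : A ≤ B) (hc : 0 < c)
    (hδ : 0 < δ) (hδA : δ ≤ Real.log (A / c))
    (hf : ∀ t ∈ Set.Icc A B, HasDerivAt f (Real.log (t / c)) t) :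
    ‖∫ t in A..B, Complex.exp (f t * Complex.I)‖ ≤ 3 / δ := by
  have hpos : ∀ t ∈ Set.Icc A B, 0 < t := fun t ht => hA.trans_le ht.1
  have hlog : ∀ t ∈ Set.Icc A B, δ ≤ Real.log (t / c) := by
    intro t ht
    refine hδA.trans (Real.log_le_log (by positivity) ?_)
    have := ht.1
    gcongr
  have hderlog : ∀ t ∈ Set.Icc A B, HasDerivAt (fun t => Real.log (t / c)) (1 / t) t := by
    intro t ht
    have ht0 := hpos t ht
    have h1 : HasDerivAt (fun t => t / c) (1 / c) t := (hasDerivAt_id t).div_const c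
    have h2 := h1.log (by positivity)
    refine h2.congr_deriv ?_
    field_simp
  have hfc : ContinuousOn f (Set.Icc A B) := fun t ht => (hf t ht).continuousAt.continuousWithinAt
  have hlc : ContinuousOn (fun t => Real.log (t / c)) (Set.Icc A B) :=
    fun t ht => (hderlog t ht).continuousAt.continuousWithinAt
  have hne : ∀ t ∈ Set.Icc A B, Real.log (t / c) ≠ 0 := fun t ht => by
    have := hlog t ht; linarith
  have hec : ContinuousOn (fun t => Complex.exp (f t * Complex.I)) (Set.Icc A B) := by
    refine ContinuousOn.cexp (ContinuousOn.mul ?_ continuousOn_const)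
    exact Complex.continuous_ofReal.comp_continuousOn hfc
  have hrc : ContinuousOn (fun t => 1 / t / Real.log (t / c) ^ 2) (Set.Icc A B) := by
    refine ContinuousOn.div (continuousOn_const.div continuousOn_id fun t ht => (hpos t ht).ne')
      (hlc.pow 2) fun t ht => pow_ne_zero 2 (hne t ht)
  have hcc : ContinuousOn (fun t => Complex.exp (f t * Complex.I) *
      (1 / Complex.I * ((1 / t / Real.log (t / c) ^ 2 : ℝ) : ℂ))) (Set.Icc A B) :=
    hec.mul (continuousOn_const.mul (Complex.continuous_ofReal.comp_continuousOn hrc))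
  have huIcc : Set.uIcc A B = Set.Icc A B := Set.uIcc_of_le hAB
  have hder : ∀ t ∈ Set.uIcc A B, HasDerivAt
      (fun t => Complex.exp (f t * Complex.I) * (1 / Complex.I * (((Real.log (t / c))⁻¹ : ℝ) : ℂ)))
      (Complex.exp (f t * Complex.I) - Complex.exp (f t * Complex.I) *
        (1 / Complex.I * ((1 / t / Real.log (t / c) ^ 2 : ℝ) : ℂ))) t := by
    intro t ht
    rw [huIcc] at ht
    have h1 := ((hf t ht).ofReal_comp.mul_const Complex.I).cexp
    have h2 := ((((hderlog t ht).inv (hne t ht)).ofReal_comp).const_mul (1 / Complex.I))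
    refine HasDerivAt.congr_deriv (h1.mul h2) ?_
    have hl : ((Real.log (t / c) : ℝ) : ℂ) ≠ 0 := by exact_mod_cast hne t ht
    have hI := Complex.I_ne_zero
    have hcancel : ((Real.log (t / c) : ℝ) : ℂ) * Complex.I * (1 / Complex.I *
        (((Real.log (t / c))⁻¹ : ℝ) : ℂ)) = 1 := by
      rw [Complex.ofReal_inv]; field_simp
    rw [mul_assoc (Complex.exp _), hcancel, neg_div, Complex.ofReal_neg]
    ring
  have hint1 : IntervalIntegrable (fun t => Complex.exp (f t * Complex.I)) MeasureTheory.volume A B :=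
    ContinuousOn.intervalIntegrable (by rwa [huIcc])
  have hint2 : IntervalIntegrable (fun t => Complex.exp (f t * Complex.I) *
      (1 / Complex.I * ((1 / t / Real.log (t / c) ^ 2 : ℝ) : ℂ))) MeasureTheory.volume A B :=
    ContinuousOn.intervalIntegrable (by rwa [huIcc])
  have hint3 : IntervalIntegrable (fun t => 1 / t / Real.log (t / c) ^ 2) MeasureTheory.volume A B :=
    ContinuousOn.intervalIntegrable (by rwa [huIcc])
  have hFTC := intervalIntegral.integral_eq_sub_of_hasDerivAt hder (hint1.sub hint2)
  rw [intervalIntegral.integral_sub hint1 hint2] at hFTC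
  have hFTC2 : ∫ t in A..B, 1 / t / Real.log (t / c) ^ 2 =
      (Real.log (A / c))⁻¹ - (Real.log (B / c))⁻¹ := by
    have := intervalIntegral.integral_eq_sub_of_hasDerivAt
      (f := fun t => -(Real.log (t / c))⁻¹) (f' := fun t => 1 / t / Real.log (t / c) ^ 2)
      (a := A) (b := B) (fun t ht => by
        rw [huIcc] at ht
        refine HasDerivAt.congr_deriv ((hderlog t ht).inv (hne t ht)).neg ?_
        ring) hint3
    rw [this]; ring
  have hnorm : ‖∫ t in A..B, Complex.exp (f t * Complex.I) *
      (1 / Complex.I * ((1 / t / Real.log (t / c) ^ 2 : ℝ) : ℂ))‖ ≤ 1 / δ := by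
    refine (intervalIntegral.norm_integral_le_of_norm_le hAB
      (Eventually.of_forall fun t ht => ?_) hint3).trans ?_
    · rw [norm_mul, Complex.norm_exp_ofReal_mul_I, norm_mul, Complex.norm_real, Real.norm_of_nonneg]
      · simp
      · have := hpos t (Set.Ioc_subset_Icc_self ht)
        positivity
    · rw [hFTC2]
      have h1 : (Real.log (A / c))⁻¹ ≤ 1 / δ := by
        rw [inv_eq_one_div]; gcongr
      have h2 : 0 < (Real.log (B / c))⁻¹ :=
        inv_pos.mpr (hδ.trans_le (hlog B (Set.right_mem_Icc.mpr hAB)))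
      linarith
  have hend : ∀ t ∈ Set.Icc A B, ‖Complex.exp (f t * Complex.I) *
      (1 / Complex.I * (((Real.log (t / c))⁻¹ : ℝ) : ℂ))‖ ≤ 1 / δ := by
    intro t ht
    have h1 := hlog t ht
    rw [norm_mul, Complex.norm_exp_ofReal_mul_I, norm_mul, Complex.norm_real, Real.norm_of_nonneg
      (inv_nonneg.mpr (by linarith))]
    simp only [one_div, norm_inv, Complex.norm_I, inv_one, one_mul]
    exact inv_anti₀ hδ h1
  have hA' := hend A (Set.left_mem_Icc.mpr hAB)
  have hB' := hend B (Set.right_mem_Icc.mpr hAB)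
  rw [sub_eq_iff_eq_add] at hFTC
  rw [hFTC]
  refine (norm_add_le _ _).trans ?_
  have := norm_sub_le (Complex.exp (f B * Complex.I) * (1 / Complex.I * (((Real.log (B / c))⁻¹ : ℝ) : ℂ)))
    (Complex.exp (f A * Complex.I) * (1 / Complex.I * (((Real.log (A / c))⁻¹ : ℝ) : ℂ)))
  have e : 3 / δ = 1 / δ + 1 / δ + 1 / δ := by ring
  rw [e]
  linarith

lemma hasDerivAt_stirlingPhase {t : ℝ} (ht : 0 < t) :
    HasDerivAt stirlingPhase (Real.log (t / (2 * Real.pi)) / 2) t := by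
  have hpi := Real.pi_pos
  have h1 : HasDerivAt (fun t => t / (2 * Real.pi)) (1 / (2 * Real.pi)) t :=
    (hasDerivAt_id t).div_const _
  have h2 := h1.log (by positivity)
  have h3 := (((((hasDerivAt_id t).div_const 2).mul h2).sub ((hasDerivAt_id t).div_const 2)).sub_const
    (Real.pi / 8))
  refine HasDerivAt.congr_deriv h3 ?_
  simp only [id]
  field_simp
  ring

lemma continuous_stirlingPhase : Continuous stirlingPhase := by
  have h : stirlingPhase = fun t => Real.pi * ((t / (2 * Real.pi)) * Real.log (t / (2 * Real.pi))) -
      t / 2 - Real.pi / 8 := by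
    ext t
    rw [stirlingPhase]
    have := Real.pi_ne_zero
    field_simp
  rw [h]
  have h1 : Continuous fun t : ℝ => (t / (2 * Real.pi)) * Real.log (t / (2 * Real.pi)) :=
    Real.continuous_mul_log.comp (continuous_id.div_const _)
  fun_prop

/-- The leading term of the weighted Gamma factor. -/
noncomputable def critOsc (t : ℝ) : ℂ := critAmp * Complex.exp (stirlingPhase t * Complex.I)

lemma continuous_critOsc : Continuous critOsc := by
  have := continuous_stirlingPhase
  unfold critOsc
  fun_prop

lemma norm_critOsc (t : ℝ) : ‖critOsc t‖ = critAmp := by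
  rw [critOsc, norm_mul, Complex.norm_exp_ofReal_mul_I, Complex.norm_real,
    Real.norm_of_nonneg critAmp_pos.le, mul_one]

/-- The off-diagonal contribution of the square of the main term. -/
lemma norm_integral_critOsc_mul_dirSum_sq_le {T U κ : ℝ} {m : ℕ} (hT : 0 < T) (hU : 0 ≤ U) (hκ : 0 < κ)
    (hm : (m : ℝ) ≤ afeLength T * Real.exp (-(1 / κ))) (a : ℕ → ℂ) :
    ‖∫ t in T..(T + U), (critOsc t * dirSum (Finset.Icc 1 m) a t) ^ 2‖ ≤
      critAmp ^ 2 * (3 / 2 * κ) * (∑ n ∈ Finset.Icc 1 m, ‖a n‖) ^ 2 := by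
  have hpi := Real.pi_pos
  have hexp : ∀ t : ℝ, (critOsc t * dirSum (Finset.Icc 1 m) a t) ^ 2 =
      ∑ j ∈ Finset.Icc 1 m, ∑ k ∈ Finset.Icc 1 m, (critAmp ^ 2 * (a j * a k)) *
        Complex.exp ((2 * stirlingPhase t - t * (Real.log j + Real.log k) : ℝ) * Complex.I) := by
    intro t
    rw [mul_pow, sq (dirSum _ _ _), dirSum, Finset.sum_mul_sum, Finset.mul_sum]
    refine Finset.sum_congr rfl fun j _ => ?_
    rw [Finset.mul_sum]
    refine Finset.sum_congr rfl fun k _ => ?_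
    rw [critOsc, mul_pow, ← Complex.exp_nat_mul, mul_mul_mul_comm (a j), ← Complex.exp_add,
      mul_mul_mul_comm, ← Complex.exp_add]
    congr 2
    push_cast
    ring
  have hph := continuous_stirlingPhase
  simp_rw [hexp]
  rw [intervalIntegral.integral_finsetSum fun m _ => Continuous.intervalIntegrable (by fun_prop) _ _]
  have hterm : ∀ j ∈ Finset.Icc 1 m, ∀ k ∈ Finset.Icc 1 m, ‖∫ t in T..(T + U),
      Complex.exp ((2 * stirlingPhase t - t * (Real.log j + Real.log k) : ℝ) * Complex.I)‖ ≤
        3 / 2 * κ := by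
    intro j hj k hk
    have hN := afeLength_pos hT
    have bd : ∀ j ∈ Finset.Icc 1 m, (0 : ℝ) < j ∧ Real.log j ≤ Real.log (afeLength T) - 1 / κ := by
      intro j hj
      have h1 := Finset.mem_Icc.mp hj
      have h0 : (0 : ℝ) < j := by exact_mod_cast (by lia : 0 < j)
      refine ⟨h0, ?_⟩
      have h2 : (j : ℝ) ≤ m := by exact_mod_cast h1.2
      have h3 := Real.log_le_log h0 (h2.trans hm)
      rw [Real.log_mul hN.ne' (Real.exp_pos _).ne', Real.log_exp] at h3
      linarith
    obtain ⟨hj0, hjl⟩ := bd j hj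
    obtain ⟨hk0, hkl⟩ := bd k hk
    have hlogN : 2 * Real.log (afeLength T) = Real.log (T / (2 * Real.pi)) := by
      rw [← afeLength_sq hT, Real.log_pow]; norm_num
    have hdiv : ∀ t : ℝ, 0 < t → Real.log (t / (2 * Real.pi * (j * k))) =
        Real.log (t / (2 * Real.pi)) - (Real.log j + Real.log k) := by
      intro t ht
      rw [← div_div, Real.log_div (by positivity) (by positivity), Real.log_mul hj0.ne' hk0.ne']
    have := norm_integral_exp_phase_le (f := fun t => 2 * stirlingPhase t - t * (Real.log j + Real.log k))
      (A := T) (B := T + U) (c := 2 * Real.pi * (j * k)) (δ := 2 / κ) hT (by linarith) (by positivity)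
      (by positivity) (by
        rw [hdiv T hT, ← hlogN]
        have : 2 / κ = 1 / κ + 1 / κ := by ring
        linarith)
      (fun t ht => by
        have ht0 : 0 < t := hT.trans_le ht.1
        rw [hdiv t ht0]
        refine HasDerivAt.congr_deriv (((hasDerivAt_stirlingPhase ht0).const_mul 2).sub
          ((hasDerivAt_id t).mul_const (Real.log j + Real.log k))) ?_
        ring)
    refine this.trans_eq ?_
    field_simp
  have hamp := critAmp_pos
  calc _ ≤ ∑ j ∈ Finset.Icc 1 m, ∑ k ∈ Finset.Icc 1 m,
        (critAmp ^ 2 * (3 / 2 * κ)) * (‖a j‖ * ‖a k‖) := by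
        refine (norm_sum_le _ _).trans (Finset.sum_le_sum fun j hj => ?_)
        rw [intervalIntegral.integral_finsetSum fun m _ =>
          Continuous.intervalIntegrable (by fun_prop) _ _]
        refine (norm_sum_le _ _).trans (Finset.sum_le_sum fun k hk => ?_)
        rw [intervalIntegral.integral_const_mul, norm_mul, norm_mul, norm_mul, norm_pow,
          Complex.norm_real, Real.norm_of_nonneg hamp.le]
        calc _ ≤ critAmp ^ 2 * (‖a j‖ * ‖a k‖) * (3 / 2 * κ) := by gcongr; exact hterm j hj k hk
          _ = _ := by ring
    _ = _ := by
        simp_rw [← Finset.mul_sum]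
        rw [sq (∑ n ∈ Finset.Icc 1 m, ‖a n‖), Finset.sum_mul_sum]
        simp_rw [← Finset.mul_sum]

/-- Coefficients of the main term after integration over an interval of length `H`. -/
noncomputable def gapCoef (H N : ℝ) (n : ℕ) : ℂ :=
  ((n : ℝ) ^ (-(1 / 2) : ℝ) : ℝ) * gapInt H (Real.log (N / n))

lemma sum_rpow_neg_half_le (m : ℕ) : ∑ n ∈ Finset.Icc 1 m, (n : ℝ) ^ (-(1 / 2) : ℝ) ≤ 2 * √m := by
  induction m with
  | zero => simp
  | succ k ih =>
    rw [Finset.sum_Icc_succ_top (by lia)]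
    have h0 : (0 : ℝ) < (k : ℝ) + 1 := by positivity
    have e : ((k + 1 : ℕ) : ℝ) ^ (-(1 / 2) : ℝ) = 1 / √(k + 1) := by
      push_cast
      rw [Real.rpow_neg h0.le, ← Real.sqrt_eq_rpow, one_div]
    rw [e]
    push_cast
    have h1 : 0 < √((k : ℝ) + 1) := Real.sqrt_pos.mpr h0
    have h2 : √((k : ℝ) + 1) ^ 2 = k + 1 := Real.sq_sqrt h0.le
    have h3 : √(k : ℝ) ^ 2 = k := Real.sq_sqrt (by positivity)
    have h4 : 1 / √((k : ℝ) + 1) ≤ 2 * √((k : ℝ) + 1) - 2 * √(k : ℝ) := by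
      rw [div_le_iff₀ h1]
      nlinarith [sq_nonneg (√((k : ℝ) + 1) - √(k : ℝ))]
    linarith

lemma norm_gapCoef_le {H N : ℝ} (hH : 0 ≤ H) (n : ℕ) :
    ‖gapCoef H N n‖ ≤ H * (n : ℝ) ^ (-(1 / 2) : ℝ) := by
  rw [gapCoef, norm_mul, Complex.norm_real, Real.norm_of_nonneg (by positivity), mul_comm]
  gcongr
  exact norm_gapInt_le hH _

lemma norm_sq_gapCoef (H N : ℝ) {n : ℕ} (hn : 0 < n) :
    ‖gapCoef H N n‖ ^ 2 = ‖gapInt H (Real.log (N / n))‖ ^ 2 / n := by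
  have hn0 : (0 : ℝ) < n := by exact_mod_cast hn
  rw [gapCoef, norm_mul, Complex.norm_real, Real.norm_of_nonneg (by positivity), mul_pow,
    ← Real.rpow_natCast, ← Real.rpow_mul hn0.le]
  norm_num
  rw [Real.rpow_neg_one]
  ring

lemma sq_two_mul_re (z : ℂ) : (2 * z.re) ^ 2 = 2 * ‖z‖ ^ 2 + 2 * (z ^ 2).re := by
  rw [← Complex.normSq_eq_norm_sq, Complex.normSq_apply, sq z, Complex.mul_re]
  ring

/-- Mean square of the main term in terms of the diagonal sum. -/
lemma abs_integral_main_sq_sub_le {T U κ H : ℝ} {m : ℕ} (hT : 0 < T) (hU : 0 ≤ U) (hκ : 0 < κ)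
    (hH : 0 ≤ H) (hm : (m : ℝ) ≤ afeLength T * Real.exp (-(1 / κ))) :
    |(∫ t in T..(T + U), (2 * (critOsc t *
        dirSum (Finset.Icc 1 m) (gapCoef H (afeLength T)) t).re) ^ 2) -
      2 * critAmp ^ 2 * (U * ∑ n ∈ Finset.Icc 1 m, ‖gapInt H (Real.log (afeLength T / n))‖ ^ 2 / n)| ≤
      2 * critAmp ^ 2 * (4 * m * (1 + Real.log m) *
        ∑ n ∈ Finset.Icc 1 m, ‖gapInt H (Real.log (afeLength T / n))‖ ^ 2 / n) +
      12 * critAmp ^ 2 * κ * H ^ 2 * m := by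
  set N := afeLength T
  set D := dirSum (Finset.Icc 1 m) (gapCoef H N) with hD
  have hDc : Continuous D := continuous_dirSum _ _
  have hoc := continuous_critOsc
  have hS : ∑ n ∈ Finset.Icc 1 m, ‖gapInt H (Real.log (N / n))‖ ^ 2 / n =
      ∑ n ∈ Finset.Icc 1 m, ‖gapCoef H N n‖ ^ 2 :=
    Finset.sum_congr rfl fun n hn =>
      (norm_sq_gapCoef H N (by have := (Finset.mem_Icc.mp hn).1; lia)).symm
  rw [hS]
  set S := ∑ n ∈ Finset.Icc 1 m, ‖gapCoef H N n‖ ^ 2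
  have h1 := abs_integral_norm_sq_dirSum_sub_le (Finset.Subset.refl (Finset.Icc 1 m)) (gapCoef H N) T (T + U)
  have h2 := norm_integral_critOsc_mul_dirSum_sq_le hT hU hκ hm (gapCoef H N)
  have hsum : ∑ n ∈ Finset.Icc 1 m, ‖gapCoef H N n‖ ≤ H * (2 * √m) := by
    refine (Finset.sum_le_sum fun n _ => norm_gapCoef_le hH n).trans ?_
    rw [← Finset.mul_sum]
    exact mul_le_mul_of_nonneg_left (sum_rpow_neg_half_le m) hH
  have hamp := critAmp_pos
  have e : ∫ t in T..(T + U), (2 * (critOsc t * D t).re) ^ 2 =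
      2 * critAmp ^ 2 * (∫ t in T..(T + U), ‖D t‖ ^ 2) +
        2 * (∫ t in T..(T + U), (critOsc t * D t) ^ 2).re := by
    have e1 : ∀ t, (2 * (critOsc t * D t).re) ^ 2 =
        2 * critAmp ^ 2 * ‖D t‖ ^ 2 + 2 * ((critOsc t * D t) ^ 2).re := by
      intro t
      rw [sq_two_mul_re, norm_mul, norm_critOsc]
      ring
    have hii : IntervalIntegrable (fun t => (critOsc t * D t) ^ 2) MeasureTheory.volume T (T + U) :=
      Continuous.intervalIntegrable (by fun_prop) _ _
    have e2 : (∫ t in T..(T + U), (critOsc t * D t) ^ 2).re =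
        ∫ t in T..(T + U), ((critOsc t * D t) ^ 2).re :=
      (Complex.reCLM.intervalIntegral_comp_comm hii).symm
    simp_rw [e1]
    rw [e2, intervalIntegral.integral_add, intervalIntegral.integral_const_mul,
      intervalIntegral.integral_const_mul]
    · exact Continuous.intervalIntegrable (by fun_prop) _ _
    · exact Continuous.intervalIntegrable
        (continuous_const.mul (Complex.continuous_re.comp (by fun_prop))) _ _
  have h3 : |2 * (∫ t in T..(T + U), (critOsc t * D t) ^ 2).re| ≤ 12 * critAmp ^ 2 * κ * H ^ 2 * m := by
    rw [abs_mul, abs_two]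
    have hmm : √(m : ℝ) ^ 2 = m := Real.sq_sqrt (by positivity)
    calc _ ≤ 2 * (critAmp ^ 2 * (3 / 2 * κ) * (H * (2 * √m)) ^ 2) := by
          gcongr
          exact (Complex.abs_re_le_norm _).trans (h2.trans (by gcongr))
      _ = 12 * critAmp ^ 2 * κ * H ^ 2 * √m ^ 2 := by ring
      _ = _ := by rw [hmm]
  rw [e]
  have e3 : T + U - T = U := by ring
  rw [e3] at h1
  calc _ = |2 * critAmp ^ 2 * ((∫ t in T..(T + U), ‖D t‖ ^ 2) - U * S) +
        2 * (∫ t in T..(T + U), (critOsc t * D t) ^ 2).re| := by congr 1; ring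
    _ ≤ _ := by
        refine (abs_add_le _ _).trans (add_le_add ?_ h3)
        rw [abs_mul, abs_of_nonneg (by positivity)]
        gcongr

/-- Local linearisation of the phase. -/
lemma abs_stirlingPhase_sub_le {T W t h : ℝ} (hT : 0 < T) (ht : T ≤ t) (hh : 0 ≤ h)
    (htW : t + h ≤ T + W) :
    |stirlingPhase (t + h) - (stirlingPhase t + h * Real.log (afeLength T))| ≤ W / (2 * T) * h := by
  have hlogN : 2 * Real.log (afeLength T) = Real.log (T / (2 * Real.pi)) := by
    rw [← afeLength_sq hT, Real.log_pow]; norm_num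
  have hpi := Real.pi_pos
  have := (convex_Icc t (t + h)).norm_image_sub_le_of_norm_hasDerivWithin_le
    (f := fun u => stirlingPhase u - u * Real.log (afeLength T))
    (f' := fun u => Real.log (u / (2 * Real.pi)) / 2 - Real.log (afeLength T)) (C := W / (2 * T))
    (x := t) (y := t + h)
    (fun u hu => by
      have hu0 : 0 < u := by linarith [hu.1]
      refine HasDerivAt.hasDerivWithinAt (HasDerivAt.congr_deriv
        ((hasDerivAt_stirlingPhase hu0).sub ((hasDerivAt_id u).mul_const _)) ?_)
      ring)
    (fun u hu => by
      have hu0 : 0 < u := by linarith [hu.1]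
      have huT : T ≤ u := by linarith [hu.1]
      have e : Real.log (u / (2 * Real.pi)) / 2 - Real.log (afeLength T) = Real.log (u / T) / 2 := by
        have : Real.log (afeLength T) = Real.log (T / (2 * Real.pi)) / 2 := by linarith
        rw [this, Real.log_div hu0.ne' (by positivity), Real.log_div hT.ne' (by positivity),
          Real.log_div hu0.ne' hT.ne']
        ring
      rw [e, Real.norm_of_nonneg]
      · have h1 := Real.log_le_sub_one_of_pos (div_pos hu0 hT)
        have h2 : u / T - 1 ≤ W / T := by
          rw [← sub_nonneg]
          have : W / T - (u / T - 1) = (W + T - u) / T := by field_simp; ring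
          rw [this]
          exact div_nonneg (by linarith [hu.2]) hT.le
        have h3 : W / (2 * T) = W / T / 2 := by field_simp
        rw [h3]
        linarith
      · have := Real.log_nonneg (by rw [le_div_iff₀ hT]; linarith : 1 ≤ u / T)
        linarith)
    (Set.left_mem_Icc.mpr (by linarith)) (Set.right_mem_Icc.mpr (by linarith))
  rw [Real.norm_eq_abs, Real.norm_eq_abs, add_sub_cancel_left, abs_of_nonneg hh] at this
  refine le_of_eq_of_le ?_ this
  congr 1
  ring

/-- The short integral of the main term. -/
lemma abs_integral_main_sub_le {T W H t : ℝ} {m : ℕ} (hT : 0 < T) (hH : 0 ≤ H) (ht : T ≤ t)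
    (htW : t + H ≤ T + W) :
    |(∫ h in (0 : ℝ)..H, 2 * (critOsc (t + h) * dirSum (Finset.Icc 1 m)
        (fun n => ((n : ℝ) ^ (-(1 / 2) : ℝ) : ℝ)) (t + h)).re) -
      2 * (critOsc t * dirSum (Finset.Icc 1 m) (gapCoef H (afeLength T)) t).re| ≤
      2 * critAmp * (W / T) * H ^ 2 * √m := by
  set N := afeLength T
  have hN : 0 < N := afeLength_pos hT
  set a : ℕ → ℂ := fun n => ((n : ℝ) ^ (-(1 / 2) : ℝ) : ℝ) with ha
  set D := dirSum (Finset.Icc 1 m) a with hD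
  have hDc : Continuous D := continuous_dirSum _ _
  have hoc := continuous_critOsc
  have hamp := critAmp_pos
  have hW : 0 ≤ W := by linarith
  have hDn : ∀ u, ‖D u‖ ≤ 2 * √m := by
    intro u
    refine (norm_dirSum_le _ _ _).trans ?_
    refine le_of_eq_of_le (Finset.sum_congr rfl fun n _ => ?_) (sum_rpow_neg_half_le m)
    rw [ha, Complex.norm_real, Real.norm_of_nonneg (by positivity)]
  have hmain : critOsc t * dirSum (Finset.Icc 1 m) (gapCoef H N) t =
      ∫ h in (0 : ℝ)..H, critOsc t * (Complex.exp ((h * Real.log N : ℝ) * Complex.I) * D (t + h)) := by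
    rw [intervalIntegral.integral_const_mul]
    congr 1
    have e1 : ∀ h : ℝ, Complex.exp ((h * Real.log N : ℝ) * Complex.I) * D (t + h) =
        ∑ n ∈ Finset.Icc 1 m, (a n * Complex.exp (-(t * Real.log n : ℝ) * Complex.I)) *
          Complex.exp ((h * (Real.log N - Real.log n) : ℝ) * Complex.I) := by
      intro h
      rw [hD, dirSum, Finset.mul_sum]
      refine Finset.sum_congr rfl fun n _ => ?_
      rw [mul_left_comm, ← Complex.exp_add, mul_assoc, ← Complex.exp_add]
      congr 2
      push_cast
      ring
    simp_rw [e1]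
    rw [intervalIntegral.integral_finsetSum fun m _ => Continuous.intervalIntegrable (by fun_prop) _ _,
      dirSum]
    refine Finset.sum_congr rfl fun n hn => ?_
    have hn0 : (0 : ℝ) < n := by exact_mod_cast (by have := (Finset.mem_Icc.mp hn).1; lia : 0 < n)
    rw [intervalIntegral.integral_const_mul, gapCoef, gapInt, Real.log_div hN.ne' hn0.ne', ha]
    ring
  have hii1 : IntervalIntegrable (fun h => critOsc (t + h) * D (t + h)) MeasureTheory.volume 0 H :=
    Continuous.intervalIntegrable (by fun_prop) _ _
  have hii2 : IntervalIntegrable (fun h : ℝ => critOsc t *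
      (Complex.exp ((h * Real.log N : ℝ) * Complex.I) * D (t + h))) MeasureTheory.volume 0 H :=
    Continuous.intervalIntegrable (by fun_prop) _ _
  have e2 : ∫ h in (0 : ℝ)..H, 2 * (critOsc (t + h) * D (t + h)).re =
      2 * (∫ h in (0 : ℝ)..H, critOsc (t + h) * D (t + h)).re := by
    rw [intervalIntegral.integral_const_mul]
    congr 1
    exact Complex.reCLM.intervalIntegral_comp_comm hii1
  rw [e2, ← mul_sub, ← Complex.sub_re, hmain, ← intervalIntegral.integral_sub hii1 hii2, abs_mul, abs_two]
  have hb := intervalIntegral.norm_integral_le_of_norm_le_const (a := 0) (b := H)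
    (C := critAmp * (W / (2 * T) * H) * (2 * √m))
    (f := fun h : ℝ => critOsc (t + h) * D (t + h) - critOsc t *
      (Complex.exp ((h * Real.log N : ℝ) * Complex.I) * D (t + h)))
    (fun h hh => by
      rw [Set.uIoc_of_le hH] at hh
      have h1 := abs_stirlingPhase_sub_le (W := W) hT ht hh.1.le (by linarith [hh.2])
      have e3 : critOsc (t + h) * D (t + h) - critOsc t *
          (Complex.exp ((h * Real.log N : ℝ) * Complex.I) * D (t + h)) =
          critAmp * (Complex.exp (stirlingPhase (t + h) * Complex.I) -
            Complex.exp ((stirlingPhase t + h * Real.log N : ℝ) * Complex.I)) * D (t + h) := by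
        rw [critOsc, critOsc, Complex.ofReal_add (stirlingPhase t), add_mul, Complex.exp_add]
        ring
      rw [e3, norm_mul, norm_mul, Complex.norm_real, Real.norm_of_nonneg hamp.le]
      gcongr
      · refine (norm_exp_mul_I_sub_le _ _).trans (h1.trans ?_)
        gcongr
        exact hh.2
      · exact hDn _)
  rw [sub_zero, abs_of_nonneg hH] at hb
  calc _ ≤ 2 * (critAmp * (W / (2 * T) * H) * (2 * √m) * H) := by
        gcongr
        exact (Complex.abs_re_le_norm _).trans hb
    _ = _ := by field_simp

lemma continuous_XHL : Continuous XHL := by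
  unfold XHL XiF
  have hs : ∀ t : ℝ, ((1 / 2 + Complex.I * t : ℂ) / 2).re = 1 / 4 := fun t => by
    simp; norm_num
  have hG : Continuous fun t : ℝ => Complex.Gamma ((1 / 2 + Complex.I * t) / 2) := by
    refine continuous_iff_continuousAt.mpr fun t => ?_
    have hd : ContinuousAt Complex.Gamma ((1 / 2 + Complex.I * t) / 2) := by
      refine (Complex.differentiableAt_Gamma _ fun k hk => ?_).continuousAt
      have := congrArg Complex.re hk
      rw [hs] at this
      simp at this
      have hk0 : (0 : ℝ) ≤ k := Nat.cast_nonneg k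
      linarith
    exact ContinuousAt.comp (f := fun t : ℝ => (1 / 2 + Complex.I * t : ℂ) / 2) hd (by fun_prop)
  have hZ : Continuous fun t : ℝ => riemannZeta (1 / 2 + Complex.I * t) := by
    refine continuous_iff_continuousAt.mpr fun t => ?_
    have hd : ContinuousAt riemannZeta (1 / 2 + Complex.I * t) := by
      refine (differentiableAt_riemannZeta fun h => ?_).continuousAt
      have := congrArg Complex.re h
      simp at this
    exact ContinuousAt.comp (f := fun t : ℝ => (1 / 2 + Complex.I * t : ℂ)) hd (by fun_prop)
  have hp : Continuous fun t : ℝ => (Real.pi : ℂ) ^ (-(1 / 2 + Complex.I * t) / 2) := by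
    refine Continuous.const_cpow (by fun_prop) (Or.inl ?_)
    exact_mod_cast Real.pi_ne_zero
  have hr : Continuous fun t : ℝ => t ^ ((1 : ℝ) / 4) :=
    Real.continuous_rpow_const (by norm_num)
  have hq : ∀ t : ℝ, (1 / 4 + t ^ 2 : ℝ) ≠ 0 := fun t => by positivity
  have hA : Continuous fun t : ℝ => t ^ ((1 : ℝ) / 4) * Real.exp (Real.pi * t / 4) / (1 / 4 + t ^ 2) :=
    (hr.mul (by fun_prop)).div (by fun_prop) hq
  have hB : Continuous fun t : ℝ => ((1 / 2 + Complex.I * t) * ((1 / 2 + Complex.I * t) - 1) / 2 : ℂ) := by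
    fun_prop
  exact hA.neg.mul (Complex.continuous_re.comp (((hB.mul hp).mul hG).mul hZ))

lemma continuous_afeRem (T κ L : ℝ) (m P : ℕ) : Continuous (afeRem T κ L m P) := by
  unfold afeRem
  refine continuous_const.mul ?_
  refine intervalIntegral.continuous_parametric_intervalIntegral_of_continuous' ?_ _ _
  have h1 := continuous_dirSum (Finset.Ioc m P) (afeCoef (afeLength T) κ)
  have h2 := continuous_dirSum (Finset.Icc 1 m) (afeCoef (afeLength T) (-κ))
  unfold Function.uncurry
  fun_prop

/-- Admissible ranges of the parameters in the mean square estimate, for `T = y ^ 20`. -/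
structure MeanSqData (y x U H : ℝ) : Prop where
  hx : 64 ≤ x
  hxy : x ^ 20 ≤ y
  hlog : Real.log (y ^ 20) ≤ x
  hU1 : x ^ 20 * y ^ 10 ≤ U
  hU2 : U ≤ 3 * y ^ 12
  hH : 0 < H
  hHx : H ≤ x

lemma MeanSqData.afeLength_le {y x U H : ℝ} (h : MeanSqData y x U H) :
    afeLength (y ^ 20) ≤ y ^ 10 / 2 ∧ y ^ 10 / 3 ≤ afeLength (y ^ 20) := by
  have hx := h.hx
  have hy : 0 < y := lt_of_lt_of_le (by positivity) h.hxy
  have h2 := afeLength_sq (T := y ^ 20) (by positivity)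
  have h0 := afeLength_pos (T := y ^ 20) (by positivity)
  have hp3 := Real.pi_gt_three
  have hp4 := Real.pi_lt_four
  constructor
  · refine (pow_le_pow_iff_left₀ h0.le (by positivity) two_ne_zero).mp ?_
    rw [h2, div_le_iff₀ (by positivity)]
    have : 0 < y ^ 20 := by positivity
    nlinarith
  · refine (pow_le_pow_iff_left₀ (by positivity) h0.le two_ne_zero).mp ?_
    rw [h2, le_div_iff₀ (by positivity)]
    have : 0 < y ^ 20 := by positivity
    nlinarith

set_option maxHeartbeats 1000000 in
lemma MeanSqData.exists_params {y x U H : ℝ} (h : MeanSqData y x U H) :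
    ∃ m P : ℕ, AFEData (y ^ 20) (x ^ 8) (y ^ 12) (U + H) m P ∧
      (m : ℝ) + 1 ≤ afeLength (y ^ 20) ∧
      afeLength (y ^ 20) * Real.exp (-(1 / x ^ 8)) ≤ m + 1 ∧
      (m : ℝ) ≤ afeLength (y ^ 20) * Real.exp (-(1 / x ^ 8)) ∧
      x ^ 8 ≤ m + 1 ∧ m ≤ P ∧ 0 < P ∧ (P : ℝ) ≤ 2 * y ^ 10 := by
  obtain ⟨hN1, hN2⟩ := h.afeLength_le
  obtain ⟨hx, hxy, hlog, hU1, hU2, hH, hHx⟩ := h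
  have hx0 : 0 < x := by linarith
  have hx1 : 1 ≤ x := by linarith
  have hpow : ∀ k : ℕ, k ≤ 20 → x ^ k ≤ y := fun k hk => (pow_le_pow_right₀ hx1 hk).trans hxy
  have hxly : x ≤ y := by simpa using hpow 1 (by norm_num)
  have hy : 64 ≤ y := by linarith
  have hy0 : 0 < y := by linarith
  have hy1 : 1 ≤ y := by linarith
  have hyp : ∀ j k : ℕ, j ≤ k → y ^ j ≤ y ^ k := fun j k hjk => pow_le_pow_right₀ hy1 hjk
  set N := afeLength (y ^ 20) with hN
  have hy10 : y ≤ y ^ 10 := by simpa using hyp 1 10 (by norm_num)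
  have hN0 : 0 < N := by linarith
  have hx8 : 1 ≤ x ^ 8 := one_le_pow₀ hx1
  have hx8' : 64 ≤ x ^ 8 := hx.trans (by simpa using pow_le_pow_right₀ hx1 (show 1 ≤ 8 by norm_num))
  have hxy8 : 64 * x ^ 8 ≤ y := by
    have : x ^ 9 ≤ y := hpow 9 (by norm_num)
    nlinarith
  have hyy : 64 * y ≤ y ^ 10 := by
    have : y ^ 2 ≤ y ^ 10 := hyp 2 10 (by norm_num)
    nlinarith
  have hxN : 2 * x ^ 8 ≤ N * (1 / 2) := by linarith
  set e := Real.exp (-(1 / x ^ 8)) with he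
  have he0 : 0 < e := Real.exp_pos _
  have he1 : e ≤ 1 := Real.exp_le_one_iff.mpr (by simp; positivity)
  have he2 : 1 / 2 ≤ e := by
    have h1 := Real.add_one_le_exp (-(1 / x ^ 8))
    have h2 : 1 / x ^ 8 ≤ 1 / 2 := by
      apply one_div_le_one_div_of_le <;> linarith
    rw [he]; linarith
  have he3 : 1 ≤ N * (1 - e) := by
    have h1 := Real.add_one_le_exp (1 / x ^ 8)
    have h2 : e * Real.exp (1 / x ^ 8) = 1 := by
      rw [he, ← Real.exp_add]; simp
    have h3 : e * (1 / x ^ 8 + 1) ≤ 1 :=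
      (mul_le_mul_of_nonneg_left h1 he0.le).trans h2.le
    have h4 : e * (1 / x ^ 8) ≤ 1 - e := by linarith
    have h5 : 1 / 2 * (1 / x ^ 8) ≤ 1 - e := le_trans (by gcongr) h4
    calc (1 : ℝ) = 2 * x ^ 8 * (1 / 2 * (1 / x ^ 8)) := by field_simp
      _ ≤ N * (1 - e) := by gcongr; linarith
  have hm2 : N * e < (⌊N * e⌋₊ : ℝ) + 1 := Nat.lt_floor_add_one _
  have hm1 : (⌊N * e⌋₊ : ℝ) ≤ N * e := Nat.floor_le (by positivity)
  have hP1 : 2 * N ≤ (⌈2 * N⌉₊ : ℝ) := Nat.le_ceil _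
  have hP2 : (⌈2 * N⌉₊ : ℝ) < 2 * N + 1 := Nat.ceil_lt_add_one (by positivity)
  have hmN : (⌊N * e⌋₊ : ℝ) ≤ N := hm1.trans (by nlinarith)
  have hT : y ≤ y ^ 20 := by simpa using hyp 1 20 (by norm_num)
  have hNT : N ≤ y ^ 20 := by
    have : y ^ 10 ≤ y ^ 20 := hyp 10 20 (by norm_num)
    linarith
  have hUH : U + H ≤ 4 * y ^ 12 := by
    have : y ≤ y ^ 12 := by simpa using hyp 1 12 (by norm_num)
    linarith
  have hy12 : 64 * y ^ 12 ≤ y ^ 13 := by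
    have : 0 < y ^ 12 := by positivity
    nlinarith [pow_succ y 12]
  have hy1320 : y ^ 13 ≤ y ^ 20 := hyp 13 20 (by norm_num)
  have hU0 : 0 ≤ U := le_trans (by positivity) hU1
  refine ⟨⌊N * e⌋₊, ⌈2 * N⌉₊, ⟨?_, ?_, ?_, ?_, ?_, ?_, ?_, ?_, ?_, ?_, ?_, ?_⟩, ?_, ?_, ?_, ?_, ?_, ?_, ?_⟩
  · linarith
  · linarith
  · have h1 : 64 * x ^ 8 ≤ y := hxy8
    have h2 : (64 * x ^ 8) ^ 3 ≤ y ^ 3 := by gcongr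
    have h3 : y ^ 3 ≤ (y ^ 20) ^ 2 := by rw [← pow_mul]; exact hyp _ _ (by norm_num)
    nlinarith [pow_pos hx0 24]
  · have : y ≤ y ^ 12 := by simpa using hyp 1 12 (by norm_num)
    exact (hpow 8 (by norm_num)).trans this
  · positivity
  · linarith
  · have h1 : x ^ 8 * (U + H + y ^ 12) ≤ y / 64 * (5 * y ^ 12) := by
      gcongr
      · linarith
      · linarith
    nlinarith [pow_pos hy0 13]
  · have h1 : (64 * x ^ 8) ^ 2 ≤ y ^ 2 := by gcongr
    have h2 : 8 * y ^ 20 * (x ^ 8) ^ 2 ≤ y ^ 20 * y ^ 2 := by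
      have := mul_le_mul_of_nonneg_left h1 (show 0 ≤ y ^ 20 by positivity)
      have h3 : 0 ≤ y ^ 20 * (x ^ 8) ^ 2 := by positivity
      nlinarith
    calc _ ≤ _ := h2
      _ = y ^ 22 := by ring
      _ ≤ y ^ 24 := hyp _ _ (by norm_num)
      _ = _ := by ring
  · rw [Real.rpow_def_of_pos hN0, Real.exp_le_exp]
    have h1 : Real.log N ≤ x := (Real.log_le_log hN0 hNT).trans hlog
    calc Real.log N * x ^ 8 ≤ x * x ^ 8 := by gcongr
      _ = x ^ 9 := by ring
      _ ≤ y := hpow 9 (by norm_num)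
      _ ≤ _ := hT
  · exact hmN
  · exact hP1
  · have h1 : (y ^ 20) ^ 3 = Real.exp (3 * Real.log (y ^ 20)) := by
      rw [show (3 : ℝ) = ((3 : ℕ) : ℝ) by norm_num, Real.exp_nat_mul, Real.exp_log (by positivity)]
    rw [h1, Real.rpow_def_of_pos two_pos, Real.exp_le_exp]
    have h2 := Real.log_two_gt_d9
    have h3 : 64 * x ≤ x ^ 8 := by
      have : x ^ 2 ≤ x ^ 8 := pow_le_pow_right₀ hx1 (by norm_num)
      nlinarith
    calc 3 * Real.log (y ^ 20) ≤ 1 / 2 * (64 * x) := by linarith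
      _ ≤ Real.log 2 * x ^ 8 := by
        gcongr
        linarith
  · linarith
  · exact hm2.le
  · exact hm1
  · have : N * (1 / 2) ≤ N * e := by gcongr
    linarith
  · exact_mod_cast (show (⌊N * e⌋₊ : ℝ) ≤ (⌈2 * N⌉₊ : ℝ) by linarith)
  · exact_mod_cast (show (0 : ℝ) < (⌈2 * N⌉₊ : ℝ) by linarith)
  · linarith

/-- The leading term of the approximate functional equation. -/
noncomputable def afeMain (m : ℕ) (t : ℝ) : ℝ :=
  2 * (critOsc t * dirSum (Finset.Icc 1 m) (fun n => ((n : ℝ) ^ (-(1 / 2) : ℝ) : ℝ)) t).re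

lemma norm_dirSum_rpow_neg_half_le (m : ℕ) (t : ℝ) :
    ‖dirSum (Finset.Icc 1 m) (fun n => ((n : ℝ) ^ (-(1 / 2) : ℝ) : ℝ)) t‖ ≤ 2 * √m := by
  refine (norm_dirSum_le _ _ _).trans (le_trans (le_of_eq ?_) (sum_rpow_neg_half_le m))
  refine Finset.sum_congr rfl fun n _ => ?_
  rw [Complex.norm_real, Real.norm_of_nonneg (by positivity)]

lemma exists_abs_XHL_sub_afeMain_le :
    ∃ C > 0, ∀ T κ L W : ℝ, ∀ m P : ℕ, AFEData T κ L W m P → ∀ t : ℝ, 28 ≤ T → T ≤ t → t ≤ T + W →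
      |XHL t - afeMain m t| ≤ C * (afeRem T κ L m P t + (1 + √m) / T) := by
  obtain ⟨C, hC, hA⟩ := exists_abs_XHL_sub_le
  have hcA := critAmp_pos
  refine ⟨C + 224 * critAmp, by positivity, fun T κ L W m P hd t hT h1 h2 => ?_⟩
  have hA' := hA T κ L W m P hd t h1 h2
  have hT0 : 0 < T := by linarith
  set D := dirSum (Finset.Icc 1 m) (fun n => ((n : ℝ) ^ (-(1 / 2) : ℝ) : ℝ)) t with hD
  have hDn : ‖D‖ ≤ 2 * √m := norm_dirSum_rpow_neg_half_le m t
  set G := (critWeight t : ℂ) * Complex.Gammaℝ (1 / 2 + t * Complex.I) with hG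
  have hg : ‖G - critOsc t‖ ≤ critAmp * (56 / T) := by
    refine (norm_critWeight_mul_Gammaℝ_sub_le (by linarith)).trans ?_
    gcongr
  have hdiff : |2 * (G * D).re - afeMain m t| ≤ 224 * critAmp * (√m / T) := by
    have : 2 * (G * D).re - afeMain m t = 2 * ((G - critOsc t) * D).re := by
      rw [afeMain, sub_mul, Complex.sub_re]; ring
    rw [this, abs_mul, abs_two]
    have h3 : |((G - critOsc t) * D).re| ≤ critAmp * (56 / T) * (2 * √m) := by
      refine (Complex.abs_re_le_norm _).trans ?_
      rw [norm_mul]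
      gcongr
    calc _ ≤ 2 * (critAmp * (56 / T) * (2 * √m)) := by gcongr
      _ = _ := by ring
  have hrem : 0 ≤ afeRem T κ L m P t := by
    have hκ := hd.hκ
    have hL : 0 ≤ L := by have := hd.hκL; linarith
    unfold afeRem
    refine mul_nonneg (by positivity) (intervalIntegral.integral_nonneg (by linarith) fun v _ => ?_)
    positivity
  have htri : |XHL t - afeMain m t| ≤ |XHL t - 2 * (G * D).re| + |2 * (G * D).re - afeMain m t| :=
    abs_sub_le _ _ _
  have hs : 0 ≤ √(m : ℝ) := Real.sqrt_nonneg _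
  have hsT : 0 ≤ √(m : ℝ) / T := by positivity
  have h1T : 0 ≤ 1 / T := by positivity
  calc _ ≤ C * (afeRem T κ L m P t + 1 / T) + 224 * critAmp * (√m / T) := by linarith
    _ ≤ (C + 224 * critAmp) * (afeRem T κ L m P t + (1 + √m) / T) := by
      rw [add_div]
      nlinarith [mul_nonneg hcA.le hrem, mul_nonneg hcA.le h1T, mul_nonneg hC.le hsT]

lemma continuous_afeMain (m : ℕ) : Continuous (afeMain m) := by
  unfold afeMain
  exact continuous_const.mul (Complex.continuous_re.comp
    (continuous_critOsc.mul (continuous_dirSum _ _)))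

lemma MeanSqData.one_add_log_le {y x U H : ℝ} (h : MeanSqData y x U H) {P : ℕ} (hP : 0 < P)
    (hPy : (P : ℝ) ≤ 2 * y ^ 10) : 1 + Real.log P ≤ 2 * x := by
  obtain ⟨hx, hxy, hlog, -, -, -, -⟩ := h
  have hx1 : 1 ≤ x := by linarith
  have hxly : x ≤ y := (le_self_pow₀ hx1 (by norm_num)).trans hxy
  have hP0 : (0 : ℝ) < P := by exact_mod_cast hP
  have h1 : (P : ℝ) ≤ y ^ 20 := by
    refine hPy.trans ?_
    have hy : 1 ≤ y := by linarith
    have : 2 ≤ y ^ 10 := (show 2 ≤ y by linarith).trans (le_self_pow₀ hy (by norm_num))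
    nlinarith
  have := (Real.log_le_log hP0 h1).trans hlog
  linarith

lemma exists_integral_sq_XHL_sub_afeMain_le :
    ∃ C > 0, ∀ y x U H : ℝ, ∀ m P : ℕ, MeanSqData y x U H →
      AFEData (y ^ 20) (x ^ 8) (y ^ 12) (U + H) m P →
      (m : ℝ) + 1 ≤ afeLength (y ^ 20) →
      afeLength (y ^ 20) * Real.exp (-(1 / x ^ 8)) ≤ m + 1 →
      x ^ 8 ≤ m + 1 → m ≤ P → 0 < P → (P : ℝ) ≤ 2 * y ^ 10 →
      ∫ t in (y ^ 20)..(y ^ 20 + (U + H)), (XHL t - afeMain m t) ^ 2 ≤ C * U / x ^ 8 := by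
  obtain ⟨C, hC, hA⟩ := exists_abs_XHL_sub_afeMain_le
  refine ⟨700 * C ^ 2, by positivity, fun y x U H m P h hd hm1 hm2 hmκ hmP hP hPy => ?_⟩
  have hNle := h.afeLength_le.1
  have hlogP := h.one_add_log_le hP hPy
  obtain ⟨hx, hxy, hlog, hU1, hU2, hH, hHx⟩ := h
  have hx0 : 0 < x := by linarith
  have hx1 : 1 ≤ x := by linarith
  have hxly : x ≤ y := (le_self_pow₀ hx1 (by norm_num)).trans hxy
  have hy : 64 ≤ y := by linarith
  have hy1 : 1 ≤ y := by linarith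
  have hy0 : 0 < y := by linarith
  have hT28 : 28 ≤ y ^ 20 :=
    (show 28 ≤ y by linarith).trans (le_self_pow₀ hy1 (by norm_num))
  have hx20 : x ≤ x ^ 20 := by simpa using pow_le_pow_right₀ hx1 (show 1 ≤ 20 by norm_num)
  have hxU : x * y ^ 10 * 64 ≤ U := by
    refine le_trans ?_ hU1
    have : x ^ 2 ≤ x ^ 20 := pow_le_pow_right₀ hx1 (by norm_num)
    have h3 : x * 64 ≤ x ^ 20 := by nlinarith
    have h4 : 0 < y ^ 10 := by positivity
    nlinarith
  have hy10 : 1 ≤ y ^ 10 := one_le_pow₀ hy1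
  have hHU : H ≤ U := by nlinarith
  have hU0 : 0 < U := by linarith
  have hs : √(m : ℝ) ≤ y ^ 5 := by
    rw [Real.sqrt_le_left (by positivity)]
    nlinarith [hm1, hNle, show (y ^ 5) ^ 2 = y ^ 10 by ring]
  have hR : (1 + √(m : ℝ)) / y ^ 20 ≤ 1 / x ^ 8 := by
    have hy5 : 1 ≤ y ^ 5 := one_le_pow₀ hy1
    have hy4 : 2 ≤ y ^ 4 := (show 2 ≤ y by linarith).trans (le_self_pow₀ hy1 (by norm_num))
    have hx8 : x ^ 8 ≤ y := (pow_le_pow_right₀ hx1 (by norm_num)).trans hxy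
    rw [div_le_div_iff₀ (by positivity) (by positivity), one_mul]
    calc (1 + √(m : ℝ)) * x ^ 8 ≤ (2 * y ^ 5) * y := by
          gcongr; linarith
      _ ≤ (y ^ 4 * y ^ 5) * y := by gcongr
      _ = y ^ 10 := by ring
      _ ≤ y ^ 20 := pow_le_pow_right₀ hy1 (by norm_num)
  have hAB : y ^ 20 ≤ y ^ 20 + (U + H) := by linarith
  have hint := integral_afeRem_sq_le (T := y ^ 20) (κ := x ^ 8) (L := y ^ 12) (A := y ^ 20)
    (B := y ^ 20 + (U + H)) (m := m) (P := P) (by positivity) (one_le_pow₀ hx1) (by positivity)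
    hm1 hm2 hmκ hmP hP hAB
  have hcR := continuous_afeRem (y ^ 20) (x ^ 8) (y ^ 12) m P
  have hcX := continuous_XHL
  have hcM := continuous_afeMain m
  set r := 1 / x ^ 8 with hr
  have hr0 : 0 < r := by positivity
  have hr1 : r ≤ 1 := by
    rw [hr, div_le_one (by positivity)]; exact one_le_pow₀ hx1
  have hmono : ∫ t in (y ^ 20)..(y ^ 20 + (U + H)), (XHL t - afeMain m t) ^ 2 ≤
      ∫ t in (y ^ 20)..(y ^ 20 + (U + H)),
        (2 * C ^ 2 * afeRem (y ^ 20) (x ^ 8) (y ^ 12) m P t ^ 2 + 2 * C ^ 2 * r ^ 2) := by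
    refine intervalIntegral.integral_mono_on hAB (Continuous.intervalIntegrable (by fun_prop) _ _)
      (Continuous.intervalIntegrable (by fun_prop) _ _) fun t ht => ?_
    have h1 := hA _ _ _ _ m P hd t hT28 ht.1 ht.2
    set ρ := afeRem (y ^ 20) (x ^ 8) (y ^ 12) m P t
    have h2 : |XHL t - afeMain m t| ≤ C * (ρ + r) := h1.trans (by gcongr)
    have h3 : (XHL t - afeMain m t) ^ 2 ≤ (C * (ρ + r)) ^ 2 := by
      rw [← sq_abs]; gcongr
    refine h3.trans ?_
    nlinarith [mul_nonneg (sq_nonneg C) (sq_nonneg (ρ - r))]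
  refine hmono.trans ?_
  rw [intervalIntegral.integral_add (Continuous.intervalIntegrable (by fun_prop) _ _)
    (Continuous.intervalIntegrable (by fun_prop) _ _), intervalIntegral.integral_const_mul,
    intervalIntegral.integral_const, smul_eq_mul]
  have hb : (y ^ 20 + (U + H) - y ^ 20) + 4 * P * (1 + Real.log P) ≤ 3 * U := by
    have : 4 * P * (1 + Real.log P) ≤ 4 * (2 * y ^ 10) * (2 * x) := by
      have : 0 ≤ 1 + Real.log P := by
        have : 0 ≤ Real.log P := Real.log_natCast_nonneg P
        linarith
      gcongr
    linarith
  have hint' : ∫ t in (y ^ 20)..(y ^ 20 + (U + H)), afeRem (y ^ 20) (x ^ 8) (y ^ 12) m P t ^ 2 ≤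
      112 * (3 * U) * r := by
    refine hint.trans ?_
    rw [hr, mul_one_div]
    gcongr
  have e : 700 * C ^ 2 * U / x ^ 8 = 2 * C ^ 2 * (112 * (3 * U) * r) + 28 * C ^ 2 * U * r := by
    rw [hr]; ring
  rw [e]
  have h5 : (y ^ 20 + (U + H) - y ^ 20) * (2 * C ^ 2 * r ^ 2) ≤ 28 * C ^ 2 * U * r := by
    have h6 : (y ^ 20 + (U + H) - y ^ 20) ≤ 2 * U := by linarith
    calc _ ≤ 2 * U * (2 * C ^ 2 * (r * 1)) := by
          rw [sq r]; gcongr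
      _ ≤ 28 * C ^ 2 * U * r := by nlinarith [mul_pos (mul_pos (pow_pos hC 2) hU0) hr0]
  have h7 := mul_le_mul_of_nonneg_left hint' (show 0 ≤ 2 * C ^ 2 by positivity)
  linarith

lemma abs_integral_sq_sub_integral_sq_le {f g : ℝ → ℝ} (hf : Continuous f) (hg : Continuous g)
    {A B ε : ℝ} (hAB : A ≤ B) (hε : 0 < ε) :
    |(∫ t in A..B, f t ^ 2) - ∫ t in A..B, g t ^ 2| ≤
      ε * (∫ t in A..B, g t ^ 2) + (1 + 1 / ε) * ∫ t in A..B, (f t - g t) ^ 2 := by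
  rw [← intervalIntegral.integral_sub (Continuous.intervalIntegrable (by fun_prop) _ _)
    (Continuous.intervalIntegrable (by fun_prop) _ _),
    ← intervalIntegral.integral_const_mul, ← intervalIntegral.integral_const_mul,
    ← intervalIntegral.integral_add (Continuous.intervalIntegrable (by fun_prop) _ _)
    (Continuous.intervalIntegrable (by fun_prop) _ _)]
  refine (intervalIntegral.abs_integral_le_integral_abs hAB).trans ?_
  refine intervalIntegral.integral_mono_on hAB (Continuous.intervalIntegrable (by fun_prop) _ _)
    (Continuous.intervalIntegrable (by fun_prop) _ _) fun t _ => ?_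
  have key : ∀ a b : ℝ, |a ^ 2 - b ^ 2| ≤ ε * b ^ 2 + (1 + 1 / ε) * (a - b) ^ 2 := fun a b => by
    have h1 : 0 ≤ ε * (b - (a - b) / ε) ^ 2 := by positivity
    have h2 : 0 ≤ ε * (b + (a - b) / ε) ^ 2 := by positivity
    have e1 : ε * (b - (a - b) / ε) ^ 2 = ε * b ^ 2 - 2 * b * (a - b) + 1 / ε * (a - b) ^ 2 := by
      field_simp; ring
    have e2 : ε * (b + (a - b) / ε) ^ 2 = ε * b ^ 2 + 2 * b * (a - b) + 1 / ε * (a - b) ^ 2 := by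
      field_simp; ring
    rw [abs_le]
    constructor <;> nlinarith [sq_nonneg (a - b)]
  exact key _ _

/-- The main term after integration over an interval of length `H`. -/
noncomputable def gapMain (T H : ℝ) (m : ℕ) (t : ℝ) : ℝ :=
  2 * (critOsc t * dirSum (Finset.Icc 1 m) (gapCoef H (afeLength T)) t).re

lemma continuous_gapMain (T H : ℝ) (m : ℕ) : Continuous (gapMain T H m) := by
  unfold gapMain
  exact continuous_const.mul (Complex.continuous_re.comp
    (continuous_critOsc.mul (continuous_dirSum _ _)))

lemma continuous_integral_add_right {f : ℝ → ℝ} (hf : Continuous f) (H : ℝ) :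
    Continuous fun t => ∫ h in (0 : ℝ)..H, f (t + h) := by
  refine intervalIntegral.continuous_parametric_intervalIntegral_of_continuous' ?_ _ _
  unfold Function.uncurry
  fun_prop

lemma exists_integral_sq_sub_gapMain_le :
    ∃ C > 0, ∀ y x U H : ℝ, ∀ m P : ℕ, MeanSqData y x U H →
      AFEData (y ^ 20) (x ^ 8) (y ^ 12) (U + H) m P →
      (m : ℝ) + 1 ≤ afeLength (y ^ 20) →
      afeLength (y ^ 20) * Real.exp (-(1 / x ^ 8)) ≤ m + 1 →
      x ^ 8 ≤ m + 1 → m ≤ P → 0 < P → (P : ℝ) ≤ 2 * y ^ 10 →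
      ∫ t in (y ^ 20)..(y ^ 20 + U), ((∫ h in (0 : ℝ)..H, XHL (t + h)) - gapMain (y ^ 20) H m t) ^ 2 ≤
        C * U / x ^ 6 := by
  obtain ⟨C, hC, hA⟩ := exists_integral_sq_XHL_sub_afeMain_le
  have hcA := critAmp_pos
  refine ⟨2 * C + 2 * (12 * critAmp) ^ 2, by positivity,
    fun y x U H m P h hd hm1 hm2 hmκ hmP hP hPy => ?_⟩
  have hR := hA y x U H m P h hd hm1 hm2 hmκ hmP hP hPy
  have hNle := h.afeLength_le.1
  obtain ⟨hx, hxy, hlog, hU1, hU2, hH, hHx⟩ := h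
  have hx0 : 0 < x := by linarith
  have hx1 : 1 ≤ x := by linarith
  have hxly : x ≤ y := (le_self_pow₀ hx1 (by norm_num)).trans hxy
  have hy1 : 1 ≤ y := by linarith
  have hy0 : 0 < y := by linarith
  have hU0 : 0 < U := lt_of_lt_of_le (by positivity) hU1
  have hHU : H ≤ U := by
    refine hHx.trans (le_trans ?_ hU1)
    have h1 : x ≤ x ^ 20 := le_self_pow₀ hx1 (by norm_num)
    have h2 : 1 ≤ y ^ 10 := one_le_pow₀ hy1
    nlinarith
  have hs : √(m : ℝ) ≤ y ^ 5 := by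
    rw [Real.sqrt_le_left (by positivity)]
    nlinarith [hm1, hNle, show (y ^ 5) ^ 2 = y ^ 10 by ring]
  set T := y ^ 20 with hT
  have hT0 : 0 < T := by positivity
  set f := fun t => XHL t - afeMain m t with hf
  have hfc : Continuous f := continuous_XHL.sub (continuous_afeMain m)
  have hE : ∀ t ∈ Set.Icc T (T + U),
      |(∫ h in (0 : ℝ)..H, XHL (t + h)) - gapMain T H m t - ∫ h in (0 : ℝ)..H, f (t + h)| ≤
        12 * critAmp * (1 / x ^ 3) := by
    intro t ht
    have hXc := continuous_XHL
    have hMc := continuous_afeMain m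
    have h1 := abs_integral_main_sub_le (T := T) (W := U + H) (H := H) (t := t) (m := m) hT0 hH.le
      ht.1 (by linarith [ht.2])
    have h2 : ∫ h in (0 : ℝ)..H, f (t + h) =
        (∫ h in (0 : ℝ)..H, XHL (t + h)) - ∫ h in (0 : ℝ)..H, afeMain m (t + h) :=
      intervalIntegral.integral_sub (Continuous.intervalIntegrable (by fun_prop) _ _)
        (Continuous.intervalIntegrable (by fun_prop) _ _)
    rw [h2, show (∫ h in (0 : ℝ)..H, XHL (t + h)) - gapMain T H m t -
      ((∫ h in (0 : ℝ)..H, XHL (t + h)) - ∫ h in (0 : ℝ)..H, afeMain m (t + h)) =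
      (∫ h in (0 : ℝ)..H, afeMain m (t + h)) - gapMain T H m t by ring]
    refine h1.trans ?_
    have h3 : (U + H) / T ≤ 6 / y ^ 8 := by
      rw [div_le_div_iff₀ hT0 (by positivity)]
      calc (U + H) * y ^ 8 ≤ (6 * y ^ 12) * y ^ 8 := by gcongr; linarith
        _ = 6 * T := by rw [hT]; ring
    calc 2 * critAmp * ((U + H) / T) * H ^ 2 * √m
        ≤ 2 * critAmp * (6 / y ^ 8) * x ^ 2 * y ^ 5 := by gcongr
      _ = 12 * critAmp * (x ^ 2 / y ^ 3) := by field_simp; norm_num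
      _ ≤ 12 * critAmp * (1 / x ^ 3) := by
        have h4 : x ^ 5 ≤ y ^ 3 :=
          ((pow_le_pow_right₀ hx1 (by norm_num)).trans hxy).trans (le_self_pow₀ hy1 (by norm_num))
        have h5 : x ^ 2 / y ^ 3 ≤ 1 / x ^ 3 := by
          rw [div_le_div_iff₀ (by positivity) (by positivity)]
          calc x ^ 2 * x ^ 3 = x ^ 5 := by ring
            _ ≤ 1 * y ^ 3 := by linarith
        gcongr
  have hAB : T ≤ T + U := by linarith
  have hsq := integral_sq_integral_mul_le (p := fun _ => 1) (f := f) continuous_const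
    (fun _ => zero_le_one) hfc (α := 0) (β := H) (A := T) (B := T + U) (K := C * U / x ^ 8) hH.le hAB
    (fun v hv => by
      rw [intervalIntegral.integral_comp_add_right (fun t => f t ^ 2)]
      refine le_trans ?_ hR
      have hc : Continuous fun t => f t ^ 2 := by fun_prop
      exact intervalIntegral.integral_mono_interval (by linarith [hv.1]) (by linarith)
        (by linarith [hv.2]) (Eventually.of_forall fun t => sq_nonneg _) (hc.intervalIntegrable _ _))
  simp only [one_mul, intervalIntegral.integral_const, smul_eq_mul, mul_one, sub_zero] at hsq
  have hc1 := continuous_integral_add_right continuous_XHL H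
  have hc2 := continuous_gapMain T H m
  have hc3 := continuous_integral_add_right hfc H
  have hmono : ∫ t in T..(T + U), ((∫ h in (0 : ℝ)..H, XHL (t + h)) - gapMain T H m t) ^ 2 ≤
      ∫ t in T..(T + U), (2 * (∫ h in (0 : ℝ)..H, f (t + h)) ^ 2 +
        2 * (12 * critAmp * (1 / x ^ 3)) ^ 2) := by
    refine intervalIntegral.integral_mono_on hAB ((hc1.sub hc2).pow 2 |>.intervalIntegrable _ _)
      (((continuous_const.mul (hc3.pow 2)).add continuous_const).intervalIntegrable _ _)
      fun t ht => ?_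
    have h1 := abs_le.mp (hE t ht)
    set a := (∫ h in (0 : ℝ)..H, XHL (t + h)) - gapMain T H m t
    set b := ∫ h in (0 : ℝ)..H, f (t + h)
    set δ := 12 * critAmp * (1 / x ^ 3)
    have h2 : (a - b) ^ 2 ≤ δ ^ 2 := sq_le_sq' h1.1 h1.2
    nlinarith [sq_nonneg (a - 2 * b)]
  refine hmono.trans ?_
  have hc4 : Continuous fun t => 2 * (∫ h in (0 : ℝ)..H, f (t + h)) ^ 2 :=
    continuous_const.mul (hc3.pow 2)
  rw [intervalIntegral.integral_add (hc4.intervalIntegrable _ _)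
    (Continuous.intervalIntegrable (by fun_prop) _ _), intervalIntegral.integral_const_mul,
    intervalIntegral.integral_const, smul_eq_mul]
  have h6 : H ^ 2 * (C * U / x ^ 8) ≤ C * U / x ^ 6 := by
    calc H ^ 2 * (C * U / x ^ 8) ≤ x ^ 2 * (C * U / x ^ 8) := by gcongr
      _ = _ := by field_simp
  have h7 : (T + U - T) * (2 * (12 * critAmp * (1 / x ^ 3)) ^ 2) =
      2 * (12 * critAmp) ^ 2 * U / x ^ 6 := by field_simp; ring
  have e : (2 * C + 2 * (12 * critAmp) ^ 2) * U / x ^ 6 =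
      2 * (C * U / x ^ 6) + 2 * (12 * critAmp) ^ 2 * U / x ^ 6 := by ring
  rw [h7, e]
  linarith

lemma MeanSqData.one_le_log {y x U H : ℝ} (h : MeanSqData y x U H) :
    1 ≤ Real.log (y ^ 20) := by
  obtain ⟨hx, hxy, -, -, -, -, -⟩ := h
  have hx1 : 1 ≤ x := by linarith
  have hxly : x ≤ y := (le_self_pow₀ hx1 (by norm_num)).trans hxy
  have hy1 : 1 ≤ y := by linarith
  have h1 : y ≤ y ^ 20 := le_self_pow₀ hy1 (by norm_num)
  rw [Real.le_log_iff_exp_le (by positivity)]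
  have := Real.exp_one_lt_d9
  linarith

lemma MeanSqData.abs_sum_sub_le {y x U H : ℝ} (h : MeanSqData y x U H) {m : ℕ}
    (hm1 : (m : ℝ) + 1 ≤ afeLength (y ^ 20))
    (hm2 : afeLength (y ^ 20) * Real.exp (-(1 / x ^ 8)) ≤ m + 1) :
    |(∑ n ∈ Finset.Icc 1 m, ‖gapInt H (Real.log (afeLength (y ^ 20) / n))‖ ^ 2 / n) -
      Real.pi * H| ≤ 180 / Real.log (y ^ 20) := by
  have hN := h.afeLength_le.2
  have hl1 := h.one_le_log
  obtain ⟨hx, hxy, hlog, -, -, hH, hHx⟩ := h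
  have hx0 : 0 < x := by linarith
  have hx1 : 1 ≤ x := by linarith
  have hxly : x ≤ y := (le_self_pow₀ hx1 (by norm_num)).trans hxy
  have hy1 : 1 ≤ y := by linarith
  have hy0 : 0 < y := by linarith
  set N := afeLength (y ^ 20)
  set l := Real.log (y ^ 20) with hl
  have hy10 : y * y ^ 5 * y ^ 4 = y ^ 10 := by ring
  have hy4 : 1 ≤ y ^ 4 := one_le_pow₀ hy1
  have hy5 : 1 ≤ y ^ 5 := one_le_pow₀ hy1
  have hN5 : 16 * y ^ 5 ≤ N := by
    have h1 : 64 * y ^ 5 * 1 ≤ y * y ^ 5 * y ^ 4 := by gcongr; linarith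
    linarith
  refine (abs_sum_norm_sq_gapInt_sub_le (κ := x ^ 8) hH.le (one_le_pow₀ hx1) (by linarith)
    hm1 hm2).trans ?_
  have hlogN : l / 4 ≤ Real.log N := by
    have h1 : Real.log (y ^ 5) ≤ Real.log N := Real.log_le_log (by positivity) (by linarith)
    rw [Real.log_pow] at h1
    rw [hl, Real.log_pow]
    push_cast at h1 ⊢
    linarith
  have hl0 : 0 < l := by linarith
  have h1x : 1 / x ≤ 1 / l := one_div_le_one_div_of_le hl0 hlog
  have t1 : 40 / Real.log N ≤ 160 * (1 / l) := by
    calc 40 / Real.log N ≤ 40 / (l / 4) := by gcongr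
      _ = _ := by field_simp; norm_num
  have t2 : H ^ 2 / x ^ 8 ≤ 1 / l := by
    refine le_trans ?_ h1x
    rw [div_le_div_iff₀ (by positivity) hx0]
    calc H ^ 2 * x ≤ x ^ 2 * x := by gcongr
      _ = x ^ 3 := by ring
      _ ≤ x ^ 8 := pow_le_pow_right₀ hx1 (by norm_num)
      _ = _ := by ring
  have t3 : 2 * (2 * H ^ 3 + H ^ 2) / √N ≤ 6 * (1 / l) := by
    have hs : y ^ 2 ≤ √N := by
      refine Real.le_sqrt_of_sq_le ?_
      have : y ^ 4 ≤ y ^ 5 := pow_le_pow_right₀ hy1 (by norm_num)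
      calc (y ^ 2) ^ 2 = y ^ 4 := by ring
        _ ≤ N := by linarith
    have h2 : 2 * H ^ 3 + H ^ 2 ≤ 3 * x ^ 3 := by
      have h3 : H ^ 3 ≤ x ^ 3 := by gcongr
      have h4 : H ^ 2 ≤ x ^ 2 := by gcongr
      have h5 : x ^ 2 ≤ x ^ 3 := pow_le_pow_right₀ hx1 (by norm_num)
      linarith
    have h6 : x ^ 4 ≤ y ^ 2 :=
      ((pow_le_pow_right₀ hx1 (by norm_num)).trans hxy).trans (le_self_pow₀ hy1 (by norm_num))
    calc 2 * (2 * H ^ 3 + H ^ 2) / √N ≤ 2 * (3 * x ^ 3) / x ^ 4 := by gcongr; linarith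
      _ = 6 * (1 / x) := by field_simp; norm_num
      _ ≤ _ := by gcongr
  have hl' : 0 < 1 / l := by positivity
  calc _ ≤ 160 * (1 / l) + 1 / l + 6 * (1 / l) := by gcongr
    _ ≤ 180 * (1 / l) := by linarith
    _ = _ := by ring

lemma two_mul_critAmp_sq : 2 * critAmp ^ 2 = √(2 * Real.pi) := by
  rw [critAmp_sq, show 2 * Real.pi = 2 ^ 2 * (Real.pi / 2) by ring, Real.sqrt_mul (by norm_num),
    Real.sqrt_sq (by norm_num)]

lemma MeanSqData.abs_integral_gapMain_sq_sub_le {y x U H : ℝ} (h : MeanSqData y x U H) {m : ℕ}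
    (hm1 : (m : ℝ) + 1 ≤ afeLength (y ^ 20))
    (hm2 : afeLength (y ^ 20) * Real.exp (-(1 / x ^ 8)) ≤ m + 1)
    (hm3 : (m : ℝ) ≤ afeLength (y ^ 20) * Real.exp (-(1 / x ^ 8))) (hm0 : 0 < m) :
    |(∫ t in (y ^ 20)..(y ^ 20 + U), gapMain (y ^ 20) H m t ^ 2) -
      Real.pi * √(2 * Real.pi) * H * U| ≤ √(2 * Real.pi) * 2000 * U / Real.log (y ^ 20) := by
  have hS := h.abs_sum_sub_le hm1 hm2
  have hl1 := h.one_le_log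
  have hNle := h.afeLength_le.1
  have hmy : (m : ℝ) ≤ y ^ 10 := by
    have : 0 ≤ y ^ 10 := by positivity
    linarith
  have hlogm := h.one_add_log_le hm0 (by have : 0 ≤ y ^ 10 := by positivity
                                         linarith)
  obtain ⟨hx, hxy, hlog, hU1, hU2, hH, hHx⟩ := h
  have hx0 : 0 < x := by linarith
  have hx1 : 1 ≤ x := by linarith
  have hxly : x ≤ y := (le_self_pow₀ hx1 (by norm_num)).trans hxy
  have hy0 : 0 < y := by linarith
  have hU0 : 0 < U := lt_of_lt_of_le (by positivity) hU1
  have hmain := abs_integral_main_sq_sub_le (T := y ^ 20) (U := U) (κ := x ^ 8) (H := H) (m := m)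
    (by positivity) hU0.le (by positivity) hH.le hm3
  set S := ∑ n ∈ Finset.Icc 1 m, ‖gapInt H (Real.log (afeLength (y ^ 20) / n))‖ ^ 2 / n with hSdef
  set l := Real.log (y ^ 20) with hl
  have hl0 : 0 < l := by linarith
  have hA2 := two_mul_critAmp_sq
  have hA0 : 0 ≤ √(2 * Real.pi) := Real.sqrt_nonneg _
  have h1x : 1 / x ≤ 1 / l := one_div_le_one_div_of_le hl0 hlog
  have hSx : S ≤ 7 * x := by
    have h1 : 180 / l ≤ 180 := div_le_self (by norm_num) hl1
    have h2 := (abs_le.mp hS).2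
    have h3 : Real.pi * H ≤ 4 * x := by
      have := Real.pi_lt_four
      gcongr
    linarith
  have hS0 : 0 ≤ S := Finset.sum_nonneg fun n _ => by positivity
  have hUx : y ^ 10 ≤ U / x ^ 20 := by
    rw [le_div_iff₀ (by positivity)]; linarith
  have t1 : 4 * m * (1 + Real.log m) * S ≤ 56 * (U * (1 / l)) := by
    have : 0 ≤ 1 + Real.log m := by
      have := Real.log_natCast_nonneg m
      linarith
    calc 4 * m * (1 + Real.log m) * S ≤ 4 * (U / x ^ 20) * (2 * x) * (7 * x) := by
          gcongr; linarith
      _ = 56 * (U * (1 / x ^ 18)) := by field_simp; norm_num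
      _ ≤ 56 * (U * (1 / x)) := by
          have : x ≤ x ^ 18 := le_self_pow₀ hx1 (by norm_num)
          gcongr
      _ ≤ _ := by gcongr
  have t2 : x ^ 8 * H ^ 2 * m ≤ U * (1 / l) := by
    calc x ^ 8 * H ^ 2 * m ≤ x ^ 8 * x ^ 2 * (U / x ^ 20) := by
          gcongr; linarith
      _ = U * (1 / x ^ 10) := by field_simp
      _ ≤ U * (1 / x) := by
          have : x ≤ x ^ 10 := le_self_pow₀ hx1 (by norm_num)
          gcongr
      _ ≤ _ := by gcongr
  have e12 : 12 * critAmp ^ 2 * x ^ 8 * H ^ 2 * m = 6 * √(2 * Real.pi) * (x ^ 8 * H ^ 2 * m) := by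
    rw [← hA2]; ring
  rw [e12, hA2] at hmain
  have t3 : |√(2 * Real.pi) * (U * S) - Real.pi * √(2 * Real.pi) * H * U| ≤
      √(2 * Real.pi) * (U * (180 * (1 / l))) := by
    rw [show √(2 * Real.pi) * (U * S) - Real.pi * √(2 * Real.pi) * H * U =
      √(2 * Real.pi) * (U * (S - Real.pi * H)) by ring, abs_mul, abs_mul, abs_of_nonneg hA0,
      abs_of_pos hU0, mul_one_div]
    gcongr
  have htri := abs_sub_le (∫ t in (y ^ 20)..(y ^ 20 + U), gapMain (y ^ 20) H m t ^ 2)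
    (√(2 * Real.pi) * (U * S)) (Real.pi * √(2 * Real.pi) * H * U)
  have hmain' : |(∫ t in (y ^ 20)..(y ^ 20 + U), gapMain (y ^ 20) H m t ^ 2) -
      √(2 * Real.pi) * (U * S)| ≤ √(2 * Real.pi) * (56 * (U * (1 / l))) +
        6 * √(2 * Real.pi) * (U * (1 / l)) := hmain.trans (by gcongr)
  have hq : 0 ≤ √(2 * Real.pi) * (U * (1 / l)) := by positivity
  have e : √(2 * Real.pi) * 2000 * U / l = 2000 * (√(2 * Real.pi) * (U * (1 / l))) := by ring
  rw [e]
  refine htri.trans ((add_le_add hmain' t3).trans ?_)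
  linarith

theorem exists_abs_integral_sq_integral_XHL_sub_le :
    ∃ C > 0, ∀ y x U H : ℝ, MeanSqData y x U H →
      |(∫ t in (y ^ 20)..(y ^ 20 + U), (∫ u in t..(t + H), XHL u) ^ 2) -
        Real.pi * √(2 * Real.pi) * H * U| ≤ C * U / Real.log (y ^ 20) := by
  obtain ⟨C, hC, hA⟩ := exists_integral_sq_sub_gapMain_le
  refine ⟨√(2 * Real.pi) * 5000 + 2 * C, by positivity, fun y x U H h => ?_⟩
  obtain ⟨m, P, hd, hm1, hm2, hm3, hmκ, hmP, hP, hPy⟩ := h.exists_params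
  have hR := hA y x U H m P h hd hm1 hm2 hmκ hmP hP hPy
  have hl1 := h.one_le_log
  have hx := h.hx
  have hx1 : 1 ≤ x := by linarith
  have hm0 : 0 < m := by
    have h1 : x ≤ x ^ 8 := le_self_pow₀ hx1 (by norm_num)
    exact_mod_cast (show (0 : ℝ) < m by linarith)
  have hY := h.abs_integral_gapMain_sq_sub_le hm1 hm2 hm3 hm0
  obtain ⟨-, hxy, hlog, hU1, hU2, hH, hHx⟩ := h
  have hx0 : 0 < x := by linarith
  have hxly : x ≤ y := (le_self_pow₀ hx1 (by norm_num)).trans hxy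
  have hy0 : 0 < y := by linarith
  have hU0 : 0 < U := lt_of_lt_of_le (by positivity) hU1
  have hI : ∀ t, ∫ u in t..(t + H), XHL u = ∫ h in (0 : ℝ)..H, XHL (t + h) := fun t => by
    rw [intervalIntegral.integral_comp_add_left]; simp
  simp_rw [hI]
  have hcmp := abs_integral_sq_sub_integral_sq_le (continuous_integral_add_right continuous_XHL H)
    (continuous_gapMain (y ^ 20) H m) (A := y ^ 20) (B := y ^ 20 + U) (ε := 1 / x ^ 2)
    (by linarith) (by positivity)
  set l := Real.log (y ^ 20)
  set J := ∫ t in (y ^ 20)..(y ^ 20 + U), gapMain (y ^ 20) H m t ^ 2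
  set E := ∫ t in (y ^ 20)..(y ^ 20 + U),
    ((∫ h in (0 : ℝ)..H, XHL (t + h)) - gapMain (y ^ 20) H m t) ^ 2
  set I := ∫ t in (y ^ 20)..(y ^ 20 + U), (∫ h in (0 : ℝ)..H, XHL (t + h)) ^ 2
  set A := √(2 * Real.pi) with hAdef
  have hA0 : 0 ≤ A := Real.sqrt_nonneg _
  have hl0 : 0 < l := by linarith
  have h1x : 1 / x ≤ 1 / l := one_div_le_one_div_of_le hl0 hlog
  have hJ : J ≤ A * 2004 * U * x := by
    have h1 := (abs_le.mp hY).2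
    have h2 : A * 2000 * U / l ≤ A * 2000 * U := div_le_self (by positivity) hl1
    have h3 : Real.pi * A * H * U ≤ 4 * A * x * U := by
      have := Real.pi_lt_four
      gcongr
    have h4 : A * 2000 * U ≤ A * 2000 * U * x := le_mul_of_one_le_right (by positivity) hx1
    linarith
  have t1 : 1 / x ^ 2 * J ≤ A * 2004 * U * (1 / l) := by
    calc 1 / x ^ 2 * J ≤ 1 / x ^ 2 * (A * 2004 * U * x) := by gcongr
      _ = A * 2004 * U * (1 / x) := by field_simp
      _ ≤ _ := by gcongr
  have t2 : (1 + 1 / (1 / x ^ 2)) * E ≤ 2 * C * U * (1 / l) := by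
    have h5 : 1 ≤ x ^ 2 := one_le_pow₀ hx1
    have hE0 : 0 ≤ E := intervalIntegral.integral_nonneg (by linarith) fun t _ => sq_nonneg _
    calc (1 + 1 / (1 / x ^ 2)) * E ≤ (x ^ 2 + x ^ 2) * (C * U / x ^ 6) := by
          rw [one_div_one_div]; gcongr
      _ = 2 * C * U * (1 / x ^ 4) := by field_simp; ring
      _ ≤ 2 * C * U * (1 / x) := by
          have : x ≤ x ^ 4 := le_self_pow₀ hx1 (by norm_num)
          gcongr
      _ ≤ _ := by gcongr
  have htri := abs_sub_le I J (Real.pi * A * H * U)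
  have hq : 0 ≤ A * U * (1 / l) := by positivity
  have e : (A * 5000 + 2 * C) * U / l = 5000 * (A * U * (1 / l)) + 2 * C * U * (1 / l) := by ring
  have e2 : A * 2000 * U / l = 2000 * (A * U * (1 / l)) := by ring
  rw [e]
  rw [e2] at hY
  linarith

lemma exists_abs_integral_sq_sub_le_of_le_three_mul {a : ℝ} (ha : 1 / 2 < a) (ha' : a ≤ 3 / 5) :
    ∃ C > 0, ∃ T₀ ≥ 2, ∀ T ≥ T₀, ∀ U H : ℝ, T ^ a ≤ U → U ≤ 3 * T ^ a → 0 < H →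
      H ≤ T ^ ((a - 1 / 2) / 100) →
      |(∫ t in T..(T + U), (∫ u in t..(t + H), XHL u) ^ 2) -
        Real.pi * √(2 * Real.pi) * H * U| ≤ C * U / Real.log T := by
  obtain ⟨C, hC, hA⟩ := exists_abs_integral_sq_integral_XHL_sub_le
  set ε := (a - 1 / 2) / 100 with hε
  have hε0 : 0 < ε := by rw [hε]; linarith
  have h64 : ∀ᶠ T : ℝ in atTop, 64 ≤ T ^ ε := (tendsto_rpow_atTop hε0).eventually_ge_atTop 64
  have hlog : ∀ᶠ T : ℝ in atTop, Real.log T ≤ T ^ ε := by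
    filter_upwards [(isLittleO_log_rpow_atTop hε0).bound one_pos, eventually_ge_atTop 1] with T hT hT1
    have h1 : 0 ≤ T ^ ε := by positivity
    rw [one_mul, Real.norm_of_nonneg h1] at hT
    exact (le_abs_self _).trans hT
  obtain ⟨T₁, hT₁⟩ := eventually_atTop.mp (h64.and hlog)
  refine ⟨C, hC, max T₁ 2, le_max_right _ _, fun T hT U H hU1 hU2 hH hHT => ?_⟩
  obtain ⟨hT64, hTlog⟩ := hT₁ T ((le_max_left _ _).trans hT)
  have hT2 : 2 ≤ T := (le_max_right _ _).trans hT
  have hT0 : 0 < T := by linarith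
  have hT1 : 1 ≤ T := by linarith
  have hpow : ∀ (b : ℝ) (k : ℕ), (T ^ b) ^ k = T ^ (b * k) := fun b k => by
    rw [Real.rpow_mul hT0.le, Real.rpow_natCast]
  have hy20 : (T ^ (1 / 20 : ℝ)) ^ 20 = T := by
    rw [hpow]; norm_num
  have hmean : MeanSqData (T ^ (1 / 20 : ℝ)) (T ^ ε) U H := by
    refine ⟨hT64, ?_, ?_, ?_, ?_, hH, hHT⟩
    · rw [hpow]
      exact Real.rpow_le_rpow_of_exponent_le hT1 (by push_cast; rw [hε]; linarith)
    · rw [hy20]; exact hTlog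
    · rw [hpow, hpow, ← Real.rpow_add hT0]
      refine (Real.rpow_le_rpow_of_exponent_le hT1 ?_).trans hU1
      push_cast; rw [hε]; linarith
    · rw [hpow]
      refine hU2.trans ?_
      gcongr
      push_cast; linarith
  have := hA _ _ _ _ hmean
  rwa [hy20] at this

lemma exists_abs_integral_sq_sub_le_of_le {a : ℝ} (ha : 1 / 2 < a) (ha' : a ≤ 3 / 5) :
    ∃ C > 0, ∃ T₀ ≥ 2, ∀ T ≥ T₀, ∀ U H : ℝ, T ^ a ≤ U → 0 < H →
      H ≤ T ^ ((a - 1 / 2) / 100) →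
      |(∫ t in T..(T + U), (∫ u in t..(t + H), XHL u) ^ 2) -
        Real.pi * √(2 * Real.pi) * H * U| ≤ C * U / Real.log T := by
  obtain ⟨C, hC, T₀, hT₀, hA⟩ := exists_abs_integral_sq_sub_le_of_le_three_mul ha ha'
  refine ⟨C, hC, T₀, hT₀, ?_⟩
  suffices h : ∀ n : ℕ, ∀ T ≥ T₀, ∀ U H : ℝ, U ≤ n → T ^ a ≤ U → 0 < H →
      H ≤ T ^ ((a - 1 / 2) / 100) →
      |(∫ t in T..(T + U), (∫ u in t..(t + H), XHL u) ^ 2) -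
        Real.pi * √(2 * Real.pi) * H * U| ≤ C * U / Real.log T by
    intro T hT U H
    exact h ⌈U⌉₊ T hT U H (Nat.le_ceil U)
  intro n
  induction n with
  | zero =>
    intro T hT U H hUn hU
    have hT0 : 0 < T := by linarith
    have : 0 < T ^ a := by positivity
    norm_num at hUn
    linarith
  | succ n ih =>
    intro T hT U H hUn hU hH hHT
    have hT2 : 2 ≤ T := by linarith
    have hT0 : 0 < T := by linarith
    have hT1 : 1 ≤ T := by linarith
    by_cases hU3 : U ≤ 3 * T ^ a
    · exact hA T hT U H hU hU3 hH hHT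
    push Not at hU3
    set V := T ^ a with hV
    have hV1 : 1 ≤ V := Real.one_le_rpow hT1 (by linarith)
    have hVT : V ≤ T := by
      calc V ≤ T ^ (1 : ℝ) := Real.rpow_le_rpow_of_exponent_le hT1 (by linarith)
        _ = T := Real.rpow_one T
    have hW : (T + V) ^ a ≤ U - V := by
      calc (T + V) ^ a ≤ (2 * T) ^ a := by
            apply Real.rpow_le_rpow (by linarith) (by linarith) (by linarith)
        _ = 2 ^ a * V := Real.mul_rpow (by norm_num) hT0.le
        _ ≤ 2 ^ (1 : ℝ) * V := by
            gcongr
            · norm_num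
            · linarith
        _ ≤ U - V := by rw [Real.rpow_one]; linarith
    have h1 := hA T hT V H le_rfl (by linarith) hH hHT
    have hHT' : H ≤ (T + V) ^ ((a - 1 / 2) / 100) :=
      hHT.trans (Real.rpow_le_rpow hT0.le (by linarith) (by linarith))
    push_cast at hUn
    have h2 := ih (T + V) (by linarith) (U - V) H (by linarith) hW hH hHT'
    have hlog : 0 < Real.log T := Real.log_pos (by linarith)
    have h3 : C * (U - V) / Real.log (T + V) ≤ C * (U - V) / Real.log T := by
      have hUV : 0 ≤ U - V := by linarith
      have := Real.log_le_log hT0 (show T ≤ T + V by linarith)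
      gcongr
    have hI : ∀ t, ∫ u in t..(t + H), XHL u = ∫ h in (0 : ℝ)..H, XHL (t + h) := fun t => by
      rw [intervalIntegral.integral_comp_add_left]; simp
    have hc : Continuous fun t => (∫ u in t..(t + H), XHL u) ^ 2 := by
      simp_rw [hI]
      exact (continuous_integral_add_right continuous_XHL H).pow 2
    have hsplit := intervalIntegral.integral_add_adjacent_intervals
      (hc.intervalIntegrable (μ := MeasureTheory.volume) T (T + V))
      (hc.intervalIntegrable (μ := MeasureTheory.volume) (T + V) (T + V + (U - V)))
    rw [show T + V + (U - V) = T + U by ring] at hsplit h2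
    rw [← hsplit]
    set I₁ := ∫ t in T..(T + V), (∫ u in t..(t + H), XHL u) ^ 2
    set I₂ := ∫ t in (T + V)..(T + U), (∫ u in t..(t + H), XHL u) ^ 2
    have e : C * U / Real.log T = C * V / Real.log T + C * (U - V) / Real.log T := by ring
    have e2 : I₁ + I₂ - Real.pi * √(2 * Real.pi) * H * U =
        (I₁ - Real.pi * √(2 * Real.pi) * H * V) + (I₂ - Real.pi * √(2 * Real.pi) * H * (U - V)) := by
      ring
    rw [e, e2]
    exact (abs_add_le _ _).trans (add_le_add h1 (h2.trans h3))

/-- Hardy–Littlewood Lemma 18. -/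
theorem hardy_littlewood_lemma18 (a b : ℝ) (ha : 1/2 < a) (hab : a ≤ b) :
    ∃ c₀ > (0:ℝ), ∀ c : ℝ, 0 < c → c ≤ c₀ →
      ∃ C > (0:ℝ), ∃ T₀ > (0:ℝ), ∀ T ≥ T₀, ∀ U : ℝ, T ^ a ≤ U → U ≤ T ^ b →
        ∀ H : ℝ, 0 < H → H ≤ T ^ c →
          |(∫ t in T..(T + U), (∫ u in t..(t + H), XHL u) ^ 2) -
              Real.pi * Real.sqrt (2 * Real.pi) * H * U| ≤ C * U / Real.log T := by
  have ha1 : 1 / 2 < min a (3 / 5) := lt_min ha (by norm_num)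
  obtain ⟨C, hC, T₀, hT₀, hA⟩ := exists_abs_integral_sq_sub_le_of_le ha1 (min_le_right _ _)
  refine ⟨(min a (3 / 5) - 1 / 2) / 100, by linarith, fun c _ hc => ⟨C, hC, T₀, by linarith,
    fun T hT U hU _ H hH hHT => ?_⟩⟩
  have hT1 : 1 ≤ T := by linarith
  exact hA T hT U H ((Real.rpow_le_rpow_of_exponent_le hT1 (min_le_left _ _)).trans hU) hH
    (hHT.trans (Real.rpow_le_rpow_of_exponent_le hT1 hc))
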